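/- Assume GRH. Let p be a prime with p ≥ 10^9, set x = ((8/5)·(2^{ω(p−1)} − 1)·log p)², and suppose that no prime power n with n < x is a primitive root modulo p. Then √x ≤ 1/10 + 6/√x + (14/9)·(2^{ω(p−1)} − 1)·log p. -/

import Mathlib

/-- The Generalized Riemann Hypothesis: for every Dirichlet character `χ` (to any modulus),
every zero `s` of the Dirichlet L-function `L(s, χ)` with `0 < Re s < 1` has `Re s = 1/2`. -/
def GRH : Prop :=
  ∀ (N : ℕ) (_ : NeZero N) (χ : DirichletCharacter ℂ N) (s : ℂ),
    DirichletCharacter.LFunction χ s = 0 → 0 < s.re → s.re < 1 → s.re = 1 / 2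

section P1
open Complex

lemma log_norm_concave_aux (a τ h : ℝ) (ha : 0 < a) (h0 : 0 ≤ h) (h1 : h ≤ 1) :
    (1-h) * Real.log (a^2+τ^2) + h * Real.log ((a+1)^2+τ^2) - h / a^2
      ≤ Real.log ((a+h)^2+τ^2) := by
  have hpos : ∀ u : ℝ, 0 ≤ u → 0 < (a+u)^2+τ^2 := fun u hu => by positivity
  set G : ℝ → ℝ := fun u => Real.log ((a+u)^2+τ^2) - u^2 / a^2 with hG
  have hd : ∀ u : ℝ, 0 ≤ u → HasDerivAt G (2*(a+u)/((a+u)^2+τ^2) - 2*u/a^2) u := by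
    intro u hu
    have h1 : HasDerivAt (fun u : ℝ => (a+u)^2+τ^2) (2*(a+u)) u := by
      have := (((hasDerivAt_id u).const_add a).pow 2).add_const (τ^2)
      simpa using this
    have h2 := h1.log (hpos u hu).ne'
    have h3 : HasDerivAt (fun u : ℝ => u^2 / a^2) (2*u/a^2) u := by
      have := ((hasDerivAt_id u).pow 2).div_const (a^2)
      simpa using this
    exact h2.sub h3
  have hconc : ConcaveOn ℝ (Set.Icc 0 1) G := by
    apply AntitoneOn.concaveOn_of_deriv (convex_Icc 0 1)
    · intro u hu
      exact (hd u hu.1).continuousAt.continuousWithinAt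
    · intro u hu
      rw [interior_Icc] at hu
      exact (hd u hu.1.le).differentiableAt.differentiableWithinAt
    · intro u hu v hv huv
      rw [interior_Icc] at hu hv
      rw [(hd u hu.1.le).deriv, (hd v hv.1.le).deriv]
      have hA := hpos u hu.1.le
      have hB := hpos v hv.1.le
      have e1 : 2*(a+v)/((a+v)^2+τ^2) - 2*(a+u)/((a+u)^2+τ^2)
          = 2*(v-u)*(τ^2-(a+u)*(a+v))/(((a+v)^2+τ^2)*((a+u)^2+τ^2)) := by
        field_simp; ring
      have e2 : 2*(v-u)*(τ^2-(a+u)*(a+v))/(((a+v)^2+τ^2)*((a+u)^2+τ^2)) ≤ 2*(v-u)/a^2 := by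
        rw [div_le_div_iff₀ (by positivity) (by positivity)]
        have hu0 := hu.1.le
        have hv0 := hv.1.le
        have k1 : (τ^2-(a+u)*(a+v)) * a^2 ≤ ((a+v)^2+τ^2)*((a+u)^2+τ^2) := by
          have : a^2 ≤ (a+u)^2+τ^2 := by nlinarith [sq_nonneg τ, mul_nonneg ha.le hu0]
          have : τ^2-(a+u)*(a+v) ≤ (a+v)^2+τ^2 := by
            nlinarith [mul_pos (by linarith : 0 < a+u) (by linarith : 0 < a+v), sq_nonneg (a+v)]
          calc (τ^2-(a+u)*(a+v)) * a^2 ≤ ((a+v)^2+τ^2) * a^2 := by gcongr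
            _ ≤ _ := by gcongr
        nlinarith [mul_le_mul_of_nonneg_left k1 (by linarith : 0 ≤ 2*(v-u))]
      have e3 : 2*v/a^2 - 2*u/a^2 = 2*(v-u)/a^2 := by ring
      linarith
  have := hconc.2 (show (0:ℝ) ∈ Set.Icc (0:ℝ) 1 by simp) (show (1:ℝ) ∈ Set.Icc (0:ℝ) 1 by simp) (show (0:ℝ) ≤ 1-h by linarith) h0 (by ring)
  simp only [hG, smul_eq_mul, mul_zero, mul_one, zero_add, add_zero] at this
  have e : h^2/a^2 ≥ 0 := by positivity
  have e' : h * ((1:ℝ)^2/a^2) = h/a^2 := by ring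
  have e'' : (1-h) * ((0:ℝ)^2/a^2) = 0 := by simp
  nlinarith

lemma norm_ratio_aux (w : ℂ) (hw : 0 < w.re) (h : ℝ) (h0 : 0 ≤ h) (h1 : h ≤ 1) :
    (1-h) * Real.log ‖w‖ + h * Real.log ‖w+1‖ - h / (2*w.re^2) ≤ Real.log ‖w + h‖ := by
  have key := log_norm_concave_aux w.re w.im h hw h0 h1
  have e : ∀ u : ℝ, Real.log ((w.re+u)^2+w.im^2) = 2 * Real.log ‖w + u‖ := by
    intro u
    have : (w.re+u)^2+w.im^2 = ‖w+u‖^2 := by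
      rw [← Complex.normSq_eq_norm_sq, Complex.normSq_apply]; simp; ring
    rw [this, Real.log_pow]; norm_num
  have e0 := e 0
  have e1 := e 1
  have eh := e h
  simp only [add_zero, ofReal_zero, ofReal_one] at e0 e1
  rw [e0, e1, eh] at key
  have : h / w.re^2 = 2 * (h / (2*w.re^2)) := by field_simp
  linarith

lemma gammaSeq_ratio (w : ℂ) (hw : 1/2 < w.re) (h : ℝ) (h0 : 0 ≤ h) (h1 : h ≤ 1) (n : ℕ)
    (hn : n ≠ 0) :
    ‖GammaSeq (w+h) n‖ ≤ ‖GammaSeq w n‖ * Real.exp (h * (Real.log ‖w‖ + 1/(2*w.re-1))) := by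
  have hre : ∀ k : ℕ, 0 < (w + k).re := fun k => by
    simp only [add_re, natCast_re]
    have : (0:ℝ) ≤ k := by positivity
    linarith
  have hne : ∀ k : ℕ, w + k ≠ 0 := fun k hk => by have := hre k; rw [hk] at this; simp at this
  have hne' : ∀ k : ℕ, w + h + k ≠ 0 := fun k hk => by
    have := hre k
    have h2 : (w + h + k).re = (w+k).re + h := by simp; ring
    rw [hk] at h2; simp at h2; simp at this; linarith
  -- product inequality in log form
  have key : ∀ m : ℕ, ∑ k ∈ Finset.range m, (Real.log ‖w + k‖ - Real.log ‖w+h+k‖)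
      ≤ h * (Real.log ‖w‖ - Real.log ‖w + m‖) + h * (1/(2*w.re-1) - 1/(2*(w.re+m)-1)) := by
    intro m
    induction m with
    | zero => simp
    | succ m ih =>
      rw [Finset.sum_range_succ]
      have h3 := norm_ratio_aux (w+m) (hre m) h h0 h1
      have e1 : w + m + h = w + h + m := by ring
      have e2 : w + m + 1 = w + ((m+1 : ℕ) : ℂ) := by push_cast; ring
      rw [e1, e2] at h3
      have hr : (w + m).re = w.re + m := by simp
      rw [hr] at h3
      have hm : (0:ℝ) ≤ m := by positivity
      have h4 : 1/(2*(w.re+m)^2) ≤ 1/(2*(w.re+m)-1) - 1/(2*(w.re+(m+1:ℕ))-1) := by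
        push_cast
        have p1 : 0 < 2*(w.re+m)-1 := by linarith
        have p2 : 0 < 2*(w.re+(m+1))-1 := by linarith
        rw [div_sub_div _ _ p1.ne' p2.ne', div_le_div_iff₀ (by nlinarith) (by positivity)]
        nlinarith
      have h5 := mul_le_mul_of_nonneg_left h4 h0
      have h6 : h / (2*(w.re+m)^2) = h * (1/(2*(w.re+m)^2)) := by ring
      rw [h6] at h3
      linarith
  have hk := key (n+1)
  have hwn : (n:ℝ) ≤ ‖w + (n+1:ℕ)‖ := by
    refine le_trans ?_ (Complex.re_le_norm _)
    simp; linarith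
  have hn0 : (0:ℝ) < n := by positivity
  have hlogn : Real.log n ≤ Real.log ‖w + (n+1:ℕ)‖ := Real.log_le_log hn0 hwn
  have hp2 : 0 ≤ 1/(2*(w.re+(n+1:ℕ))-1) := by
    apply div_nonneg zero_le_one; push_cast; linarith
  unfold GammaSeq
  rw [norm_div, norm_div, norm_mul, norm_mul, norm_prod, norm_prod]
  rw [norm_natCast_cpow_of_pos (by omega), norm_natCast_cpow_of_pos (by omega)]
  have hP : 0 < ∏ j ∈ Finset.range (n+1), ‖w+j‖ := Finset.prod_pos fun j _ => norm_pos_iff.2 (hne j)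
  have hP' : 0 < ∏ j ∈ Finset.range (n+1), ‖w+h+j‖ :=
    Finset.prod_pos fun j _ => norm_pos_iff.2 (hne' j)
  have hl : Real.log (∏ j ∈ Finset.range (n+1), ‖w+j‖) - Real.log (∏ j ∈ Finset.range (n+1), ‖w+h+j‖)
      = ∑ k ∈ Finset.range (n+1), (Real.log ‖w + k‖ - Real.log ‖w+h+k‖) := by
    rw [Real.log_prod (fun j _ => (norm_pos_iff.2 (hne j)).ne'),
      Real.log_prod (fun j _ => (norm_pos_iff.2 (hne' j)).ne'), Finset.sum_sub_distrib]
  have hfac : (0:ℝ) < ‖((n.factorial : ℕ):ℂ)‖ := by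
    rw [Complex.norm_natCast]; positivity
  set P := ∏ j ∈ Finset.range (n+1), ‖w+j‖
  set P' := ∏ j ∈ Finset.range (n+1), ‖w+h+j‖
  have hb : (w + h).re = w.re + h := by simp
  rw [hb, Real.rpow_add hn0, Real.rpow_def_of_pos hn0 h]
  have hPe : P = P' * Real.exp (Real.log P - Real.log P') := by
    rw [Real.exp_sub, Real.exp_log hP, Real.exp_log hP']; field_simp
  have hfin : Real.exp (Real.log n * h) * Real.exp (Real.log P - Real.log P')
      ≤ Real.exp (h * (Real.log ‖w‖ + 1/(2*w.re-1))) := by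
    rw [← Real.exp_add]
    apply Real.exp_le_exp.2
    rw [hl]
    nlinarith [mul_le_mul_of_nonneg_left hlogn h0, mul_nonneg h0 hp2]
  rw [div_mul_eq_mul_div, div_le_div_iff₀ hP' hP]
  nth_rewrite 1 [hPe]
  have hA : (0:ℝ) ≤ (n:ℝ)^w.re * ‖((n.factorial : ℕ):ℂ)‖ * P' := by positivity
  nlinarith [mul_le_mul_of_nonneg_left hfin hA]

lemma gamma_ratio_one (w : ℂ) (hw : 1/2 < w.re) (h : ℝ) (h0 : 0 ≤ h) (h1 : h ≤ 1) :
    ‖Gamma (w+h)‖ ≤ ‖Gamma w‖ * Real.exp (h * (Real.log ‖w‖ + 1/(2*w.re-1))) := by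
  have t1 := (GammaSeq_tendsto_Gamma (w+h)).norm
  have t2 := (GammaSeq_tendsto_Gamma w).norm.mul_const
    (Real.exp (h * (Real.log ‖w‖ + 1/(2*w.re-1))))
  refine le_of_tendsto_of_tendsto t1 t2 ?_
  filter_upwards [Filter.eventually_ne_atTop 0] with n hn
  exact gammaSeq_ratio w hw h h0 h1 n hn

/-- Upper bound for ratios of Gamma values. -/
lemma gamma_ratio (z : ℂ) (hz : 0 < z.re) (h : ℝ) (h0 : 0 ≤ h) (h1 : h ≤ 1) :
    ‖Gamma (z+h)‖ ≤ ‖Gamma z‖ * Real.exp (h * (Real.log ‖z+1‖ + 1/(2*z.re+1))) := by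
  have key := gamma_ratio_one (z+1) (by simp; linarith) h h0 h1
  have hz0 : z ≠ 0 := fun h => by rw [h] at hz; simp at hz
  have hzh : z + h ≠ 0 := fun h2 => by
    have : (z + h).re = z.re + h := by simp
    rw [h2] at this; simp at this; linarith
  have e1 : z + 1 + h = (z + h) + 1 := by ring
  rw [e1, Gamma_add_one _ hzh, Gamma_add_one _ hz0, norm_mul, norm_mul] at key
  have e2 : 2 * (z+1).re - 1 = 2*z.re+1 := by simp; ring
  rw [e2] at key
  have hn : ‖z‖ ≤ ‖z + h‖ := by
    rw [← sq_le_sq₀ (norm_nonneg _) (norm_nonneg _), ← normSq_eq_norm_sq, ← normSq_eq_norm_sq,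
      normSq_apply, normSq_apply]
    simp; nlinarith
  have hp : 0 < ‖z‖ := norm_pos_iff.2 hz0
  set X := Real.exp (h * (Real.log ‖z+1‖ + 1/(2*z.re+1)))
  have : ‖z‖ * ‖Gamma (z+h)‖ ≤ ‖z‖ * (‖Gamma z‖ * X) := by
    calc _ ≤ ‖z+h‖ * ‖Gamma (z+h)‖ := by gcongr
      _ ≤ _ := by rw [← mul_assoc]; exact key
  exact le_of_mul_le_mul_left this hp

/-- The inverse ratio is bounded. -/
lemma gamma_ratio_inv (ε h : ℝ) (hε : 0 < ε) (hh : 0 < h) :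
    ∃ C, 0 < C ∧ ∀ z : ℂ, ε ≤ z.re → ‖Gamma z‖ ≤ C * ‖Gamma (z+h)‖ := by
  have hInt := Complex.betaIntegral_convergent (u := ε) (v := h) (by simpa) (by simpa)
  set C0 := ∫ t in (0:ℝ)..1, ‖(t:ℂ)^((ε:ℂ)-1) * (1-(t:ℂ))^((h:ℂ)-1)‖ with hC0
  have hG : 0 < ‖Gamma (h:ℂ)‖ := norm_pos_iff.2 (Gamma_ne_zero_of_re_pos (by simpa))
  have hC0n : 0 ≤ C0 := by
    apply intervalIntegral.integral_nonneg zero_le_one; intro u _; positivity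
  refine ⟨(C0+1) / ‖Gamma (h:ℂ)‖, by positivity, ?_⟩
  intro z hz
  have hzr : 0 < z.re := by linarith
  have hb := Complex.Gamma_mul_Gamma_eq_betaIntegral (s := z) (t := h) hzr (by simpa)
  have hbd : ‖betaIntegral z h‖ ≤ C0 := by
    unfold betaIntegral
    refine intervalIntegral.norm_integral_le_of_norm_le zero_le_one ?_ hInt.norm
    filter_upwards with t
    intro ht
    rw [norm_mul, norm_mul]
    gcongr ?_ * _
    rw [norm_cpow_eq_rpow_re_of_pos ht.1, norm_cpow_eq_rpow_re_of_pos ht.1]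
    apply Real.rpow_le_rpow_of_exponent_ge ht.1 ht.2
    simp; linarith
  have h3 : ‖Gamma z‖ * ‖Gamma (h:ℂ)‖ = ‖Gamma (z+h)‖ * ‖betaIntegral z h‖ := by
    rw [← norm_mul, hb, norm_mul]
  rw [div_mul_eq_mul_div, le_div_iff₀ hG, h3, mul_comm]
  gcongr; linarith

end P1

section P2
open Complex

structure GoodData (M : ℂ → ℂ) (a q : ℝ) : Prop where
  diff : Differentiable ℂ M
  ne : ∀ s : ℂ, 1/2 < s.re → M s ≠ 0
  up : ∃ C, 0 < C ∧ ∀ s : ℂ, 1/4 ≤ s.re → ‖M s‖ ≤ C*(1+‖s‖)^2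
  low : ∃ c, 0 < c ∧ ∀ s : ℂ, 2 ≤ s.re → c ≤ ‖M s‖
  ratio : ∃ C, ∀ x h : ℝ, 3 ≤ x → 0 < h → h < 1/4 → ‖M (x-h)‖ ≤ C * ‖M (x+h)‖
  fe : ∀ s : ℂ, 0 < s.re → s.re < 1 → (q/Real.pi)^(s.re/2) * ‖Gamma ((s+a)/2)‖ * ‖M s‖
    = (q/Real.pi)^((1-s.re)/2) * ‖Gamma ((1-(starRingEnd ℂ) s+a)/2)‖ * ‖M (1-(starRingEnd ℂ) s)‖
  apos : 0 ≤ a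
  qpos : 1 ≤ q

lemma exists_log_ball (M : ℂ → ℂ) (hM : Differentiable ℂ M) (c : ℂ) (r : ℝ) (hr : 0 < r)
    (hne : ∀ s ∈ Metric.ball c r, M s ≠ 0) :
    ∃ F : ℂ → ℂ, F c = 0 ∧ (∀ s ∈ Metric.ball c r, HasDerivAt F (deriv M s / M s) s) ∧
      ∀ s ∈ Metric.ball c r, M s = M c * exp (F s) := by
  have hd : DifferentiableOn ℂ (fun s => deriv M s / M s) (Metric.ball c r) := by
    intro s hs
    have h1 : Differentiable ℂ (deriv M) := (hM.contDiff (n := 2)).differentiable_deriv_two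
    exact ((h1 s).div (hM s) (hne s hs)).differentiableWithinAt
  obtain ⟨F, hFc, hF⟩ := (hd.isExactOn_ball).with_val_at c 0
  refine ⟨F, hFc, hF, ?_⟩
  intro s hs
  have hc : c ∈ Metric.ball c r := Metric.mem_ball_self hr
  have hconst : M s * exp (-(F s)) = M c * exp (-(F c)) := by
    have hder : ∀ u ∈ Metric.ball c r, HasDerivAt (fun u => M u * exp (-(F u))) 0 u := by
      intro u hu
      have h1 := (hM u).hasDerivAt.mul ((hF u hu).neg.cexp)
      have h2 : M u * (deriv M u / M u) = deriv M u := mul_div_cancel₀ _ (hne u hu)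
      have h3 : deriv M u * exp (-(F u)) + M u * (exp (-(F u)) * -(deriv M u / M u)) = 0 := by
        linear_combination -(exp (-(F u))) * h2
      exact h3 ▸ h1
    exact (convex_ball c r).is_const_of_fderivWithin_eq_zero (𝕜 := ℂ)
      (fun u hu => (hder u hu).differentiableAt.differentiableWithinAt)
      (fun u hu => by
        rw [fderivWithin_of_isOpen Metric.isOpen_ball hu]
        have := (hder u hu).hasFDerivAt.fderiv
        rw [this]; ext; simp) hs hc
  rw [hFc] at hconst
  simp only [neg_zero, exp_zero, mul_one] at hconst
  rw [← hconst, mul_assoc, ← exp_add]; simp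

lemma GoodData.inv_growth {M : ℂ → ℂ} {a q : ℝ} (H : GoodData M a q) (h : ℝ) (h0 : 0 < h) :
    ∃ A B, 0 < A ∧ 0 < B ∧ ∀ s : ℂ, 1/2 + h ≤ s.re → ‖M s‖⁻¹ ≤ A * Real.exp (B*(1+‖s‖)) := by
  obtain ⟨C, hC, hup⟩ := H.up
  obtain ⟨c, hc, hlow⟩ := H.low
  set K := C/c*20 with hK
  have hKp : 0 < K := by positivity
  refine ⟨1/c, 2*(2*K+2)*(3/2)/h, by positivity, by positivity, ?_⟩
  intro s hs
  rcases le_or_gt 2 s.re with h2 | h2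
  · have := hlow s h2
    have e1 : 1 ≤ Real.exp ((2*(2*K+2)*(3/2)/h)*(1+‖s‖)) := Real.one_le_exp (by positivity)
    calc ‖M s‖⁻¹ ≤ c⁻¹ := by gcongr
      _ = 1/c * 1 := by rw [one_div, mul_one]
      _ ≤ _ := by gcongr
  set c0 : ℂ := 2 + s.im * I with hc0
  have hc0re : c0.re = 2 := by simp [hc0]
  have hball : ∀ u ∈ Metric.ball c0 (3/2), 1/2 < u.re ∧ ‖u‖ ≤ ‖s‖ + 7/2 := by
    intro u hu
    rw [Metric.mem_ball, dist_eq] at hu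
    have := abs_re_le_norm (u-c0)
    rw [sub_re, hc0re] at this
    have h3 := abs_lt.1 (lt_of_le_of_lt this hu)
    constructor
    · linarith
    · have : ‖u‖ ≤ ‖u - c0‖ + ‖c0‖ := by simpa using norm_add_le (u-c0) c0
      have h4 : ‖c0‖ ≤ 2 + ‖s‖ := by
        calc ‖c0‖ ≤ ‖(2:ℂ)‖ + ‖(s.im:ℂ) * I‖ := norm_add_le _ _
          _ = 2 + |s.im| := by simp
          _ ≤ _ := by gcongr; exact abs_im_le_norm s
      linarith
  obtain ⟨F, hF0, hFd, hFM⟩ := exists_log_ball M H.diff c0 (3/2) (by norm_num)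
    (fun u hu => H.ne u (hball u hu).1)
  have hsc : s - c0 = ((s.re - 2 : ℝ) : ℂ) := by
    apply Complex.ext <;> simp [hc0]
  have hsn : ‖s - c0‖ = 2 - s.re := by
    rw [hsc, norm_real, Real.norm_eq_abs, abs_of_nonpos (by linarith)]; ring
  have hsb : s ∈ Metric.ball c0 (3/2) := by
    rw [Metric.mem_ball, dist_eq, hsn]; linarith
  have hMc0 : c ≤ ‖M c0‖ := hlow _ hc0re.ge
  set X := (2*K+2)*(1+‖s‖) with hX
  have hXp : 0 < X := by positivity
  have hre : ∀ u ∈ Metric.ball c0 (3/2), (F u).re ≤ X := by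
    intro u hu
    have e1 := hFM u hu
    have e2 := hup u (by linarith [(hball u hu).1])
    rw [e1, norm_mul, norm_exp] at e2
    have e3 : c * Real.exp (F u).re ≤ C * (1 + ‖u‖)^2 := le_trans (by gcongr) e2
    have e4 : (1+‖u‖)^2 ≤ 20 * (1+‖s‖)^2 * (81/4/20) := by
      have := (hball u hu).2
      have h5 : 1 + ‖u‖ ≤ 9/2 * (1+‖s‖) := by nlinarith [norm_nonneg s]
      calc (1+‖u‖)^2 ≤ (9/2 * (1+‖s‖))^2 := by gcongr
        _ = _ := by ring
    have e5 : Real.exp (F u).re ≤ C/c * (20 * (1+‖s‖)^2 * (81/4/20)) := by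
      rw [div_mul_eq_mul_div, le_div_iff₀ hc]
      calc _ = c * Real.exp (F u).re := mul_comm _ _
        _ ≤ _ := e3
        _ ≤ _ := by gcongr
    have e6 : Real.exp (F u).re ≤ Real.exp X := by
      have k1 : 1 + ‖s‖ ≤ Real.exp (1+‖s‖) := by linarith [Real.add_one_le_exp (1+‖s‖)]
      have k2 : 2*K ≤ Real.exp (2*K) := by linarith [Real.add_one_le_exp (2*K)]
      have k3 : C/c * (20 * (1+‖s‖)^2 * (81/4/20)) = K * (81/80) * (1+‖s‖)^2 := by rw [hK]; ring
      have k4 : K * (81/80) ≤ 2 * K := by linarith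
      calc _ ≤ _ := e5
        _ = _ := k3
        _ ≤ Real.exp (2*K) * (Real.exp (1+‖s‖))^2 := by
          gcongr; linarith
        _ = Real.exp (2*K + 2*(1+‖s‖)) := by rw [← Real.exp_nat_mul, ← Real.exp_add]; simp
        _ ≤ _ := by
          apply Real.exp_le_exp.2; rw [hX]; nlinarith [norm_nonneg s]
    exact Real.exp_le_exp.1 e6
  have bc := borelCaratheodory_zero (f := fun z => F (c0 + z)) (M := X) (R := 3/2) (z := s - c0) hXp
    (by
      intro z hz
      have hz' : c0 + z ∈ Metric.ball c0 (3/2) := by simpa using hz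
      have := (hFd _ hz').differentiableAt
      exact (this.comp z (by fun_prop)).differentiableWithinAt)
    (by
      intro z hz
      exact hre _ (by simpa using hz)) (by norm_num) (by simpa [dist_eq] using hsb) (by simpa using hF0)
  simp only [add_sub_cancel] at bc
  rw [hsn] at bc
  have bc2 : ‖F s‖ ≤ 2*X*(3/2)/h := by
    refine bc.trans ?_
    have : 0 ≤ 2 - s.re := by linarith
    gcongr <;> linarith
  rw [hFM s hsb, norm_mul, norm_exp, mul_inv]
  have e7 : (Real.exp (F s).re)⁻¹ ≤ Real.exp (2*X*(3/2)/h) := by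
    rw [← Real.exp_neg]
    apply Real.exp_le_exp.2
    have := abs_re_le_norm (F s)
    linarith [neg_abs_le (F s).re]
  calc ‖M c0‖⁻¹ * (Real.exp (F s).re)⁻¹ ≤ c⁻¹ * Real.exp (2*X*(3/2)/h) := by gcongr
    _ = _ := by rw [one_div, hX]; congr 2; ring

end P2

section P3
open Complex

lemma GoodData.pl {M : ℂ → ℂ} {a q : ℝ} (H : GoodData M a q) (h : ℝ) (h0 : 0 < h) (h1 : h < 1/4)
    (w : ℂ) (hw : 1/2 < w.re) :
    ‖M (w-h)‖ * ‖Gamma ((w-h+a)/2)‖ ≤ (q/Real.pi)^h * (‖M (w+h)‖ * ‖Gamma ((w+h+a)/2)‖) := by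
  have ha := H.apos
  set Q : ℂ → ℂ := fun z => (M (z+1/2-h) * Gamma ((z+1/2-h+a)/2)) / (M (z+1/2+h) * Gamma ((z+1/2+h+a)/2))
    with hQ
  have hqpi : 0 < q/Real.pi := div_pos (by linarith [H.qpos]) Real.pi_pos
  have hG2 : ∀ z : ℂ, 0 ≤ z.re → Gamma ((z+1/2+h+a)/2) ≠ 0 := fun z hz =>
    Gamma_ne_zero_of_re_pos (by simp; linarith)
  have hG1 : ∀ z : ℂ, 0 ≤ z.re → Gamma ((z+1/2-h+a)/2) ≠ 0 := fun z hz =>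
    Gamma_ne_zero_of_re_pos (by simp; linarith)
  have hM2 : ∀ z : ℂ, 0 ≤ z.re → M (z+1/2+h) ≠ 0 := fun z hz => H.ne _ (by simp; linarith)
  have hGd : ∀ u : ℂ, 0 < u.re → DifferentiableAt ℂ Gamma u := fun u hu =>
    differentiableAt_Gamma u (fun m hm => by
      rw [hm] at hu; simp at hu; linarith [(Nat.cast_nonneg m : (0:ℝ) ≤ m)])
  have hQd : ∀ z : ℂ, 0 ≤ z.re → DifferentiableAt ℂ Q z := by
    intro z hz
    have g1 : DifferentiableAt ℂ (fun z : ℂ => Gamma ((z+1/2-h+a)/2)) z :=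
      (hGd ((z+1/2-h+a)/2) (by simp; linarith)).comp z
        (by fun_prop : DifferentiableAt ℂ (fun z : ℂ => (z+1/2-h+a)/2) z)
    have g2 : DifferentiableAt ℂ (fun z : ℂ => Gamma ((z+1/2+h+a)/2)) z :=
      (hGd ((z+1/2+h+a)/2) (by simp; linarith)).comp z
        (by fun_prop : DifferentiableAt ℂ (fun z : ℂ => (z+1/2+h+a)/2) z)
    have m1 : DifferentiableAt ℂ (fun z : ℂ => M (z+1/2-h)) z :=
      (H.diff _).comp z (by fun_prop : DifferentiableAt ℂ (fun z : ℂ => z+1/2-h) z)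
    have m2 : DifferentiableAt ℂ (fun z : ℂ => M (z+1/2+h)) z :=
      (H.diff _).comp z (by fun_prop : DifferentiableAt ℂ (fun z : ℂ => z+1/2+h) z)
    exact (m1.mul g1).div (m2.mul g2) (mul_ne_zero (hM2 z hz) (hG2 z hz))
  obtain ⟨C1, hC1, hgam⟩ := gamma_ratio_inv (1/8) h (by norm_num) h0
  have hgam' : ∀ z : ℂ, 0 ≤ z.re → ‖Gamma ((z+1/2-h+a)/2)‖ / ‖Gamma ((z+1/2+h+a)/2)‖ ≤ C1 := by
    intro z hz
    rw [div_le_iff₀ (norm_pos_iff.2 (hG2 z hz))]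
    have hg := hgam ((z+1/2-h+a)/2) (by simp; linarith)
    rwa [show (z+1/2-h+a)/2 + (h:ℂ) = (z+1/2+h+a)/2 by ring] at hg
  have hQn : ∀ z, ‖Q z‖ = ‖M (z+1/2-h)‖ * ‖M (z+1/2+h)‖⁻¹ *
      (‖Gamma ((z+1/2-h+a)/2)‖ / ‖Gamma ((z+1/2+h+a)/2)‖) := by
    intro z
    simp only [hQ, norm_div, norm_mul]
    rw [div_eq_mul_inv, div_eq_mul_inv, mul_inv]; ring
  obtain ⟨C, hC, hup⟩ := H.up
  obtain ⟨A, B, hA, hB, hinv⟩ := H.inv_growth h h0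
  have hgrow : ∀ z : ℂ, 0 ≤ z.re → ‖Q z‖ ≤ (C * A * C1 * Real.exp (2 * 2 + B * 2)) *
      Real.exp ((2+B) * ‖z‖) := by
    intro z hz
    rw [hQn]
    have n1 : ‖z+1/2-h‖ ≤ ‖z‖ + 1 := by
      calc ‖z+1/2-h‖ = ‖z + ((1/2-h:ℝ):ℂ)‖ := by congr 1; push_cast; ring
        _ ≤ ‖z‖ + ‖((1/2-h:ℝ):ℂ)‖ := norm_add_le _ _
        _ ≤ _ := by
          rw [norm_real, Real.norm_eq_abs, abs_of_nonneg (by linarith)]; linarith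
    have n2 : ‖z+1/2+h‖ ≤ ‖z‖ + 1 := by
      calc ‖z+1/2+h‖ = ‖z + ((1/2+h:ℝ):ℂ)‖ := by congr 1; push_cast; ring
        _ ≤ ‖z‖ + ‖((1/2+h:ℝ):ℂ)‖ := norm_add_le _ _
        _ ≤ _ := by
          rw [norm_real, Real.norm_eq_abs, abs_of_nonneg (by linarith)]; linarith
    have k1 := hup (z+1/2-h) (by simp; linarith)
    have k2 := hinv (z+1/2+h) (by simp; linarith)
    have k3 := hgam' z hz
    have k4 : (1 + ‖z+1/2-h‖)^2 ≤ Real.exp (2 * (2+‖z‖)) := by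
      have : 1 + ‖z+1/2-h‖ ≤ Real.exp (2+‖z‖) := by
        linarith [Real.add_one_le_exp (2+‖z‖)]
      calc _ ≤ (Real.exp (2+‖z‖))^2 := by gcongr
        _ = _ := by rw [← Real.exp_nat_mul]; simp
    have k5 : Real.exp (B*(1+‖z+1/2+h‖)) ≤ Real.exp (B * (2+‖z‖)) := by
      apply Real.exp_le_exp.2; apply mul_le_mul_of_nonneg_left _ hB.le; linarith
    calc _ ≤ (C * Real.exp (2 * (2+‖z‖))) * (A * Real.exp (B * (2+‖z‖))) * C1 := by
          gcongr
          · exact k1.trans (by gcongr)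
          · exact k2.trans (by gcongr)
      _ = C * A * C1 * (Real.exp (2 * (2+‖z‖)) * Real.exp (B * (2+‖z‖))) := by ring
      _ = C * A * C1 * (Real.exp (2 * 2 + B * 2) * Real.exp ((2+B) * ‖z‖)) := by
          rw [← Real.exp_add, ← Real.exp_add]; congr 2; ring
      _ = _ := by ring
  have main := PhragmenLindelof.right_half_plane_of_bounded_on_real (C := (q/Real.pi)^h)
    (f := Q) (z := w - 1/2) (by
      apply DifferentiableOn.diffContOnCl
      intro z hz
      rw [closure_setOfPred_lt_re] at hz
      exact (hQd z hz).differentiableWithinAt)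
    ⟨1, by norm_num, 2+B, by
      apply Asymptotics.IsBigO.of_bound (C * A * C1 * Real.exp (2 * 2 + B * 2))
      apply Filter.eventually_inf_principal.2
      refine Filter.Eventually.of_forall fun z hz => ?_
      rw [Real.rpow_one, Real.norm_of_nonneg (Real.exp_pos _).le]
      exact hgrow z (le_of_lt hz)⟩
    (by
      obtain ⟨C2, hC2⟩ := H.ratio
      refine ⟨C2 * C1, ?_⟩
      rw [Filter.eventually_map]
      filter_upwards [Filter.eventually_ge_atTop (3:ℝ)] with x hx
      rw [hQn]
      have k := hC2 (x+1/2) h (by linarith) h0 h1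
      push_cast at k
      have hx0 : (0:ℝ) ≤ (x:ℂ).re := by simp; linarith
      have k2 := hgam' x hx0
      have hp := norm_pos_iff.2 (hM2 x hx0)
      have k3 : ‖M ((x:ℂ)+1/2-h)‖ * ‖M ((x:ℂ)+1/2+h)‖⁻¹ ≤ C2 := by
        rw [← div_eq_mul_inv, div_le_iff₀ hp]; exact k
      have : 0 ≤ C2 := le_trans (by positivity) k3
      gcongr)
    (by
      intro t
      apply le_of_eq
      rw [hQn]
      have f := H.fe (t*I+1/2-h) (by simp; linarith) (by simp; linarith)
      have e1 : 1 - (starRingEnd ℂ) (t*I+1/2-h) = t*I+1/2+h := by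
        apply Complex.ext <;> simp <;> norm_num <;> ring
      have e2 : ((t:ℂ)*I+1/2-h).re = 1/2 - h := by simp
      rw [e1, e2] at f
      have t0 : (0:ℝ) ≤ ((t:ℂ)*I).re := by simp
      have g2 := norm_pos_iff.2 (hG2 _ t0)
      have m2 := norm_pos_iff.2 (hM2 _ t0)
      have e3 : (q/Real.pi)^((1-(1/2-h))/2) = (q/Real.pi)^h * (q/Real.pi)^((1/2-h)/2) := by
        rw [← Real.rpow_add hqpi]; congr 1; ring
      rw [e3] at f
      have q1 : 0 < (q/Real.pi)^((1/2-h)/2) := Real.rpow_pos_of_pos hqpi _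
      rw [← div_eq_mul_inv, div_mul_div_comm, div_eq_iff (by positivity)]
      apply mul_left_cancel₀ q1.ne'
      linear_combination f)
    (by simp; linarith)
  have hw0 : 0 ≤ (w-1/2).re := by simp; linarith
  rw [hQ] at main
  simp only [norm_div, norm_mul, sub_add_cancel] at main
  have m2 := norm_pos_iff.2 (hM2 _ hw0)
  have g2 := norm_pos_iff.2 (hG2 _ hw0)
  rw [sub_add_cancel] at m2 g2
  rwa [div_le_iff₀ (by positivity)] at main

lemma GoodData.pos_aux {M : ℂ → ℂ} {a q : ℝ} (H : GoodData M a q) (w : ℂ) (hw : 1/2 < w.re) :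
    0 ≤ 2 * (deriv M w / M w).re + (Real.log q - Real.log Real.pi + Real.log ‖(w+a+2)/2‖
      + 1/(w.re+a+1)) := by
  have ha := H.apos
  have hqpi : 0 < q/Real.pi := div_pos (by linarith [H.qpos]) Real.pi_pos
  set r := min (w.re - 1/2) (1/4) with hr
  have hrp : 0 < r := lt_min (by linarith) (by norm_num)
  have hr1 : r ≤ w.re - 1/2 := min_le_left _ _
  have hr2 : r ≤ 1/4 := min_le_right _ _
  have hball : ∀ u ∈ Metric.ball w r, 1/2 < u.re := by
    intro u hu
    rw [Metric.mem_ball, dist_eq] at hu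
    have := abs_re_le_norm (u-w)
    rw [sub_re] at this
    have h3 := abs_lt.1 (lt_of_le_of_lt this hu)
    linarith
  obtain ⟨F, hF0, hFd, hFM⟩ := exists_log_ball M H.diff w r hrp
    (fun u hu => H.ne u (hball u hu))
  have key : ∀ h : ℝ, 0 < h → h < r → 0 ≤ ((F (w+h)).re - (F (w-h)).re)/h +
      (Real.log q - Real.log Real.pi + Real.log ‖(w-h+a+2)/2‖ + 1/(w.re-h+a+1)) := by
    intro h h0 h1
    have hb1 : w + h ∈ Metric.ball w r := by
      simp [abs_of_pos h0, h1]
    have hb2 : w - h ∈ Metric.ball w r := by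
      simp [dist_eq, abs_of_pos h0, h1]
    have k := H.pl h h0 (by linarith) w hw
    have g := gamma_ratio ((w-h+a)/2) (by simp; linarith) h h0.le (by linarith)
    have e1 : (w-h+a)/2 + h = (w+h+a)/2 := by ring
    have e2 : (w-h+a)/2 + 1 = (w-h+a+2)/2 := by ring
    have e3 : 2 * ((w-h+a)/2).re + 1 = w.re-h+a+1 := by simp; ring
    rw [e1, e2, e3] at g
    set Y := Real.log ‖(w-h+a+2)/2‖ + 1/(w.re-h+a+1) with hY
    have gp : 0 < ‖Gamma ((w-h+a)/2)‖ := norm_pos_iff.2 (Gamma_ne_zero_of_re_pos (by simp; linarith))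
    have k2 : ‖M (w-h)‖ ≤ (q/Real.pi)^h * Real.exp (h*Y) * ‖M (w+h)‖ := by
      apply le_of_mul_le_mul_right _ gp
      calc _ ≤ _ := k
        _ ≤ (q/Real.pi)^h * (‖M (w+h)‖ * (‖Gamma ((w-h+a)/2)‖ * Real.exp (h*Y))) := by gcongr
        _ = _ := by ring
    rw [hFM _ hb1, hFM _ hb2, norm_mul, norm_mul, norm_exp, norm_exp, Real.rpow_def_of_pos hqpi] at k2
    have mp := norm_pos_iff.2 (H.ne w hw)
    have k3 : Real.exp (F (w-h)).re ≤ Real.exp (Real.log (q/Real.pi) * h + h*Y + (F (w+h)).re) := by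
      rw [Real.exp_add, Real.exp_add]
      apply le_of_mul_le_mul_left _ mp
      linarith
    have k4 := Real.exp_le_exp.1 k3
    rw [Real.log_div (by linarith [H.qpos]) Real.pi_pos.ne'] at k4
    have : Real.log q - Real.log Real.pi + Real.log ‖(w-h+a+2)/2‖ + 1/(w.re-h+a+1)
      = ((Real.log q - Real.log Real.pi) * h + h*Y)/h := by rw [hY]; field_simp; ring
    rw [this, ← add_div]
    apply div_nonneg _ h0.le
    linarith
  have hwb : w ∈ Metric.ball w r := Metric.mem_ball_self hrp
  have d1 : HasDerivAt (fun h : ℝ => (F (w+h)).re - (F (w-h)).re) (2 * (deriv M w / M w).re) 0 := by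
    have f0 := hFd w hwb
    have f1 : HasDerivAt (fun h : ℝ => F (w+h)) (deriv M w / M w) 0 := by
      have c1 : HasDerivAt (fun h : ℂ => F (w+h)) (deriv M w / M w) ((0:ℝ):ℂ) := by
        apply HasDerivAt.comp_const_add
        simpa using f0
      exact c1.comp_ofReal
    have f2 : HasDerivAt (fun h : ℝ => F (w-h)) (-(deriv M w / M w)) 0 := by
      have c1 : HasDerivAt (fun h : ℂ => F (w-h)) (-(deriv M w / M w)) ((0:ℝ):ℂ) := by
        apply HasDerivAt.comp_const_sub
        simpa using f0
      exact c1.comp_ofReal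
    have r1 := reCLM.hasFDerivAt.comp_hasDerivAt (0:ℝ) f1
    have r2 := reCLM.hasFDerivAt.comp_hasDerivAt (0:ℝ) f2
    have := r1.sub r2
    have e : 2 * (deriv M w / M w).re = reCLM (deriv M w / M w) - reCLM (-(deriv M w / M w)) := by
      simp only [reCLM_apply, neg_re]; ring
    rw [e]; exact this
  have t1 : Filter.Tendsto (fun h : ℝ => ((F (w+h)).re - (F (w-h)).re)/h) (nhdsWithin 0 (Set.Ioi 0))
      (nhds (2 * (deriv M w / M w).re)) := by
    have := d1.tendsto_slope_zero_right
    simp only [zero_add, ofReal_zero, add_zero, sub_zero, sub_self, smul_eq_mul] at this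
    refine this.congr (fun h => by rw [div_eq_inv_mul])
  have t2 : Filter.Tendsto (fun h : ℝ => Real.log q - Real.log Real.pi + Real.log ‖(w-h+a+2)/2‖
      + 1/(w.re-h+a+1)) (nhdsWithin 0 (Set.Ioi 0))
      (nhds (Real.log q - Real.log Real.pi + Real.log ‖(w+a+2)/2‖ + 1/(w.re+a+1))) := by
    apply Filter.Tendsto.mono_left _ nhdsWithin_le_nhds
    have hne : (w+a+2)/2 ≠ 0 := fun h => by
      have := congrArg Complex.re h
      simp at this; linarith
    have : ContinuousAt (fun h : ℝ => Real.log q - Real.log Real.pi + Real.log ‖(w-h+a+2)/2‖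
      + 1/(w.re-h+a+1)) 0 := by
      refine ContinuousAt.add (ContinuousAt.add continuousAt_const (ContinuousAt.log ?_ ?_)) ?_
      · fun_prop
      · simpa using hne
      · apply ContinuousAt.div continuousAt_const (by fun_prop)
        linarith
    simpa [ContinuousAt] using this
  refine ge_of_tendsto (t1.add t2) ?_
  filter_upwards [Ioo_mem_nhdsGT hrp] with h hh
  exact key h hh.1 hh.2

end P3

section P5
open Complex MeasureTheory

lemma phi_integrable (r : ℝ) (hr : 1 < r) : Integrable (fun t : ℝ => (1+|t|)^(-r)) := by
  have := integrable_one_add_norm (E := ℝ) (μ := volume) (r := r) (by simpa using hr)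
  simpa using this

lemma phi_integral : ∫ t : ℝ, (1+|t|)^(-(3/2):ℝ) = 4 := by
  rw [integral_comp_abs (f := fun t => (1+t)^(-(3/2):ℝ))]
  have : ∫ t in Set.Ioi (0:ℝ), (1+t)^(-(3/2):ℝ) = 2 := by
    have h := integral_Ioi_of_hasDerivAt_of_tendsto (a := (0:ℝ)) (m := 0)
      (f := fun t : ℝ => -2*(1+t)^(-(1/2):ℝ)) (f' := fun t : ℝ => (1+t)^(-(3/2):ℝ)) ?_ ?_ ?_ ?_
    · rw [h]; norm_num
    · have : ContinuousAt (fun t : ℝ => -2*(1+t)^(-(1/2):ℝ)) 0 := by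
        refine continuousAt_const.mul (ContinuousAt.rpow_const (by fun_prop) (Or.inl (by norm_num)))
      exact this.continuousWithinAt
    · intro t ht
      have ht' : (0:ℝ) < 1 + t := by linarith [Set.mem_Ioi.1 ht]
      have h1 : HasDerivAt (fun t : ℝ => 1+t) 1 t := (hasDerivAt_id t).const_add 1
      have h2 := (h1.rpow_const (p := -(1/2)) (Or.inl ht'.ne')).const_mul (-2)
      refine h2.congr_deriv ?_
      rw [show (-(1/2):ℝ)-1 = -(3/2) by norm_num]; ring
    · have := integrableOn_add_rpow_Ioi_of_lt (a := -(3/2)) (c := 0) (m := 1) (by norm_num) (by norm_num)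
      simpa [add_comm] using this
    · have h1 : Filter.Tendsto (fun T : ℝ => (1+T)^(-(1/2):ℝ)) Filter.atTop (nhds 0) :=
        (tendsto_rpow_neg_atTop (by norm_num : (0:ℝ) < 1/2)).comp
          (Filter.tendsto_atTop_add_const_left _ _ Filter.tendsto_id)
      simpa using h1.const_mul (-2)
  rw [this]; norm_num

lemma norm_le_of_re_im {c : ℝ} (t : ℝ) : |t| ≤ ‖(c:ℂ) + t * I‖ := by
  have := abs_im_le_norm ((c:ℂ) + t * I)
  simpa using this

lemma line_integrable (f : ℂ → ℂ) (c C : ℝ)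
    (hd : ∀ s : ℂ, s.re = c → ContinuousAt f s)
    (hb : ∀ s : ℂ, s.re = c → ‖f s‖ ≤ C * (1+|s.im|)^(-(3/2):ℝ)) :
    Integrable (fun t : ℝ => f (c + t * I)) := by
  have hcont : Continuous (fun t : ℝ => f (c + t * I)) := by
    rw [continuous_iff_continuousAt]
    intro t
    exact ContinuousAt.comp (f := fun t : ℝ => (c:ℂ) + t * I) (hd _ (by simp)) (by fun_prop)
  refine ((phi_integrable (3/2) (by norm_num)).const_mul C).mono' hcont.aestronglyMeasurable ?_
  refine Filter.Eventually.of_forall fun t => ?_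
  simpa using hb (c + t * I) (by simp)

lemma contour_shift (f : ℂ → ℂ) (c d C : ℝ) (hcd : c ≤ d)
    (hd : ∀ s : ℂ, c ≤ s.re → s.re ≤ d → DifferentiableAt ℂ f s)
    (hb : ∀ s : ℂ, c ≤ s.re → s.re ≤ d → ‖f s‖ ≤ C * (1+|s.im|)^(-(3/2):ℝ)) :
    ∫ t : ℝ, f (c + t * I) = ∫ t : ℝ, f (d + t * I) := by
  have i1 := line_integrable f c C (fun s hs => (hd s hs.ge (hs.le.trans hcd)).continuousAt)
    (fun s hs => hb s hs.ge (hs.le.trans hcd))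
  have i2 := line_integrable f d C (fun s hs => (hd s (hcd.trans hs.ge) hs.le).continuousAt)
    (fun s hs => hb s (hcd.trans hs.ge) hs.le)
  have t1 := intervalIntegral_tendsto_integral i1 Filter.tendsto_neg_atTop_atBot Filter.tendsto_id
  have t2 := intervalIntegral_tendsto_integral i2 Filter.tendsto_neg_atTop_atBot Filter.tendsto_id
  have hz : Filter.Tendsto (fun T : ℝ => C * (1+|T|)^(-(3/2):ℝ) * |d - c| + C * (1+|T|)^(-(3/2):ℝ) * |d - c|)
      Filter.atTop (nhds 0) := by
    have h1 : Filter.Tendsto (fun T : ℝ => (1+|T|)^(-(3/2):ℝ)) Filter.atTop (nhds 0) :=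
      (tendsto_rpow_neg_atTop (by norm_num : (0:ℝ) < 3/2)).comp
        (Filter.tendsto_atTop_add_const_left _ _ Filter.tendsto_abs_atTop_atTop)
    have := ((h1.const_mul C).mul_const |d-c|).add ((h1.const_mul C).mul_const |d-c|)
    simpa using this
  have t3 : Filter.Tendsto (fun T : ℝ => (∫ t in (-T)..T, f (d + t * I)) - ∫ t in (-T)..T, f (c + t * I))
      Filter.atTop (nhds 0) := by
    refine squeeze_zero_norm (fun T => ?_) hz
    have h := integral_boundary_rect_eq_zero_of_differentiableOn f ⟨c, -T⟩ ⟨d, T⟩ (by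
      intro s hs
      rw [mem_reProdIm] at hs
      simp only [Set.uIcc_of_le hcd] at hs
      exact (hd s hs.1.1 hs.1.2).differentiableWithinAt)
    simp only [smul_eq_mul] at h
    have hh : I * ((∫ t in (-T)..T, f (d + t * I)) - ∫ t in (-T)..T, f (c + t * I))
        = (∫ x in c..d, f (x + T * I)) - (∫ x in c..d, f (x + (-T:ℝ) * I)) := by
      linear_combination h
    have hn : ‖(∫ t in (-T)..T, f (d + t * I)) - ∫ t in (-T)..T, f (c + t * I)‖
        = ‖(∫ x in c..d, f (x + T * I)) - (∫ x in c..d, f (x + (-T:ℝ) * I))‖ := by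
      rw [← hh, norm_mul, norm_I, one_mul]
    rw [hn]
    refine (norm_sub_le _ _).trans (add_le_add ?_ ?_)
    · refine intervalIntegral.norm_integral_le_of_norm_le_const fun x hx => ?_
      rw [Set.uIoc_of_le hcd] at hx
      simpa using hb (x + T * I) (by simpa using hx.1.le) (by simpa using hx.2)
    · refine intervalIntegral.norm_integral_le_of_norm_le_const fun x hx => ?_
      rw [Set.uIoc_of_le hcd] at hx
      simpa using hb (x + (-T:ℝ) * I) (by simpa using hx.1.le) (by simpa using hx.2)
  have t4 := t2.sub t1
  have := tendsto_nhds_unique t4 t3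
  exact (sub_eq_zero.1 this).symm

lemma integral_poisson (b : ℝ) (hb : 0 < b) : ∫ t : ℝ, b/(b^2+t^2) = Real.pi := by
  have h := integral_univ_inv_one_add_sq
  have h2 := Measure.integral_comp_mul_left (fun t : ℝ => (1+t^2)⁻¹) b⁻¹
  rw [h] at h2
  simp only [inv_inv, smul_eq_mul, abs_of_pos hb] at h2
  have : ∀ t : ℝ, b/(b^2+t^2) = b⁻¹ * (1 + (b⁻¹*t)^2)⁻¹ := by
    intro t; field_simp
  simp_rw [this]
  rw [integral_const_mul, h2]; field_simp

lemma integrable_poisson (b : ℝ) (hb : 0 < b) : Integrable (fun t : ℝ => b/(b^2+t^2)) := by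
  by_contra h
  have := integral_undef h
  rw [integral_poisson b hb] at this
  exact Real.pi_ne_zero this

end P5

section P5b
open Complex MeasureTheory

lemma dslope_bound (V : ℂ → ℂ) (c C : ℝ) (hc : 0 < c) (hC : 0 ≤ C)
    (hV : ∀ s : ℂ, c ≤ s.re → DifferentiableAt ℂ V s)
    (hg : ∀ s : ℂ, c ≤ s.re → ‖V s‖ ≤ C * (1+‖s‖)^((1/2):ℝ)) :
    ∃ K, 0 ≤ K ∧ ∀ s : ℂ, c ≤ s.re →
      ‖dslope V ((2*c+1:ℝ):ℂ) s / (s+1)‖ ≤ K * (1+‖s‖)^(-(3/2):ℝ) := by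
  set w0 : ℂ := ((2*c+1:ℝ):ℂ) with hw0
  have hw0re : w0.re = 2*c+1 := by simp [hw0]
  have hw0n : ‖w0‖ = 2*c+1 := by
    rw [hw0, norm_real, Real.norm_eq_abs, abs_of_pos (by linarith)]
  have hplus : ∀ s : ℂ, c ≤ s.re → (1+‖s‖)/2 ≤ ‖s+1‖ := by
    intro s hs
    have h1 : 1 ≤ ‖s+1‖ := by
      have := abs_re_le_norm (s+1)
      rw [add_re, one_re, abs_of_pos (by linarith)] at this
      linarith
    have h2 : ‖s‖ ≤ ‖s+1‖ := by
      apply le_of_sq_le_sq _ (norm_nonneg _) |> id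
      rw [← normSq_eq_norm_sq, ← normSq_eq_norm_sq, normSq_apply, normSq_apply]
      simp; nlinarith
    linarith
  obtain ⟨K1, hK1⟩ := (isCompact_closedBall w0 1 |>.inter_right
    (isClosed_le continuous_const continuous_re : IsClosed {s : ℂ | c ≤ s.re})).exists_bound_of_continuousOn
    (f := dslope V w0) (by
      intro s hs
      apply ContinuousAt.continuousWithinAt
      by_cases h : s = w0
      · rw [h]; exact continuousAt_dslope_same.2 (hV _ (by rw [hw0re]; linarith))
      · exact (continuousAt_dslope_of_ne h).2 (hV s hs.2).continuousAt)
  set K2 := max K1 0 with hK2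
  refine ⟨K2*2*(3+‖w0‖)^(1/2:ℝ) + (C+‖V w0‖)*(2+‖w0‖)*2, by positivity, ?_⟩
  intro s hs
  have hs1 := hplus s hs
  have hsp : 0 < 1 + ‖s‖ := by positivity
  have ha : (1+‖s‖)^(-(3/2):ℝ) = (1+‖s‖)^(1/2:ℝ) * (1+‖s‖)⁻¹ * (1+‖s‖)⁻¹ := by
    rw [← Real.rpow_neg_one, ← Real.rpow_add hsp, ← Real.rpow_add hsp]; norm_num
  have hb : (1+‖s‖)^(-(3/2):ℝ) * (1+‖s‖)^(1/2:ℝ) = (1+‖s‖)⁻¹ := by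
    rw [← Real.rpow_neg_one, ← Real.rpow_add hsp]; norm_num
  have h1r : 1 ≤ (1+‖s‖)^(1/2:ℝ) := Real.one_le_rpow (by linarith [norm_nonneg s]) (by norm_num)
  have hφ : 0 < (1+‖s‖)^(-(3/2):ℝ) := by positivity
  rw [norm_div]
  rcases le_or_gt ‖s - w0‖ 1 with h | h
  · have k1 : ‖dslope V w0 s‖ ≤ K2 := (hK1 s ⟨by simpa [dist_eq] using h, hs⟩).trans (le_max_left _ _)
    have k2 : ‖s‖ ≤ 1 + ‖w0‖ := by
      have : ‖s‖ ≤ ‖s - w0‖ + ‖w0‖ := by simpa using norm_add_le (s-w0) w0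
      linarith
    calc ‖dslope V w0 s‖ / ‖s+1‖ ≤ K2 / ((1+‖s‖)/2) := by gcongr
      _ = K2 * 2 * (1+‖s‖)⁻¹ := by field_simp
      _ = K2 * 2 * (1+‖s‖)^(1/2:ℝ) * (1+‖s‖)^(-(3/2):ℝ) := by rw [← hb]; ring
      _ ≤ K2 * 2 * (3+‖w0‖)^(1/2:ℝ) * (1+‖s‖)^(-(3/2):ℝ) := by
        have : (1+‖s‖)^(1/2:ℝ) ≤ (3+‖w0‖)^(1/2:ℝ) :=
          Real.rpow_le_rpow hsp.le (by linarith) (by norm_num)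
        gcongr
      _ ≤ _ := by
        gcongr
        have : 0 ≤ (C+‖V w0‖)*(2+‖w0‖)*2 := by positivity
        linarith
  · have hne : s ≠ w0 := fun e => by rw [e] at h; simp at h; linarith
    rw [dslope_of_ne _ hne, slope_def_field, norm_div]
    have k2 : 1 + ‖s‖ ≤ (2+‖w0‖) * ‖s-w0‖ := by
      have : ‖s‖ ≤ ‖s - w0‖ + ‖w0‖ := by simpa using norm_add_le (s-w0) w0
      nlinarith [norm_nonneg w0]
    have k3 : ‖V s - V w0‖ ≤ (C + ‖V w0‖) * (1+‖s‖)^(1/2:ℝ) := by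
      have := norm_sub_le (V s) (V w0)
      have := hg s hs
      nlinarith [norm_nonneg (V w0)]
    have k4 : (1+‖s‖)/(2+‖w0‖) ≤ ‖s - w0‖ := by
      rw [div_le_iff₀ (by positivity)]; linarith
    calc ‖V s - V w0‖ / ‖s-w0‖ / ‖s+1‖
        ≤ (C + ‖V w0‖) * (1+‖s‖)^(1/2:ℝ) / ((1+‖s‖)/(2+‖w0‖)) / ((1+‖s‖)/2) := by gcongr
      _ = (C+‖V w0‖)*(2+‖w0‖)*2 * (1+‖s‖)^(-(3/2):ℝ) := by
        rw [ha]; field_simp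
      _ ≤ _ := by
        gcongr
        have : 0 ≤ K2*2*(3+‖w0‖)^(1/2:ℝ) := by positivity
        linarith

lemma poisson (V : ℂ → ℂ) (c C : ℝ) (hc : 0 < c) (hC : 0 ≤ C)
    (hV : ∀ s : ℂ, c ≤ s.re → DifferentiableAt ℂ V s)
    (hg : ∀ s : ℂ, c ≤ s.re → ‖V s‖ ≤ C * (1+‖s‖)^((1/2):ℝ)) :
    Integrable (fun t : ℝ => V (c + t*I) * (((c+1)/((c+1)^2+t^2) : ℝ):ℂ)) ∧
    ∫ t : ℝ, V (c + t*I) * (((c+1)/((c+1)^2+t^2) : ℝ):ℂ) = Real.pi * V ((2*c+1:ℝ):ℂ) := by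
  obtain ⟨K, hK0, hK⟩ := dslope_bound V c C hc hC hV hg
  set w0 : ℂ := ((2*c+1:ℝ):ℂ) with hw0
  have hw0re : w0.re = 2*c+1 := by simp [hw0]
  set k : ℂ → ℂ := fun s => dslope V w0 s / (s+1) with hk
  have hs1 : ∀ s : ℂ, c ≤ s.re → s + 1 ≠ 0 := fun s hs h => by
    have := congrArg Complex.re h
    simp at this; linarith
  -- differentiability
  have hcc : ∀ s : ℂ, c ≤ s.re → ContinuousAt k s := by
    intro s hs
    refine ContinuousAt.div ?_ (by fun_prop) (hs1 s hs)
    by_cases h : s = w0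
    · rw [h]; exact continuousAt_dslope_same.2 (hV _ (by rw [hw0re]; linarith))
    · exact (continuousAt_dslope_of_ne h).2 (hV s hs).continuousAt
  have hdd : ∀ s : ℂ, c ≤ s.re → DifferentiableAt ℂ k s := by
    intro s hs
    refine DifferentiableAt.div ?_ (by fun_prop) (hs1 s hs)
    by_cases h : s = w0
    · have hopen : IsOpen {u : ℂ | c < u.re} := isOpen_lt continuous_const continuous_re
      have hmem : {u : ℂ | c < u.re} ∈ nhds w0 := hopen.mem_nhds (by
        show c < w0.re
        rw [hw0re]; linarith)
      have hon : DifferentiableOn ℂ (dslope V w0) {u : ℂ | c < u.re} :=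
        (differentiableOn_dslope hmem).2 fun u hu =>
          (hV u (le_of_lt hu)).differentiableWithinAt
      rw [h]; exact hon.differentiableAt hmem
    · exact (differentiableAt_dslope_of_ne h).2 (hV s hs)
  have hle : ∀ s : ℂ, c ≤ s.re → ‖k s‖ ≤ K * (1+|s.im|)^(-(3/2):ℝ) := by
    intro s hs
    refine (hK s hs).trans ?_
    apply mul_le_mul_of_nonneg_left _ hK0
    apply Real.rpow_le_rpow_of_nonpos (by positivity) _ (by norm_num)
    linarith [abs_im_le_norm s]
  have hzero : ∫ t : ℝ, k (c + t*I) = 0 := by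
    have hle2 : ∀ d : ℝ, c ≤ d → ‖∫ t : ℝ, k (c + t*I)‖ ≤
        K * (1+d)^(-(1/4):ℝ) * ∫ t : ℝ, (1+|t|)^(-(5/4):ℝ) := by
      intro d hd
      rw [contour_shift k c d K hd (fun s h1 _ => hdd s h1) (fun s h1 _ => hle s h1)]
      rw [← integral_const_mul]
      refine norm_integral_le_of_norm_le ((phi_integrable (5/4) (by norm_num)).const_mul _) ?_
      refine Filter.Eventually.of_forall fun t => ?_
      refine (hK (d + t*I) (by simpa using hd)).trans ?_
      rw [mul_assoc]
      apply mul_le_mul_of_nonneg_left _ hK0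
      have hn1 : |t| ≤ ‖(d:ℂ)+t*I‖ := norm_le_of_re_im t
      have hn2 : d ≤ ‖(d:ℂ)+t*I‖ := by
        have := re_le_norm ((d:ℂ)+t*I)
        simpa using this
      have hp : 0 < 1 + ‖(d:ℂ)+t*I‖ := by positivity
      rw [show (-(3/2):ℝ) = -(1/4) + -(5/4) by norm_num, Real.rpow_add hp]
      have hd0 : 0 < d := by linarith
      apply mul_le_mul
      · exact Real.rpow_le_rpow_of_nonpos (by linarith) (by linarith) (by norm_num)
      · exact Real.rpow_le_rpow_of_nonpos (by positivity) (by linarith) (by norm_num)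
      · positivity
      · positivity
    have ht : Filter.Tendsto (fun d : ℝ => K * (1+d)^(-(1/4):ℝ) * ∫ t : ℝ, (1+|t|)^(-(5/4):ℝ))
        Filter.atTop (nhds 0) := by
      have h1 : Filter.Tendsto (fun T : ℝ => (1+T)^(-(1/4):ℝ)) Filter.atTop (nhds 0) :=
        (tendsto_rpow_neg_atTop (by norm_num : (0:ℝ) < 1/4)).comp
          (Filter.tendsto_atTop_add_const_left _ _ Filter.tendsto_id)
      simpa using (h1.const_mul K).mul_const (∫ t : ℝ, (1+|t|)^(-(5/4):ℝ))
    have := ge_of_tendsto ht (by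
      filter_upwards [Filter.eventually_ge_atTop c] with d hd using hle2 d hd)
    exact norm_le_zero_iff.1 this
  have hki : Integrable (fun t : ℝ => k (c + t*I)) :=
    line_integrable k c K (fun s hs => hcc s hs.ge) (fun s hs => hle s hs.ge)
  have hpi : Integrable (fun t : ℝ => (((c+1)/((c+1)^2+t^2) : ℝ):ℂ)) :=
    (integrable_poisson (c+1) (by linarith)).ofReal
  have hrepr : ∀ t : ℝ, V (c + t*I) * (((c+1)/((c+1)^2+t^2) : ℝ):ℂ)
      = V w0 * (((c+1)/((c+1)^2+t^2) : ℝ):ℂ) - ((c+1:ℝ):ℂ) * k (c + t*I) := by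
    intro t
    have hre : ((c:ℂ) + t*I).re = c := by simp
    have hne : (c:ℂ) + t*I ≠ w0 := fun h => by
      rw [h, hw0re] at hre; linarith
    have hn1 := hs1 ((c:ℂ)+t*I) hre.ge
    have hn2 : (c:ℂ) + t*I - w0 ≠ 0 := sub_ne_zero.2 hne
    have e : (((c+1)/((c+1)^2+t^2) : ℝ):ℂ) = -((c+1:ℝ):ℂ) / ((c + t*I + 1) * (c + t*I - w0)) := by
      have hx : ((c:ℂ) + t*I + 1) * (c + t*I - w0) = -(((c+1)^2+t^2 : ℝ):ℂ) := by
        rw [hw0]; push_cast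
        linear_combination (t:ℂ)^2 * I_sq
      rw [hx, neg_div_neg_eq]; push_cast; ring
    rw [e, hk]
    simp only []
    rw [dslope_of_ne _ hne, slope_def_field]
    field_simp
    ring
  simp_rw [hrepr]
  refine ⟨(hpi.const_mul _).sub (hki.const_mul _), ?_⟩
  rw [integral_sub (hpi.const_mul _) (hki.const_mul _), integral_const_mul, integral_const_mul, hzero,
    integral_complex_ofReal, integral_poisson (c+1) (by linarith)]
  ring

end P5b

section P4
open Complex MeasureTheory

noncomputable def eF (a : ℝ) (s : ℂ) : ℂ :=
  log ((s+a+2)/2) + ((1/(a+3/2) - Real.log Real.pi : ℝ):ℂ)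

noncomputable def VF (M : ℂ → ℂ) (a q : ℝ) (s : ℂ) : ℂ :=
  (Real.log q : ℂ) + eF a s + 2*(deriv M s / M s)

lemma eF_diff (a : ℝ) (ha : 0 ≤ a) (s : ℂ) (hs : -(3/2) ≤ s.re) : DifferentiableAt ℂ (eF a) s := by
  unfold eF
  refine DifferentiableAt.add_const _ (DifferentiableAt.clog (by fun_prop) ?_)
  left; simp; linarith

lemma GoodData.D_diff {M : ℂ → ℂ} {a q : ℝ} (H : GoodData M a q) (s : ℂ) (hs : 1/2 < s.re) :
    DifferentiableAt ℂ (fun s => deriv M s / M s) s := by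
  have h1 : Differentiable ℂ (deriv M) := (H.diff.contDiff (n := 2)).differentiable_deriv_two
  exact (h1 s).div (H.diff s) (H.ne s hs)

lemma GoodData.VF_diff {M : ℂ → ℂ} {a q : ℝ} (H : GoodData M a q) (s : ℂ) (hs : 1/2 < s.re) :
    DifferentiableAt ℂ (VF M a q) s := by
  have h1 := eF_diff a H.apos s (by linarith)
  have h2 := H.D_diff s hs
  exact (h1.const_add _).add (h2.const_mul 2)

lemma GoodData.VF_re {M : ℂ → ℂ} {a q : ℝ} (H : GoodData M a q) (s : ℂ) (hs : 1/2 < s.re) :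
    0 ≤ (VF M a q s).re := by
  have h := H.pos_aux s hs
  have ha := H.apos
  unfold VF eF
  simp only [add_re, ofReal_re, log_re, mul_re, re_ofNat, im_ofNat, zero_mul, sub_zero]
  have : 1/(s.re+a+1) ≤ 1/(a+3/2) := by
    apply one_div_le_one_div_of_le <;> linarith
  linarith

lemma log_pi_bounds : 1 < Real.log Real.pi ∧ Real.log Real.pi < 1.15 := by
  constructor
  · rw [Real.lt_log_iff_exp_lt Real.pi_pos]
    linarith [Real.exp_one_lt_d9, Real.pi_gt_d6]
  · rw [Real.log_lt_iff_lt_exp Real.pi_pos]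
    have h1 : Real.exp 1.15 = Real.exp 1 * Real.exp 0.15 := by rw [← Real.exp_add]; norm_num
    have h2 : (1.16:ℝ) ≤ Real.exp 0.15 := by
      have := Real.quadratic_le_exp_of_nonneg (x := 0.15) (by norm_num)
      norm_num at this ⊢; linarith
    rw [h1]
    nlinarith [Real.exp_one_gt_d9, Real.pi_lt_d6]

lemma eF_bound (a : ℝ) (ha : 0 ≤ a) (ha2 : a ≤ 2) (s : ℂ) (hs : -(1/2) ≤ s.re) :
    ‖eF a s‖ ≤ 5/2 + 3 * (1+‖s‖)^((1/2):ℝ) := by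
  unfold eF
  set w : ℂ := (s+a+2)/2 with hw
  have hwre : 3/4 ≤ w.re := by simp [hw]; linarith
  have hwn : 3/4 ≤ ‖w‖ := hwre.trans (re_le_norm w)
  have hwp : 0 < ‖w‖ := by linarith
  have hwu : ‖w‖ ≤ 2 * (1+‖s‖) := by
    rw [hw, norm_div]
    have h1 : ‖s+a+2‖ ≤ ‖s‖ + a + 2 := by
      calc ‖s+a+2‖ ≤ ‖s+a‖ + ‖(2:ℂ)‖ := norm_add_le _ _
        _ ≤ ‖s‖ + ‖(a:ℂ)‖ + ‖(2:ℂ)‖ := by gcongr; exact norm_add_le _ _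
        _ = _ := by rw [norm_real, Real.norm_of_nonneg ha]; simp
    have h2 : ‖(2:ℂ)‖ = 2 := by simp
    rw [h2]; linarith [norm_nonneg s]
  have hR : (1+‖s‖)^((1/2):ℝ) = Real.sqrt (1+‖s‖) := by rw [Real.sqrt_eq_rpow]
  rw [hR]
  set R := Real.sqrt (1+‖s‖) with hRdef
  have hR1 : 1 ≤ R := Real.one_le_sqrt.2 (by linarith [norm_nonneg s])
  have hRsq : R^2 = 1+‖s‖ := Real.sq_sqrt (by positivity)
  have hlog1 : Real.log ‖w‖ ≤ 3 * R - 2 := by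
    have h1 : Real.log ‖w‖ = 2 * Real.log (Real.sqrt ‖w‖) := by
      rw [Real.log_sqrt hwp.le]; ring
    have h2 : Real.log (Real.sqrt ‖w‖) ≤ Real.sqrt ‖w‖ - 1 :=
      Real.log_le_sub_one_of_pos (Real.sqrt_pos.2 hwp)
    have h3 : Real.sqrt ‖w‖ ≤ 3/2 * R := by
      apply Real.sqrt_le_iff.2
      constructor
      · positivity
      · nlinarith
    linarith
  have hlog2 : -1 ≤ Real.log ‖w‖ := by
    have := Real.one_sub_inv_le_log_of_pos hwp
    have h3 : ‖w‖⁻¹ ≤ (3/4)⁻¹ := by gcongr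
    norm_num at h3; linarith
  have harg : |arg w| ≤ 1.58 := by
    have := abs_arg_le_pi_div_two_iff.2 (by linarith : 0 ≤ w.re)
    linarith [Real.pi_lt_d6]
  have hln : ‖log w‖ ≤ (3*R - 3/2+ 0.04) + 1.58 := by
    have h1 := norm_le_abs_re_add_abs_im (log w)
    rw [log_re, log_im] at h1
    have : |Real.log ‖w‖| ≤ 3*R - 3/2+0.04 := by
      rw [abs_le]; constructor <;> linarith
    linarith
  have hk : ‖((1/(a+3/2) - Real.log Real.pi : ℝ):ℂ)‖ ≤ 2 := by
    rw [norm_real, Real.norm_eq_abs, abs_le]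
    have h1 : 0 ≤ 1/(a+3/2) := by positivity
    have h2 : 1/(a+3/2) ≤ 1 := by rw [div_le_one (by linarith)]; linarith
    have := log_pi_bounds
    constructor <;> linarith
  calc _ ≤ ‖log w‖ + ‖((1/(a+3/2) - Real.log Real.pi : ℝ):ℂ)‖ := norm_add_le _ _
    _ ≤ _ := by linarith

lemma GoodData.VF_growth {M : ℂ → ℂ} {a q : ℝ} (H : GoodData M a q) (ha2 : a ≤ 2) (B : ℝ)
    (hB : ∀ s : ℂ, 3/2 ≤ s.re → ‖deriv M s / M s‖ ≤ B) (c : ℝ) (hc : 1/2 < c) :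
    ∃ C, 0 ≤ C ∧ ∀ s : ℂ, c ≤ s.re → ‖VF M a q s‖ ≤ C * (1+‖s‖)^((1/2):ℝ) := by
  have hB0 : 0 ≤ B := le_trans (norm_nonneg _) (hB 2 (by norm_num))
  have hR1 : ∀ s : ℂ, 1 ≤ (1+‖s‖)^((1/2):ℝ) := fun s =>
    Real.one_le_rpow (by linarith [norm_nonneg s]) (by norm_num)
  set C0 := |Real.log q| + 6 + 2*B with hC0
  have hC0p : 0 ≤ C0 := by positivity
  have direct : ∀ s : ℂ, 3/2 ≤ s.re → ‖VF M a q s‖ ≤ C0 * (1+‖s‖)^((1/2):ℝ) := by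
    intro s hs
    have h1 := eF_bound a H.apos ha2 s (by linarith)
    have h2 := hB s hs
    have h3 := hR1 s
    have : ‖VF M a q s‖ ≤ |Real.log q| + ‖eF a s‖ + 2 * ‖deriv M s / M s‖ := by
      unfold VF
      calc _ ≤ ‖(Real.log q : ℂ) + eF a s‖ + ‖2*(deriv M s / M s)‖ := norm_add_le _ _
        _ ≤ ‖(Real.log q : ℂ)‖ + ‖eF a s‖ + ‖2*(deriv M s / M s)‖ := by
          gcongr; exact norm_add_le _ _
        _ = _ := by rw [norm_real, norm_mul]; simp
    rw [hC0]
    nlinarith [abs_nonneg (Real.log q)]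
  refine ⟨C0 + (3 + 9*C0)/(c-1/2), by
    have : 0 < c - 1/2 := by linarith
    positivity, ?_⟩
  intro s hs
  have hcp : 0 < c - 1/2 := by linarith
  rcases le_or_gt 2 s.re with h2 | h2
  · refine (direct s (by linarith)).trans ?_
    have : 0 ≤ (3 + 9*C0)/(c-1/2) := by positivity
    gcongr; linarith
  set c0 : ℂ := 2 + s.im * I with hc0
  have hc0re : c0.re = 2 := by simp [hc0]
  have hball : ∀ u ∈ Metric.ball c0 (3/2), 1/2 < u.re := by
    intro u hu
    rw [Metric.mem_ball, dist_eq] at hu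
    have := abs_re_le_norm (u-c0)
    rw [sub_re, hc0re] at this
    have h3 := abs_lt.1 (lt_of_le_of_lt this hu)
    linarith
  have hsc : s - c0 = ((s.re - 2 : ℝ) : ℂ) := by
    apply Complex.ext <;> simp [hc0]
  have hsn : ‖s - c0‖ = 2 - s.re := by
    rw [hsc, norm_real, Real.norm_eq_abs, abs_of_nonpos (by linarith)]; ring
  have hsb : s ∈ Metric.ball c0 (3/2) := by
    rw [Metric.mem_ball, dist_eq, hsn]; linarith
  have bc := borelCaratheodory (f := fun z => -VF M a q (c0 + z)) (M := 1) (R := 3/2) (z := s - c0)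
    one_pos
    (by
      intro z hz
      have hz' : c0 + z ∈ Metric.ball c0 (3/2) := by simpa using hz
      have := (H.VF_diff _ (hball _ hz'))
      exact (this.comp z (by fun_prop : DifferentiableAt ℂ (fun z => c0 + z) z)).neg.differentiableWithinAt)
    (by
      intro z hz
      have := H.VF_re (c0+z) (hball _ (by simpa using hz))
      simp only [Set.mem_setOf_eq, neg_re]; linarith) (by norm_num) (by simpa [dist_eq] using hsb)
  simp only [add_sub_cancel, norm_neg, add_zero] at bc
  rw [hsn] at bc
  have hV0 := direct c0 (by rw [hc0re]; norm_num)
  have hc0n : (1+‖c0‖)^((1/2):ℝ) ≤ 3 * (1+‖s‖)^((1/2):ℝ) := by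
    have h4 : ‖c0‖ ≤ 2 + ‖s‖ := by
      calc ‖c0‖ ≤ ‖(2:ℂ)‖ + ‖(s.im:ℂ) * I‖ := norm_add_le _ _
        _ = 2 + |s.im| := by simp
        _ ≤ _ := by gcongr; exact abs_im_le_norm s
    calc (1+‖c0‖)^((1/2):ℝ) ≤ (9 * (1+‖s‖))^((1/2):ℝ) := by
          apply Real.rpow_le_rpow (by positivity) _ (by norm_num)
          linarith [norm_nonneg s]
      _ = _ := by
        rw [Real.mul_rpow (by norm_num) (by positivity)]
        congr 1
        rw [show (9:ℝ) = 3^(2:ℝ) by norm_num, ← Real.rpow_mul (by norm_num)]; norm_num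
  have h1s := hR1 s
  calc ‖VF M a q s‖ ≤ _ := bc
    _ ≤ 2*1*(3/2)/(c-1/2) + C0 * (3*(1+‖s‖)^((1/2):ℝ)) * 3/(c-1/2) := by
      have e1 : 0 ≤ 2 - s.re := by linarith
      have e2 : c - 1/2 ≤ 3/2 - (2 - s.re) := by linarith
      have e3 : 2 - s.re ≤ 3/2 := by linarith
      have e4 : 3/2 + (2 - s.re) ≤ 3 := by linarith
      have e5 : ‖VF M a q c0‖ ≤ C0 * (3*(1+‖s‖)^((1/2):ℝ)) := hV0.trans (by gcongr)
      gcongr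
    _ = (3 + 9*C0*(1+‖s‖)^((1/2):ℝ))/(c-1/2) := by ring
    _ ≤ ((3 + 9*C0)*(1+‖s‖)^((1/2):ℝ))/(c-1/2) := by gcongr; nlinarith
    _ = (3 + 9*C0)/(c-1/2) * (1+‖s‖)^((1/2):ℝ) := by ring
    _ ≤ _ := by gcongr; linarith

end P4

section P6
open Complex MeasureTheory

lemma quarter_le (t : ℝ) : 1/(1/4+t^2) ≤ 5 * ((1+|t|)^2)⁻¹ := by
  rw [← div_eq_mul_inv, div_le_div_iff₀ (by positivity) (by positivity)]
  nlinarith [sq_nonneg (2*|t|-1/2), sq_abs t]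

lemma half_mul_quarter (t : ℝ) : (1+|t|)^((1/2):ℝ) * (1/(1/4+t^2)) ≤ 5 * (1+|t|)^(-(3/2):ℝ) := by
  have hp : 0 < 1 + |t| := by positivity
  have h : (1+|t|)^((1/2):ℝ) * ((1+|t|)^2)⁻¹ = (1+|t|)^(-(3/2):ℝ) := by
    rw [← Real.rpow_natCast, ← Real.rpow_neg hp.le, ← Real.rpow_add hp]; norm_num
  calc _ ≤ (1+|t|)^((1/2):ℝ) * (5 * ((1+|t|)^2)⁻¹) := by
        gcongr; exact quarter_le t
    _ = 5 * ((1+|t|)^((1/2):ℝ) * ((1+|t|)^2)⁻¹) := by ring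
    _ = _ := by rw [h]

lemma integral_quarter : ∫ t : ℝ, 1/(1/4+t^2) = 2*Real.pi ∧ Integrable (fun t : ℝ => 1/(1/4+t^2)) := by
  have h1 := integral_poisson (1/2) (by norm_num)
  have h2 := integrable_poisson (1/2) (by norm_num)
  have e : ∀ t : ℝ, 1/(1/4+t^2) = 2 * ((1/2)/((1/2)^2+t^2)) := fun t => by
    norm_num; ring
  simp_rw [e]
  exact ⟨by rw [integral_const_mul, h1], h2.const_mul _⟩

lemma line_bound (g k : ℝ → ℂ) (A B X : ℝ) (hA : 0 ≤ A) (hB : 0 ≤ B) (hX : 0 ≤ X)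
    (hg : ∀ t, ‖g t‖ ≤ A + B * (1+|t|)^((1/2):ℝ)) (hk : ∀ t, ‖k t‖ ≤ X * (1/(1/4+t^2))) :
    ‖∫ t, g t * k t‖ ≤ X * (2*Real.pi*A + 20*B) := by
  have hi : Integrable (fun t : ℝ => X * A * (1/(1/4+t^2)) + X * B * 5 * (1+|t|)^(-(3/2):ℝ)) :=
    (integral_quarter.2.const_mul _).add ((phi_integrable (3/2) (by norm_num)).const_mul _)
  have := norm_integral_le_of_norm_le (f := fun t => g t * k t) hi
    (Filter.Eventually.of_forall fun t => by
      have h2 := half_mul_quarter t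
      rw [norm_mul]
      calc _ ≤ (A + B * (1+|t|)^((1/2):ℝ)) * (X * (1/(1/4+t^2))) := by
            gcongr
            · exact hg t
            · exact hk t
        _ = X * A * (1/(1/4+t^2)) + X * B * ((1+|t|)^((1/2):ℝ) * (1/(1/4+t^2))) := by ring
        _ ≤ X * A * (1/(1/4+t^2)) + X * B * (5 * (1+|t|)^(-(3/2):ℝ)) := by gcongr
        _ = _ := by ring)
  refine this.trans (le_of_eq ?_)
  rw [integral_add (integral_quarter.2.const_mul _) ((phi_integrable (3/2) (by norm_num)).const_mul _),
    integral_const_mul, integral_const_mul, integral_quarter.1, phi_integral]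
  ring

lemma strip_bound {g k : ℂ} {t P X : ℝ} (hP : 0 ≤ P)
    (hg : ‖g‖ ≤ P * (1+|t|)^((1/2):ℝ)) (hk : ‖k‖ ≤ X * (1/(1/4+t^2))) (hX : 0 ≤ X) :
    ‖g * k‖ ≤ P * X * 5 * (1+|t|)^(-(3/2):ℝ) := by
  rw [norm_mul]
  have h2 := half_mul_quarter t
  calc _ ≤ (P * (1+|t|)^((1/2):ℝ)) * (X * (1/(1/4+t^2))) := by gcongr
    _ = P * X * ((1+|t|)^((1/2):ℝ) * (1/(1/4+t^2))) := by ring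
    _ ≤ P * X * (5 * (1+|t|)^(-(3/2):ℝ)) := by gcongr
    _ = _ := by ring

lemma half_pow_im (s : ℂ) (h1 : -(1/2) ≤ s.re) (h2 : s.re ≤ 3/2) :
    (1+‖s‖)^((1/2):ℝ) ≤ 8/5 * (1+|s.im|)^((1/2):ℝ) := by
  have h3 : ‖s‖ ≤ 3/2 + |s.im| := by
    have := norm_le_abs_re_add_abs_im s
    have : |s.re| ≤ 3/2 := by rw [abs_le]; constructor <;> linarith
    linarith
  calc (1+‖s‖)^((1/2):ℝ) ≤ (64/25 * (1+|s.im|))^((1/2):ℝ) := by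
        apply Real.rpow_le_rpow (by positivity) _ (by norm_num)
        linarith [abs_nonneg s.im]
    _ = _ := by
      rw [Real.mul_rpow (by norm_num) (by positivity)]
      congr 1
      rw [show (64/25:ℝ) = (8/5)^(2:ℝ) by norm_num, ← Real.rpow_mul (by norm_num)]; norm_num

lemma norm_sq_inv_le (u : ℂ) (hu : 1/2 ≤ u.re) : ‖(u^2)⁻¹‖ ≤ 1/(1/4+u.im^2) := by
  rw [norm_inv, norm_pow, ← normSq_eq_norm_sq, normSq_apply, ← one_div]
  apply one_div_le_one_div_of_le (by positivity)
  nlinarith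

noncomputable def GF (x : ℝ) (s : ℂ) : ℂ := (x:ℂ)^s * ((s+1)^2)⁻¹
noncomputable def GT (x c : ℝ) (s : ℂ) : ℂ := (x:ℂ)^((2*c:ℝ) - s) * ((((2*c+1:ℝ):ℂ) - s)^2)⁻¹

lemma GF_diff (x : ℝ) (hx : 0 < x) (s : ℂ) (hs : -(1/2) ≤ s.re) : DifferentiableAt ℂ (GF x) s := by
  unfold GF
  have h1 : (x:ℂ) ≠ 0 := by exact_mod_cast hx.ne'
  refine DifferentiableAt.mul ?_ (DifferentiableAt.inv (by fun_prop) ?_)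
  · exact DifferentiableAt.const_cpow (by fun_prop) (Or.inl h1)
  · apply pow_ne_zero; intro h
    have := congrArg Complex.re h
    simp at this; linarith

lemma GT_diff (x c : ℝ) (hx : 0 < x) (hc : 1/2 < c) (s : ℂ) (hs : s.re ≤ 3/2) :
    DifferentiableAt ℂ (GT x c) s := by
  unfold GT
  have h1 : (x:ℂ) ≠ 0 := by exact_mod_cast hx.ne'
  refine DifferentiableAt.mul ?_ (DifferentiableAt.inv (by fun_prop) ?_)
  · exact DifferentiableAt.const_cpow (by fun_prop) (Or.inl h1)
  · apply pow_ne_zero; intro h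
    have := congrArg Complex.re h
    simp at this; linarith

lemma GF_norm (x : ℝ) (hx : 0 < x) (s : ℂ) (hs : -(1/2) ≤ s.re) :
    ‖GF x s‖ ≤ x^s.re * (1/(1/4+s.im^2)) := by
  unfold GF
  rw [norm_mul, norm_cpow_eq_rpow_re_of_pos hx]
  have := norm_sq_inv_le (s+1) (by simp; linarith)
  gcongr
  simpa using this

lemma GT_norm (x c : ℝ) (hx : 0 < x) (hc : 1/2 < c) (s : ℂ) (hs : s.re ≤ 3/2) :
    ‖GT x c s‖ ≤ x^(2*c-s.re) * (1/(1/4+s.im^2)) := by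
  unfold GT
  rw [norm_mul, norm_cpow_eq_rpow_re_of_pos hx]
  have := norm_sq_inv_le (((2*c+1:ℝ):ℂ)-s) (by simp; linarith)
  have e : (((2*c:ℝ):ℂ) - s).re = 2*c - s.re := by simp
  rw [e]
  gcongr
  simpa using this

lemma conj_GF (x c : ℝ) (hx : 0 < x) (t : ℝ) :
    (starRingEnd ℂ) (GF x (c + t*I)) = GT x c (c + t*I) := by
  unfold GF GT
  have h1 : (starRingEnd ℂ) ((x:ℂ)^((c:ℂ)+t*I)) = (x:ℂ)^((c:ℂ) - t*I) := by
    have h := cpow_conj (x:ℂ) ((c:ℂ)+t*I) (by rw [arg_ofReal_of_nonneg hx.le]; exact Real.pi_pos.ne)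
    rw [conj_ofReal] at h
    rw [← h]
    simp [sub_eq_add_neg]
  rw [map_mul, h1, map_inv₀, map_pow]
  congr 2
  · push_cast; ring
  · congr 1
    simp; ring

lemma integral_add4 (f g h k : ℝ → ℂ) (u v : ℂ) (hf : Integrable f) (hg : Integrable g)
    (hh : Integrable h) (hk : Integrable k) :
    ∫ t, (f t + u * g t + v * h t + k t) = (∫ t, f t) + u * (∫ t, g t) + v * (∫ t, h t) + ∫ t, k t := by
  have i1 : Integrable (fun t => f t + u * g t) := hf.add (hg.const_mul _)
  have i2 : Integrable (fun t => f t + u * g t + v * h t) := i1.add (hh.const_mul _)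
  rw [integral_add i2 hk, integral_add i1 (hh.const_mul _), integral_add hf (hg.const_mul _),
    integral_const_mul, integral_const_mul]

/-- main bound at abscissa `c` -/
lemma GoodData.bound_c {M : ℂ → ℂ} {a q : ℝ} (H : GoodData M a q) (ha2 : a ≤ 2) (B : ℝ)
    (hB : ∀ s : ℂ, 3/2 ≤ s.re → ‖deriv M s / M s‖ ≤ B) (c : ℝ) (hc : 1/2 < c) (hc1 : c < 1)
    (x : ℝ) (hx : 1 ≤ x) :
    ‖∫ t : ℝ, (deriv M ((3/2:ℝ) + t*I) / M ((3/2:ℝ) + t*I)) * GF x ((3/2:ℝ) + t*I)‖ ≤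
      x^c * (Real.pi / (c+1)) * (VF M a q ((2*c+1:ℝ):ℂ)).re
      + 1/2 * (x^(-(1/2):ℝ) * (2*Real.pi*(Real.log q + 5/2) + 100))
      + 1/2 * (x^(2*c-3/2) * (2*Real.pi*(Real.log q + 5/2) + 100))
      + x^(2*c-3/2) * (2*Real.pi*B) := by
  have hx0 : 0 < x := by linarith
  have hB0 : 0 ≤ B := le_trans (norm_nonneg _) (hB 2 (by norm_num))
  have hlq : 0 ≤ Real.log q := Real.log_nonneg H.qpos
  obtain ⟨C, hC0, hC⟩ := H.VF_growth ha2 B hB c hc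
  set D : ℂ → ℂ := fun s => deriv M s / M s with hD
  set E : ℂ → ℂ := fun s => (Real.log q : ℂ) + eF a s with hE
  have hEd : ∀ s : ℂ, -(1/2) ≤ s.re → DifferentiableAt ℂ E s := fun s hs =>
    (eF_diff a H.apos s (by linarith)).const_add _
  have hEb : ∀ s : ℂ, -(1/2) ≤ s.re → s.re ≤ 3/2 →
      ‖E s‖ ≤ (Real.log q + 5/2) + 5 * (1+|s.im|)^((1/2):ℝ) := by
    intro s h1 h2
    have k1 := eF_bound a H.apos ha2 s h1
    have k2 := half_pow_im s h1 h2
    have k3 : ‖E s‖ ≤ ‖(Real.log q : ℂ)‖ + ‖eF a s‖ := norm_add_le _ _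
    rw [norm_real, Real.norm_of_nonneg hlq] at k3
    have : 0 ≤ (1+|s.im|)^((1/2):ℝ) := by positivity
    linarith
  have h1im : ∀ s : ℂ, 1 ≤ (1+|s.im|)^((1/2):ℝ) := fun s =>
    Real.one_le_rpow (by linarith [abs_nonneg s.im]) (by norm_num)
  set PE := Real.log q + 5/2 + 5 with hPE
  have hEb' : ∀ s : ℂ, -(1/2) ≤ s.re → s.re ≤ 3/2 → ‖E s‖ ≤ PE * (1+|s.im|)^((1/2):ℝ) := by
    intro s h1 h2
    have := hEb s h1 h2
    have := h1im s
    rw [hPE]; nlinarith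
  have hVE : ∀ s, VF M a q s = E s + 2 * D s := fun s => rfl
  set PD := (C * (8/5) + PE) with hPD
  have hPE0 : 0 ≤ PE := by positivity
  have hPD0 : 0 ≤ PD := by positivity
  have hVb : ∀ s : ℂ, c ≤ s.re → s.re ≤ 3/2 → ‖VF M a q s‖ ≤ C*(8/5) * (1+|s.im|)^((1/2):ℝ) := by
    intro s h1 h2
    have k1 := hC s h1
    have k2 := half_pow_im s (by linarith) h2
    calc _ ≤ _ := k1
      _ ≤ C * (8/5 * (1+|s.im|)^((1/2):ℝ)) := by gcongr
      _ = _ := by ring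
  have hDb : ∀ s : ℂ, c ≤ s.re → s.re ≤ 3/2 → ‖D s‖ ≤ PD * (1+|s.im|)^((1/2):ℝ) := by
    intro s h1 h2
    have k1 := hVb s h1 h2
    have k3 := hEb' s (by linarith) h2
    have k4 : 2 * D s = VF M a q s - E s := by rw [hVE]; ring
    have k5 : 2 * ‖D s‖ ≤ ‖VF M a q s‖ + ‖E s‖ := by
      have : ‖2 * D s‖ = 2 * ‖D s‖ := by rw [norm_mul]; simp
      rw [← this, k4]; exact norm_sub_le _ _
    have := norm_nonneg (D s)
    rw [hPD]; nlinarith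
  have hDd : ∀ s : ℂ, c ≤ s.re → DifferentiableAt ℂ D s := fun s hs => H.D_diff s (by linarith)
  -- kernel bounds
  set X := x^(3/2:ℝ) with hX
  have hX0 : 0 ≤ X := by positivity
  have hGF : ∀ s : ℂ, -(1/2) ≤ s.re → s.re ≤ 3/2 → ‖GF x s‖ ≤ X * (1/(1/4+s.im^2)) := by
    intro s h1 h2
    refine (GF_norm x hx0 s h1).trans ?_
    have := Real.rpow_le_rpow_of_exponent_le hx h2
    gcongr
  have hGT : ∀ s : ℂ, c ≤ s.re → s.re ≤ 3/2 → ‖GT x c s‖ ≤ X * (1/(1/4+s.im^2)) := by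
    intro s h1 h2
    refine (GT_norm x c hx0 hc s h2).trans ?_
    have := Real.rpow_le_rpow_of_exponent_le hx (by linarith : 2*c - s.re ≤ 3/2)
    gcongr
  -- shifts
  have s1 : ∫ t : ℝ, D (c + t*I) * GF x (c + t*I) = ∫ t : ℝ, D ((3/2:ℝ) + t*I) * GF x ((3/2:ℝ) + t*I) :=
    contour_shift (fun s => D s * GF x s) c (3/2) (PD*X*5) (by linarith)
      (fun s h1 _ => (hDd s h1).mul (GF_diff x hx0 s (by linarith)))
      (fun s h1 h2 => strip_bound hPD0 (hDb s h1 h2) (hGF s (by linarith) h2) hX0)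
  have s2 : ∫ t : ℝ, D (c + t*I) * GT x c (c + t*I) = ∫ t : ℝ, D ((3/2:ℝ) + t*I) * GT x c ((3/2:ℝ) + t*I) :=
    contour_shift (fun s => D s * GT x c s) c (3/2) (PD*X*5) (by linarith)
      (fun s h1 h2 => (hDd s h1).mul (GT_diff x c hx0 hc s h2))
      (fun s h1 h2 => strip_bound hPD0 (hDb s h1 h2) (hGT s h1 h2) hX0)
  have s3 : ∫ t : ℝ, E (c + t*I) * GT x c (c + t*I) = ∫ t : ℝ, E ((3/2:ℝ) + t*I) * GT x c ((3/2:ℝ) + t*I) :=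
    contour_shift (fun s => E s * GT x c s) c (3/2) (PE*X*5) (by linarith)
      (fun s h1 h2 => (hEd s (by linarith)).mul (GT_diff x c hx0 hc s h2))
      (fun s h1 h2 => strip_bound hPE0 (hEb' s (by linarith) h2) (hGT s h1 h2) hX0)
  have s4 : ∫ t : ℝ, E ((-(1/2):ℝ) + t*I) * GF x ((-(1/2):ℝ) + t*I) = ∫ t : ℝ, E (c + t*I) * GF x (c + t*I) :=
    contour_shift (fun s => E s * GF x s) (-(1/2)) c (PE*X*5) (by linarith)
      (fun s h1 h2 => (hEd s h1).mul (GF_diff x hx0 s h1))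
      (fun s h1 h2 => strip_bound hPE0 (hEb' s h1 (by linarith)) (hGF s h1 (by linarith)) hX0)
  -- integrability on Re = c
  have hline : ∀ t : ℝ, ((c:ℂ) + t*I).re = c := fun t => by simp
  have iDT : Integrable (fun t : ℝ => D (c + t*I) * GT x c (c + t*I)) :=
    line_integrable (fun s => D s * GT x c s) c (PD*X*5)
      (fun s h => ((hDd s h.ge).mul (GT_diff x c hx0 hc s (by linarith))).continuousAt)
      (fun s h => strip_bound hPD0 (hDb s h.ge (by linarith)) (hGT s h.ge (by linarith)) hX0)
  have iET : Integrable (fun t : ℝ => E (c + t*I) * GT x c (c + t*I)) :=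
    line_integrable (fun s => E s * GT x c s) c (PE*X*5)
      (fun s h => ((hEd s (by linarith)).mul (GT_diff x c hx0 hc s (by linarith))).continuousAt)
      (fun s h => strip_bound hPE0 (hEb' s (by linarith) (by linarith)) (hGT s h.ge (by linarith)) hX0)
  have iEF : Integrable (fun t : ℝ => E (c + t*I) * GF x (c + t*I)) :=
    line_integrable (fun s => E s * GF x s) c (PE*X*5)
      (fun s h => ((hEd s (by linarith)).mul (GF_diff x hx0 s (by linarith))).continuousAt)
      (fun s h => strip_bound hPE0 (hEb' s (by linarith) (by linarith)) (hGF s (by linarith) (by linarith)) hX0)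
  have iDF : Integrable (fun t : ℝ => D (c + t*I) * GF x (c + t*I)) :=
    line_integrable (fun s => D s * GF x s) c (PD*X*5)
      (fun s h => ((hDd s h.ge).mul (GF_diff x hx0 s (by linarith))).continuousAt)
      (fun s h => strip_bound hPD0 (hDb s h.ge (by linarith)) (hGF s (by linarith) (by linarith)) hX0)
  have cET : ∫ t : ℝ, (starRingEnd ℂ) (E (c + t*I) * GT x c (c + t*I)) =
      (starRingEnd ℂ) (∫ t : ℝ, E (c + t*I) * GT x c (c + t*I)) := integral_conj
  have cDT : ∫ t : ℝ, (starRingEnd ℂ) (D (c + t*I) * GT x c (c + t*I)) =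
      (starRingEnd ℂ) (∫ t : ℝ, D (c + t*I) * GT x c (c + t*I)) := integral_conj
  have iET' : Integrable (fun t : ℝ => (starRingEnd ℂ) (E (c + t*I) * GT x c (c + t*I))) :=
    (conjCLE.toContinuousLinearMap.integrable_comp iET)
  have iDT' : Integrable (fun t : ℝ => (starRingEnd ℂ) (D (c + t*I) * GT x c (c + t*I))) :=
    (conjCLE.toContinuousLinearMap.integrable_comp iDT)
  have pw : ∀ t : ℝ, D (c + t*I) * GF x (c + t*I) + 1/2 * (E (c + t*I) * GF x (c + t*I))
      + 1/2 * (starRingEnd ℂ) (E (c + t*I) * GT x c (c + t*I))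
      + (starRingEnd ℂ) (D (c + t*I) * GT x c (c + t*I))
      = ((VF M a q (c + t*I)).re : ℂ) * GF x (c + t*I) := by
    intro t
    rw [← conj_GF x c hx0 t, map_mul, map_mul, conj_conj, re_eq_add_conj, hVE]
    simp only [map_add, map_mul, map_ofNat]
    ring
  have hsum : (∫ t : ℝ, D (c + t*I) * GF x (c + t*I)) + 1/2 * (∫ t : ℝ, E (c + t*I) * GF x (c + t*I))
      + 1/2 * (starRingEnd ℂ) (∫ t : ℝ, E (c + t*I) * GT x c (c + t*I))
      + (starRingEnd ℂ) (∫ t : ℝ, D (c + t*I) * GT x c (c + t*I))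
      = ∫ t : ℝ, ((VF M a q (c + t*I)).re : ℂ) * GF x (c + t*I) := by
    simp_rw [← pw]
    rw [integral_add4 _ _ _ _ (1/2) (1/2) iDF iEF iET' iDT', cET, cDT]
  -- the positive part
  obtain ⟨pi1, pi2⟩ := poisson (VF M a q) c C (by linarith) hC0 (fun s hs => H.VF_diff s (by linarith)) hC
  have hposb : ‖∫ t : ℝ, ((VF M a q (c + t*I)).re : ℂ) * GF x (c + t*I)‖ ≤
      x^c * (Real.pi / (c+1)) * (VF M a q ((2*c+1:ℝ):ℂ)).re := by
    have r1 : Integrable (fun t : ℝ => (VF M a q (c + t*I) * (((c+1)/((c+1)^2+t^2) : ℝ):ℂ)).re) :=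
      pi1.re
    have r2 : ∫ t : ℝ, (VF M a q (c + t*I) * (((c+1)/((c+1)^2+t^2) : ℝ):ℂ)).re
        = Real.pi * (VF M a q ((2*c+1:ℝ):ℂ)).re := by
      have := integral_re pi1
      simp only [RCLike.re_to_complex] at this
      rw [this, pi2]; simp
    have hn := norm_integral_le_of_norm_le (f := fun t : ℝ => ((VF M a q (c + t*I)).re : ℂ) * GF x (c + t*I))
      (r1.const_mul (x^c/(c+1))) (Filter.Eventually.of_forall fun t => by
        have hp := H.VF_re (c + t*I) (by simpa using hc)
        rw [norm_mul, norm_real, Real.norm_of_nonneg hp, re_mul_ofReal]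
        unfold GF
        rw [norm_mul, norm_cpow_eq_rpow_re_of_pos hx0, hline, norm_inv, norm_pow,
          ← normSq_eq_norm_sq, normSq_apply]
        apply le_of_eq
        have : (c+1)^2+t^2 ≠ 0 := by positivity
        have hc1' : c + 1 ≠ 0 := by linarith
        simp
        field_simp)
    refine hn.trans (le_of_eq ?_)
    rw [integral_const_mul, r2]; ring
  have b4 : ‖∫ t : ℝ, E (c + t*I) * GF x (c + t*I)‖ ≤ x^(-(1/2):ℝ) * (2*Real.pi*(Real.log q + 5/2) + 100) := by
    rw [← s4]
    refine (line_bound _ _ (Real.log q + 5/2) 5 (x^(-(1/2):ℝ)) (by positivity) (by norm_num) (by positivity)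
      (fun t => ?_) (fun t => ?_)).trans (le_of_eq (by ring))
    · simpa using hEb ((-(1/2):ℝ) + t*I) (by simp) (by norm_num)
    · have := GF_norm x hx0 ((-(1/2):ℝ) + t*I) (by simp)
      simpa using this
  have b3 : ‖∫ t : ℝ, E (c + t*I) * GT x c (c + t*I)‖ ≤ x^(2*c-3/2) * (2*Real.pi*(Real.log q + 5/2) + 100) := by
    rw [s3]
    refine (line_bound _ _ (Real.log q + 5/2) 5 (x^(2*c-3/2)) (by positivity) (by norm_num) (by positivity)
      (fun t => ?_) (fun t => ?_)).trans (le_of_eq (by ring))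
    · simpa using hEb ((3/2:ℝ) + t*I) (by norm_num) (by simp)
    · have := GT_norm x c hx0 hc ((3/2:ℝ) + t*I) (by simp)
      simpa using this
  have b2 : ‖∫ t : ℝ, D (c + t*I) * GT x c (c + t*I)‖ ≤ x^(2*c-3/2) * (2*Real.pi*B) := by
    rw [s2]
    refine (line_bound _ _ B 0 (x^(2*c-3/2)) hB0 le_rfl (by positivity)
      (fun t => ?_) (fun t => ?_)).trans (le_of_eq (by ring))
    · have := hB ((3/2:ℝ) + t*I) (by simp)
      rw [zero_mul, add_zero]; exact this
    · have := GT_norm x c hx0 hc ((3/2:ℝ) + t*I) (by simp)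
      simpa using this
  rw [← s1]
  have hfin : ∫ t : ℝ, D (c + t*I) * GF x (c + t*I) =
      (∫ t : ℝ, ((VF M a q (c + t*I)).re : ℂ) * GF x (c + t*I))
      - 1/2 * (∫ t : ℝ, E (c + t*I) * GF x (c + t*I))
      - 1/2 * (starRingEnd ℂ) (∫ t : ℝ, E (c + t*I) * GT x c (c + t*I))
      - (starRingEnd ℂ) (∫ t : ℝ, D (c + t*I) * GT x c (c + t*I)) := by
    rw [← hsum]; ring
  rw [hfin]
  have n1 : ∀ z : ℂ, ‖(1/2:ℂ) * z‖ = 1/2 * ‖z‖ := fun z => by rw [norm_mul]; norm_num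
  refine (norm_sub_le _ _).trans ?_
  rw [norm_conj]
  refine add_le_add ((norm_sub_le _ _).trans ?_) b2
  rw [n1, norm_conj]
  refine add_le_add ((norm_sub_le _ _).trans ?_) (by linarith)
  rw [n1]
  exact add_le_add hposb (by linarith)

lemma GoodData.bound {M : ℂ → ℂ} {a q : ℝ} (H : GoodData M a q) (ha2 : a ≤ 2) (B : ℝ)
    (hB : ∀ s : ℂ, 3/2 ≤ s.re → ‖deriv M s / M s‖ ≤ B) (x : ℝ) (hx : 1 ≤ x) :
    ‖∫ t : ℝ, (deriv M ((3/2:ℝ) + t*I) / M ((3/2:ℝ) + t*I)) * GF x ((3/2:ℝ) + t*I)‖ ≤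
      2*Real.pi*(Real.sqrt x/3 * (VF M a q 2).re + (Real.sqrt x)⁻¹ * (Real.log q + 37/2 + B)) := by
  have hx0 : 0 < x := by linarith
  have hcont : ContinuousAt (fun c : ℝ => x^c * (Real.pi / (c+1)) * (VF M a q ((2*c+1:ℝ):ℂ)).re
      + 1/2 * (x^(-(1/2):ℝ) * (2*Real.pi*(Real.log q + 5/2) + 100))
      + 1/2 * (x^(2*c-3/2) * (2*Real.pi*(Real.log q + 5/2) + 100))
      + x^(2*c-3/2) * (2*Real.pi*B)) (1/2) := by
    have hV : ContinuousAt (fun c : ℝ => (VF M a q ((2*c+1:ℝ):ℂ)).re) (1/2) := by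
      refine continuous_re.continuousAt.comp ?_
      refine ContinuousAt.comp (f := fun c : ℝ => ((2*c+1:ℝ):ℂ)) (g := VF M a q) ?_ (by fun_prop)
      exact (H.VF_diff _ (by norm_num)).continuousAt
    have h1 : ContinuousAt (fun c : ℝ => x^c) (1/2) := (Real.continuous_const_rpow hx0.ne').continuousAt
    have h2 : ContinuousAt (fun c : ℝ => x^(2*c-3/2)) (1/2) :=
      ((Real.continuous_const_rpow hx0.ne').comp (by fun_prop : Continuous fun c : ℝ => 2*c-3/2)).continuousAt
    have h3 : ContinuousAt (fun c : ℝ => Real.pi/(c+1)) (1/2) :=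
      continuousAt_const.div (by fun_prop) (by norm_num)
    exact ((((h1.mul h3).mul hV).add continuousAt_const).add
      (continuousAt_const.mul (h2.mul continuousAt_const))).add (h2.mul continuousAt_const)
  have hle := ge_of_tendsto (hcont.tendsto.mono_left (nhdsWithin_le_nhds (s := Set.Ioi (1/2)))) (by
    filter_upwards [Ioo_mem_nhdsGT (by norm_num : (1/2:ℝ) < 1)] with c hc
    exact H.bound_c ha2 B hB c hc.1 hc.2 x hx)
  refine hle.trans ?_
  have e1 : x^(1/2:ℝ) = Real.sqrt x := (Real.sqrt_eq_rpow x).symm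
  have e2 : x^(-(1/2):ℝ) = (Real.sqrt x)⁻¹ := by rw [Real.rpow_neg hx0.le, e1]
  have e3 : x^(2*(1/2)-3/2:ℝ) = (Real.sqrt x)⁻¹ := by rw [← e2]; norm_num
  have e4 : ((2*(1/2)+1:ℝ):ℂ) = 2 := by push_cast; norm_num
  rw [e3, e2, e1, e4]
  have hi : 0 < (Real.sqrt x)⁻¹ := inv_pos.2 (Real.sqrt_pos.2 hx0)
  have : (Real.sqrt x)⁻¹ * 100 ≤ (Real.sqrt x)⁻¹ * (32 * Real.pi) := by
    gcongr; linarith [Real.pi_gt_d6]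
  generalize (Real.sqrt x)⁻¹ = v at *
  generalize (VF M a q 2).re = w at *
  have e : Real.sqrt x * (Real.pi / (1 / 2 + 1)) * w = 2*Real.pi*(Real.sqrt x/3*w) := by ring
  rw [e]
  linarith

end P6

section P7
open Complex MeasureTheory

lemma mellin_log_aux (s : ℂ) (hs : -1 < s.re) :
    HasMellin (fun t : ℝ => Real.log t • (Set.indicator (Set.Ioc 0 1) (fun t => (t:ℂ) ^ (1:ℂ) : ℝ → ℂ)) t) s
      (-((s+1)^2)⁻¹) := by
  set h : ℝ → ℂ := Set.indicator (Set.Ioc 0 1) (fun t => (t:ℂ) ^ (1:ℂ) : ℝ → ℂ) with hh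
  have hloc : LocallyIntegrableOn h (Set.Ioi 0) := by
    have : Integrable h := by
      rw [hh, integrable_indicator_iff measurableSet_Ioc]
      simp only [cpow_one]
      exact (Complex.continuous_ofReal.integrableOn_Icc (a := 0) (b := 1)).mono_set Set.Ioc_subset_Icc_self
    exact this.locallyIntegrable.locallyIntegrableOn _
  have h1 : h =O[Filter.atTop] (fun t : ℝ => t ^ (-(s.re+1))) := by
    refine Asymptotics.IsBigO.of_bound 1 ?_
    filter_upwards [Filter.eventually_gt_atTop 1] with t ht
    rw [hh, Set.indicator_of_notMem (by simp [ht])]; simp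
  have h2 : h =O[nhdsWithin 0 (Set.Ioi 0)] (fun t : ℝ => t ^ (-(-1:ℝ))) := by
    refine Asymptotics.IsBigO.of_bound 1 (Filter.Eventually.of_forall fun t => ?_)
    rw [hh]
    refine (norm_indicator_le_norm_self _ _).trans ?_
    simp
  have key := mellin_hasDerivAt_of_isBigO_rpow hloc h1 (by linarith) h2 hs
  refine ⟨key.1, ?_⟩
  have e : mellin h =ᶠ[nhds s] fun z => (z+1)⁻¹ := by
    have : {z : ℂ | -1 < z.re} ∈ nhds s := (isOpen_lt continuous_const continuous_re).mem_nhds hs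
    filter_upwards [this] with z hz
    have hz2 : 0 < z.re + (1:ℂ).re := by
      have hz3 : -1 < z.re := hz
      rw [one_re]; linarith
    have := (hasMellin_cpow_Ioc 1 (s := z) hz2).2
    rw [hh, this]; simp
  have hne : s + 1 ≠ 0 := fun h0 => by
    have := congrArg re h0; simp at this; linarith
  have d2 : HasDerivAt (fun z : ℂ => (z+1)⁻¹) (-1/(s+1)^2) s :=
    ((hasDerivAt_id s).add_const 1).fun_inv hne
  have := (key.2.congr_of_eventuallyEq e.symm).unique d2
  rw [this]; field_simp

/-- The kernel function. -/
noncomputable def kf (u : ℝ) : ℝ := u * max (-Real.log u) 0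

lemma kf_nonneg {u : ℝ} (hu : 0 ≤ u) : 0 ≤ kf u := mul_nonneg hu (le_max_right _ _)

lemma kf_mellin (s : ℂ) (hs : -1 < s.re) : HasMellin (fun u => (kf u : ℂ)) s (((s+1)^2)⁻¹) := by
  have h := mellin_log_aux s hs
  have h2 := hasMellin_const_smul h.1 (-1 : ℂ)
  rw [h.2] at h2
  have e : Set.EqOn (fun t : ℝ => (t:ℂ)^(s-1) • ((-1:ℂ) • (Real.log t • (Set.indicator (Set.Ioc 0 1) (fun t => (t:ℂ) ^ (1:ℂ) : ℝ → ℂ)) t)))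
     (fun t : ℝ => (t:ℂ)^(s-1) • (kf t : ℂ)) (Set.Ioi 0) := by
    intro t ht
    have ht : 0 < t := ht
    simp only
    congr 1
    by_cases h1 : t ≤ 1
    · rw [Set.indicator_of_mem (show t ∈ Set.Ioc (0:ℝ) 1 from ⟨ht, h1⟩), kf, max_eq_left (by simpa using Real.log_nonpos ht.le h1)]
      push_cast; simp; ring
    · rw [Set.indicator_of_notMem (by simp [h1]), kf, max_eq_right (by simpa using Real.log_nonneg (not_le.1 h1).le)]
      simp
  constructor
  · exact IntegrableOn.congr_fun h2.1 e measurableSet_Ioi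
  · rw [mellin, ← setIntegral_congr_fun measurableSet_Ioi e]
    have := h2.2
    rw [mellin] at this
    rw [this]; simp

lemma vert_int (f : ℂ → ℂ) (hf : ∀ t : ℝ, ‖f ((3/2:ℝ)+t*I)‖ ≤ 8 * (1/(1/4+t^2)))
   (hc : Continuous fun t : ℝ => f ((3/2:ℝ)+t*I)) : VerticalIntegrable f (3/2) := by
  rw [VerticalIntegrable]
  exact Integrable.mono' (integral_quarter.2.const_mul 8) hc.aestronglyMeasurable (Filter.Eventually.of_forall hf)

lemma ln_ne (t : ℝ) : ((3/2:ℝ):ℂ)+t*I + 1 ≠ 0 := fun h0 => by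
  have := congrArg re h0; norm_num at this

lemma ln_ne' (t : ℝ) : ((3/2:ℝ):ℂ)+t*I - 1 ≠ 0 := fun h0 => by
  have := congrArg re h0; norm_num at this

lemma ln_norm (t : ℝ) : ‖((((3/2:ℝ):ℂ)+t*I + 1)^2)⁻¹‖ ≤ 1/(1/4+t^2) := by
  rw [norm_inv, norm_pow, ← Complex.normSq_eq_norm_sq, Complex.normSq_apply, ← one_div]
  refine one_div_le_one_div_of_le (by positivity) ?_
  simp; nlinarith

lemma mellinInv_form (f : ℂ → ℂ) (y : ℝ) (hy : 0 < y) (c : ℂ) (h : mellinInv (3/2) f y⁻¹ = c) :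
    ∫ t : ℝ, (y:ℂ)^(((3/2:ℝ):ℂ)+t*I) * f (((3/2:ℝ):ℂ)+t*I) = 2*Real.pi * c := by
  rw [mellinInv] at h
  rw [← h]
  have e : ∀ t : ℝ, ((y⁻¹:ℝ):ℂ)^(-(((3/2:ℝ):ℂ)+t*I)) = (y:ℂ)^(((3/2:ℝ):ℂ)+t*I) := fun t => by
    rw [ofReal_inv, Complex.inv_cpow _ _ (by rw [Complex.arg_ofReal_of_nonneg hy.le]; exact Real.pi_pos.ne), cpow_neg, inv_inv]
  simp_rw [e, smul_eq_mul]
  rw [Complex.real_smul]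
  have : (Real.pi:ℂ) ≠ 0 := by exact_mod_cast Real.pi_ne_zero
  rw [← mul_assoc]
  have h1 : (2 * (Real.pi:ℂ)) * ((1 / (2 * Real.pi) : ℝ):ℂ) = 1 := by push_cast; field_simp
  rw [h1, one_mul]

lemma kernel_eval (y : ℝ) (hy : 0 < y) :
    ∫ t : ℝ, GF y ((3/2:ℝ)+t*I) = 2*Real.pi * (kf y⁻¹ : ℂ) := by
  have hm : ∀ s : ℂ, -1 < s.re → mellin (fun u => (kf u : ℂ)) s = ((s+1)^2)⁻¹ := fun s hs => (kf_mellin s hs).2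
  have hmt : ∀ t : ℝ, mellin (fun u => (kf u : ℂ)) ((3/2:ℝ)+t*I) = ((((3/2:ℝ):ℂ)+t*I + 1)^2)⁻¹ := fun t =>
    hm _ (by norm_num)
  have hv : VerticalIntegrable (mellin (fun u => (kf u : ℂ))) (3/2) := by
    apply vert_int
    · intro t; rw [hmt]
      refine (ln_norm t).trans ?_
      have : 0 ≤ 1/(1/4+t^2) := by positivity
      linarith
    · simp_rw [hmt]
      exact Continuous.inv₀ (by fun_prop) (fun t => pow_ne_zero _ (ln_ne t))
  have hyi : 0 < y⁻¹ := inv_pos.2 hy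
  have h := mellinInv_mellin_eq (3/2) (fun u => (kf u : ℂ)) hyi (kf_mellin _ (by norm_num)).1 hv (by
    apply Complex.continuous_ofReal.continuousAt.comp
    unfold kf
    exact continuousAt_id.mul (((Real.continuousAt_log hyi.ne').neg).max continuousAt_const))
  have := mellinInv_form _ y hy _ h
  rw [← this]
  congr 1; ext t
  rw [hmt]; rfl

lemma kernel_eval' (y : ℝ) (hy : 1 < y) :
    ∫ t : ℝ, (((3/2:ℝ):ℂ)+t*I-1)⁻¹ * GF y ((3/2:ℝ)+t*I) = 2*Real.pi * ((y/4 - (Real.log y/2+1/4)/y : ℝ) : ℂ) := by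
  have hy0 : 0 < y := by linarith
  set f : ℝ → ℂ := fun t => ((1/4:ℂ) • (Set.indicator (Set.Ioc 0 1) (fun t => (t:ℂ) ^ (-1:ℂ) : ℝ → ℂ)) t
    - (1/4:ℂ) • (Set.indicator (Set.Ioc 0 1) (fun t => (t:ℂ) ^ (1:ℂ) : ℝ → ℂ)) t)
    - (1/2:ℂ) • (kf t:ℂ) with hf
  have hm : ∀ t : ℝ, HasMellin f ((3/2:ℝ)+t*I) ((((3/2:ℝ):ℂ)+t*I - 1)⁻¹ * ((((3/2:ℝ):ℂ)+t*I + 1)^2)⁻¹) := by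
    intro t
    set s : ℂ := ((3/2:ℝ):ℂ)+t*I
    have a1 := hasMellin_cpow_Ioc (-1) (s := s) (by simp [s]; norm_num)
    have a2 := hasMellin_cpow_Ioc (1) (s := s) (by simp [s]; norm_num)
    have a3 := kf_mellin s (by simp [s]; norm_num)
    have b1 := hasMellin_const_smul a1.1 (1/4 : ℂ)
    have b2 := hasMellin_const_smul a2.1 (1/4 : ℂ)
    have b3 := hasMellin_const_smul a3.1 (1/2 : ℂ)
    have c1 := hasMellin_sub b1.1 b2.1
    have c2 := hasMellin_sub c1.1 b3.1
    refine ⟨c2.1, ?_⟩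
    have h1 : s + 1 ≠ 0 := ln_ne t
    have h2 : s - 1 ≠ 0 := ln_ne' t
    rw [hf, c2.2, c1.2, b1.2, b2.2, b3.2, a1.2, a2.2, a3.2]
    simp only [smul_eq_mul, ← sub_eq_add_neg]
    field_simp; ring
  have hv : VerticalIntegrable (mellin f) (3/2) := by
    apply vert_int
    · intro t; rw [(hm t).2, norm_mul]
      have : ‖(((3/2:ℝ):ℂ)+t*I - 1)⁻¹‖ ≤ 2 := by
        rw [norm_inv, inv_le_comm₀ (norm_pos_iff.2 (ln_ne' t)) (by norm_num)]
        refine le_trans ?_ (Complex.abs_re_le_norm _)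
        simp; norm_num
      have h0 : 0 ≤ 1/(1/4+t^2) := by positivity
      nlinarith [ln_norm t, norm_nonneg (((((3/2:ℝ):ℂ)+t*I + 1)^2)⁻¹)]
    · simp_rw [fun t => (hm t).2]
      exact (Continuous.inv₀ (by fun_prop) (fun t => (ln_ne' t))).mul (Continuous.inv₀ (by fun_prop) (fun t => pow_ne_zero _ (ln_ne t)))
  have hyi : 0 < y⁻¹ := inv_pos.2 hy0
  have hyi1 : y⁻¹ < 1 := inv_lt_one_of_one_lt₀ hy
  have hm0 : MellinConvergent f ((3/2:ℝ):ℂ) := by simpa using (hm 0).1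
  have hev : f =ᶠ[nhds y⁻¹] fun t => (1/4:ℂ) * (t:ℂ)^(-1:ℂ) - 1/4*(t:ℂ) - 1/2 * (kf t:ℂ) := by
    filter_upwards [Ioo_mem_nhds hyi hyi1] with t ht
    rw [hf]; simp only
    have hm : t ∈ Set.Ioc (0:ℝ) 1 := ⟨ht.1, ht.2.le⟩
    rw [Set.indicator_of_mem hm, Set.indicator_of_mem hm]
    simp
  have h := mellinInv_mellin_eq (3/2) f hyi hm0 hv (by
    refine ContinuousAt.congr ?_ hev.symm
    have k : ContinuousAt (fun t => (kf t : ℂ)) y⁻¹ := by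
      apply Complex.continuous_ofReal.continuousAt.comp
      unfold kf
      exact continuousAt_id.mul (((Real.continuousAt_log hyi.ne').neg).max continuousAt_const)
    have k2 : ContinuousAt (fun t : ℝ => (t:ℂ)^(-1:ℂ)) y⁻¹ := by
      simp_rw [cpow_neg_one]
      exact (Complex.continuous_ofReal.continuousAt).inv₀ (by exact_mod_cast hyi.ne')
    exact ((continuousAt_const.mul k2).sub (continuousAt_const.mul Complex.continuous_ofReal.continuousAt)).sub (continuousAt_const.mul k))
  rw [hev.self_of_nhds] at h
  have := mellinInv_form _ y hy0 _ h
  have e2 : ((y/4 - (Real.log y/2+1/4)/y : ℝ) : ℂ) = (1/4:ℂ) * ((y⁻¹:ℝ):ℂ)^(-1:ℂ) - 1/4*((y⁻¹:ℝ):ℂ) - 1/2 * (kf y⁻¹:ℂ) := by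
    rw [kf, Real.log_inv, neg_neg, max_eq_left (Real.log_nonneg hy.le), cpow_neg_one]
    have : (y:ℂ) ≠ 0 := by exact_mod_cast hy0.ne'
    push_cast; field_simp; ring
  rw [e2, ← this]
  congr 1; ext t
  rw [(hm t).2, GF]; ring

lemma cpow_div_term (x : ℝ) (hx : 0 < x) (n : ℕ) (hn : n ≠ 0) (s : ℂ) :
    GF (x / n) s = ((n:ℂ)^s)⁻¹ * GF x s := by
  have hn' : (0:ℝ) < n := by positivity
  rw [GF, GF, ofReal_div, div_eq_mul_inv, ← ofReal_inv, mul_cpow_ofReal_nonneg hx.le (by positivity),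
    ofReal_inv, Complex.inv_cpow _ _ (by rw [Complex.arg_ofReal_of_nonneg hn'.le]; exact Real.pi_pos.ne)]
  simp; ring

lemma lseries_interchange (b : ℕ → ℂ) (hb0 : b 0 = 0) (hs : LSeriesSummable b (3/2:ℝ)) (x : ℝ) (hx : 1 ≤ x) :
    ∫ t : ℝ, LSeries b ((3/2:ℝ)+t*I) * GF x ((3/2:ℝ)+t*I)
      = 2*Real.pi * ∑ n ∈ Finset.range ⌈x⌉₊, b n * (kf (n/x) : ℂ) := by
  have hx0 : 0 < x := by linarith
  have hGc : Continuous fun t : ℝ => GF x ((3/2:ℝ)+t*I) := by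
    unfold GF
    refine Continuous.mul ?_ (Continuous.inv₀ (by fun_prop) (fun t => pow_ne_zero _ (ln_ne t)))
    exact Continuous.const_cpow (by fun_prop) (Or.inl (by exact_mod_cast hx0.ne'))
  have hGn : ∀ t : ℝ, ‖GF x ((3/2:ℝ)+t*I)‖ ≤ x^(3/2:ℝ) * (1/(1/4+t^2)) := fun t => by
    rw [GF, norm_mul, Complex.norm_cpow_eq_rpow_re_of_pos hx0]
    have : (((3/2:ℝ):ℂ)+t*I).re = 3/2 := by simp
    rw [this]
    gcongr; exact ln_norm t
  have hGi : Integrable fun t : ℝ => GF x ((3/2:ℝ)+t*I) :=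
    Integrable.mono' (integral_quarter.2.const_mul _) hGc.aestronglyMeasurable (Filter.Eventually.of_forall hGn)
  have hterm : ∀ n : ℕ, ∀ t : ℝ, ‖LSeries.term b ((3/2:ℝ)+t*I) n‖ = ‖LSeries.term b (3/2:ℝ) n‖ := by
    intro n t
    rw [LSeries.norm_term_eq, LSeries.norm_term_eq]; simp
  have htc : ∀ n : ℕ, Continuous fun t : ℝ => LSeries.term b ((3/2:ℝ)+t*I) n := by
    intro n
    rcases eq_or_ne n 0 with rfl | hn
    · simp [LSeries.term]; exact continuous_const
    · simp only [LSeries.term, hn, if_false]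
      refine Continuous.div continuous_const ?_ ?_
      · exact Continuous.const_cpow (by fun_prop) (Or.inl (by exact_mod_cast hn))
      · intro t; rw [Ne, cpow_eq_zero_iff]; simp [hn]
  have hInt : ∀ n : ℕ, Integrable fun t : ℝ => LSeries.term b ((3/2:ℝ)+t*I) n * GF x ((3/2:ℝ)+t*I) := by
    intro n
    exact hGi.bdd_mul (htc n).aestronglyMeasurable (Filter.Eventually.of_forall fun t => (hterm n t).le)
  have hsum : Summable fun n : ℕ => ∫ t : ℝ, ‖LSeries.term b ((3/2:ℝ)+t*I) n * GF x ((3/2:ℝ)+t*I)‖ := by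
    simp_rw [norm_mul, hterm, integral_const_mul]
    exact hs.norm.mul_right _
  have key := hasSum_integral_of_summable_integral_norm hInt hsum
  have heach : ∀ n : ℕ, ∫ t : ℝ, LSeries.term b ((3/2:ℝ)+t*I) n * GF x ((3/2:ℝ)+t*I)
      = 2*Real.pi * (b n * (kf (n/x) : ℂ)) := by
    intro n
    rcases eq_or_ne n 0 with rfl | hn
    · simp [hb0, LSeries.term]
    · have hn' : (0:ℝ) < n := by positivity
      have := kernel_eval (x/n) (by positivity)
      rw [inv_div] at this
      calc _ = ∫ t : ℝ, b n * GF (x/n) ((3/2:ℝ)+t*I) := by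
            congr 1; ext t
            rw [cpow_div_term x hx0 n hn, LSeries.term, if_neg hn]; ring
        _ = _ := by rw [integral_const_mul, this]; ring
  simp_rw [heach] at key
  have hL : ∀ t : ℝ, LSeries b ((3/2:ℝ)+t*I) * GF x ((3/2:ℝ)+t*I) = ∑' n, LSeries.term b ((3/2:ℝ)+t*I) n * GF x ((3/2:ℝ)+t*I) := by
    intro t; rw [LSeries, tsum_mul_right]
  simp_rw [hL]
  rw [← key.tsum_eq, tsum_mul_left, tsum_eq_sum (s := Finset.range ⌈x⌉₊)]
  intro n hn
  have hn : x ≤ n := by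
    have := Finset.mem_range.not.1 hn
    exact Nat.ceil_le.1 (not_lt.1 this)
  rw [kf, max_eq_right (by
    have := Real.log_nonneg ((one_le_div hx0).2 hn); linarith)]
  simp

end P7

section P8
open Complex MeasureTheory

lemma up_aux (M P Q : ℂ → ℂ) (B : ℝ → ℂ) (C : ℝ) (hM : Differentiable ℂ M) (hP : Differentiable ℂ P)
    (hQ : Differentiable ℂ Q) (hBm : Measurable B) (hBb : ∀ t, 1 ≤ t → ‖B t‖ ≤ C)
    (h : ∀ s : ℂ, 1 < s.re → M s = P s + Q s * ∫ t in Set.Ioi (1:ℝ), B t * (t:ℂ)^(-(s+1)))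
    (s : ℂ) (hs : 1/4 ≤ s.re) : ‖M s‖ ≤ ‖P s‖ + ‖Q s‖ * (4 * C) := by
  have hC : 0 ≤ C := (norm_nonneg _).trans (hBb 1 le_rfl)
  set B1 : ℝ → ℂ := Set.indicator (Set.Ioi 1) B with hB1
  have hB1b : ∀ t, ‖B1 t‖ ≤ C := fun t => by
    by_cases ht : t ∈ Set.Ioi (1:ℝ)
    · rw [hB1, Set.indicator_of_mem ht]; exact hBb t (le_of_lt ht)
    · rw [hB1, Set.indicator_of_notMem ht]; simpa using hC
  have hB1m : Measurable B1 := hBm.indicator measurableSet_Ioi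
  have hloc : LocallyIntegrableOn B1 (Set.Ioi 0) := by
    have : LocallyIntegrable B1 := by
      refine (locallyIntegrable_const C).mono hB1m.aestronglyMeasurable (Filter.Eventually.of_forall fun t => ?_)
      rw [Real.norm_of_nonneg hC]; exact hB1b t
    exact this.locallyIntegrableOn _
  have e : ∀ s : ℂ, mellin B1 (-s) = ∫ t in Set.Ioi (1:ℝ), B t * (t:ℂ)^(-(s+1)) := by
    intro s
    have : ∀ t : ℝ, (t:ℂ)^(-s-1) • B1 t = Set.indicator (Set.Ioi 1) (fun t : ℝ => B t * (t:ℂ)^(-(s+1))) t := by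
      intro t
      by_cases ht : t ∈ Set.Ioi (1:ℝ)
      · rw [hB1, Set.indicator_of_mem ht, Set.indicator_of_mem ht, smul_eq_mul, mul_comm, neg_add']
      · rw [hB1, Set.indicator_of_notMem ht, Set.indicator_of_notMem ht, smul_zero]
    rw [mellin]
    simp_rw [this]
    rw [setIntegral_indicator measurableSet_Ioi]
    congr 2
    ext t; simp only [Set.mem_inter_iff, Set.mem_Ioi]; constructor
    · intro h; exact h.2
    · intro h; exact ⟨by linarith, h⟩
  have hd : ∀ s : ℂ, 0 < s.re → DifferentiableAt ℂ (fun s => mellin B1 (-s)) s := by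
    intro s hs
    have h1 : B1 =O[Filter.atTop] (fun t : ℝ => t ^ (-(0:ℝ))) := by
      refine Asymptotics.IsBigO.of_bound C (Filter.Eventually.of_forall fun t => ?_)
      simpa using hB1b t
    have h2 : B1 =O[nhdsWithin 0 (Set.Ioi 0)] (fun t : ℝ => t ^ (-((-s).re-1))) := by
      refine Asymptotics.IsBigO.of_bound 1 ?_
      have : ∀ᶠ t : ℝ in nhdsWithin 0 (Set.Ioi 0), t < 1 := 
        nhdsWithin_le_nhds (Iio_mem_nhds (by norm_num))
      filter_upwards [this] with t ht
      rw [hB1, Set.indicator_of_notMem (by simp [ht.le])]; simp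
    have := mellin_differentiableAt_of_isBigO_rpow (s := -s) hloc h1 (by simpa using hs) h2 (by linarith)
    exact DifferentiableAt.comp (g := mellin B1) (f := fun s : ℂ => -s) s this differentiable_neg.differentiableAt
  have hU : IsOpen {z : ℂ | 0 < z.re} := isOpen_lt continuous_const continuous_re
  have hU1 : IsOpen {z : ℂ | 1 < z.re} := isOpen_lt continuous_const continuous_re
  have hpre : IsPreconnected {z : ℂ | 0 < z.re} := (convex_halfSpace_re_gt 0).isPreconnected
  have hEq : Set.EqOn M (fun s => P s + Q s * mellin B1 (-s)) {z : ℂ | 0 < z.re} := by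
    refine AnalyticOnNhd.eqOn_of_preconnected_of_eventuallyEq (𝕜 := ℂ) (z₀ := 2) ?_ ?_ hpre (by simp) ?_
    · exact hM.differentiableOn.analyticOnNhd hU
    · refine DifferentiableOn.analyticOnNhd (fun z hz => ?_) hU
      exact ((hP z).add ((hQ z).mul (hd z hz))).differentiableWithinAt
    · filter_upwards [hU1.mem_nhds (show (2:ℂ) ∈ {z : ℂ | 1 < z.re} by simp)] with z hz
      rw [h z hz, e z]
  rw [hEq (show 0 < s.re by linarith)]
  refine (norm_add_le _ _).trans ?_
  rw [norm_mul]
  gcongr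
  rw [e]
  have hi : IntegrableOn (fun t : ℝ => C * t^(-(5/4):ℝ)) (Set.Ioi 1) :=
    (integrableOn_Ioi_rpow_of_lt (by norm_num) (by norm_num)).const_mul _
  refine (norm_integral_le_of_norm_le hi ?_).trans ?_
  · rw [ae_restrict_iff' measurableSet_Ioi]
    refine Filter.Eventually.of_forall fun t ht => ?_
    have ht : 1 < t := ht
    rw [norm_mul, Complex.norm_cpow_eq_rpow_re_of_pos (by linarith)]
    refine mul_le_mul (hBb t ht.le) ?_ (by positivity) hC
    apply Real.rpow_le_rpow_of_exponent_le ht.le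
    simp; linarith
  · rw [integral_const_mul, integral_Ioi_rpow_of_lt (by norm_num) (by norm_num)]
    norm_num; linarith

lemma char_partial (p : ℕ) [NeZero p] (χ : DirichletCharacter ℂ p) (hχ : χ ≠ 1) (n : ℕ) :
    ‖∑ k ∈ Finset.range n, χ k‖ ≤ p := by
  have hper : ∀ n, ∑ k ∈ Finset.range (n+p), χ k = ∑ k ∈ Finset.range n, χ k := by
    intro n
    induction n with
    | zero =>
      have h0 := MulChar.sum_eq_zero_of_ne_one hχ
      simp only [zero_add, Finset.range_zero, Finset.sum_empty]
      rw [← h0]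
      refine Finset.sum_bij (fun k _ => (k : ZMod p)) (by simp) ?_ ?_ (by simp)
      · intro a ha b hb hab
        have := (ZMod.natCast_eq_natCast_iff' a b p).1 hab
        rwa [Nat.mod_eq_of_lt (Finset.mem_range.1 ha), Nat.mod_eq_of_lt (Finset.mem_range.1 hb)] at this
      · intro b _
        exact ⟨b.val, Finset.mem_range.2 (ZMod.val_lt b), by simp⟩
    | succ n ih =>
      rw [show n+1+p = (n+p)+1 by ring, Finset.sum_range_succ, ih, Finset.sum_range_succ]
      simp
  have hmod : ∀ m n, ∑ k ∈ Finset.range (n+m*p), χ k = ∑ k ∈ Finset.range n, χ k := by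
    intro m
    induction m with
    | zero => simp
    | succ m ih => intro n; rw [show n + (m+1)*p = (n+m*p)+p by ring, hper, ih]
  have h1 := hmod (n/p) (n%p)
  rw [Nat.mod_add_div' n p] at h1
  rw [h1]
  refine (norm_sum_le _ _).trans ?_
  refine (Finset.sum_le_card_nsmul _ _ 1 (fun k _ => χ.norm_le_one _)).trans ?_
  simp
  exact_mod_cast (Nat.mod_lt n (Nat.pos_of_ne_zero (NeZero.ne p))).le

lemma char_up (p : ℕ) [NeZero p] (hp1 : p ≠ 1) (χ : DirichletCharacter ℂ p) (hχ : χ ≠ 1) (s : ℂ) (hs : 1/4 ≤ s.re) :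
    ‖DirichletCharacter.LFunction χ s‖ ≤ ‖s‖ * (4 * (p : ℝ)) := by
  have hp : ∀ n : ℕ, ‖∑ k ∈ Finset.Icc 1 n, χ k‖ ≤ p := by
    intro n
    have h := char_partial p χ hχ (n+1)
    have h0 : χ ((0:ℕ):ZMod p) = 0 := by
      rw [Nat.cast_zero]; exact χ.map_zero' hp1
    have e : ∑ k ∈ Finset.Icc 1 n, χ k = ∑ k ∈ Finset.range (n+1), χ k := by
      refine Finset.sum_subset (fun k hk => ?_) (fun k hk hk2 => ?_)
      · simp only [Finset.mem_Icc] at hk; simp only [Finset.mem_range]; omega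
      · have : k = 0 := by
          simp only [Finset.mem_Icc, not_and, not_le] at hk2; simp only [Finset.mem_range] at hk; omega
        rw [this, h0]
    rwa [e]
  have h := up_aux (DirichletCharacter.LFunction χ) 0 (fun s => s) (fun t => ∑ k ∈ Finset.Icc 1 ⌊t⌋₊, χ k) p
    (DirichletCharacter.differentiable_LFunction hχ) (differentiable_const 0) differentiable_id
    (Measurable.comp (g := fun n : ℕ => ∑ k ∈ Finset.Icc 1 n, χ k) (Measurable.of_discrete) Nat.measurable_floor)
    (fun t _ => hp _) (fun s hs => by
      rw [DirichletCharacter.LFunction_eq_LSeries χ hs, LSeries_eq_mul_integral (fun n => χ n) (r := 0) le_rfl (by linarith)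
        (ZMod.LSeriesSummable_of_one_lt_re χ hs)]
      · simp
      · refine Asymptotics.IsBigO.of_bound p (Filter.Eventually.of_forall fun n => ?_)
        simpa using hp n) s hs
  simpa using h

/-- Entire version of `(s-1)ζ(s)`. -/
noncomputable def zt : ℂ → ℂ := Function.update (fun s => (s-1)*riemannZeta s) 1 1

lemma zt_eq {s : ℂ} (hs : s ≠ 1) : zt s = (s-1)*riemannZeta s := Function.update_of_ne hs _ _

lemma zt_diff : Differentiable ℂ zt := by
  rw [← differentiableOn_univ,
    ← differentiableOn_compl_singleton_and_continuousAt_iff (c := 1) Filter.univ_mem, zt]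
  refine ⟨DifferentiableOn.congr (f := fun s => (s-1)*riemannZeta s)
    (fun s hs => ?_) fun s hs => ?_,
    continuousWithinAt_compl_self.mp ?_⟩
  · have : s ≠ 1 := by simpa using hs
    exact ((differentiableAt_id.sub_const 1).mul (differentiableAt_riemannZeta this)).differentiableWithinAt
  · have : s ≠ 1 := by simpa using hs
    rw [Function.update_of_ne this]
  · simpa using! riemannZeta_residue_one

lemma zeta_up' (s : ℂ) (hs : 1/4 ≤ s.re) : ‖zt s‖ ≤ ‖s‖ + ‖-s*(s-1)‖ * (4*1) := by
  exact up_aux zt (fun s => s) (fun s => -s*(s-1)) (fun t => ((t - ⌊t⌋₊ : ℝ):ℂ)) 1 zt_diff differentiable_id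
    (by fun_prop) (by fun_prop) (fun t ht => by
      rw [norm_real, Real.norm_of_nonneg (sub_nonneg.2 (Nat.floor_le (by linarith)))]
      have := Nat.lt_floor_add_one t
      linarith) (fun s hs => by
      have h1 : s ≠ 1 := fun h => by simp [h] at hs
      have h1' : s - 1 ≠ 0 := sub_ne_zero.2 h1
      have hO : (fun n : ℕ => ∑ k ∈ Finset.Icc 1 n, ‖(1:ℂ)‖) =O[Filter.atTop] (fun n : ℕ => (n:ℝ)^(1:ℝ)) := by
        refine Asymptotics.IsBigO.of_bound 1 (Filter.Eventually.of_forall fun n => ?_)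
        simp
      have hz := LSeries_eq_mul_integral' (fun _ => 1) (r := 1) zero_le_one hs hO
      have e1 : LSeries (fun _ => 1) s = riemannZeta s := LSeries_one_eq_riemannZeta hs
      rw [e1] at hz
      have i1 : IntegrableOn (fun t : ℝ => (t:ℂ)^(-s)) (Set.Ioi 1) :=
        integrableOn_Ioi_cpow_of_lt (by simpa using hs) one_pos
      have i1v : ∫ t in Set.Ioi (1:ℝ), (t:ℂ)^(-s) = 1/(s-1) := by
        rw [integral_Ioi_cpow_of_lt (by simpa using hs) one_pos]
        simp
        rw [show -s+1 = -(s-1) by ring, div_neg, neg_div, neg_neg, one_div]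
      have e2 : Set.EqOn (fun t : ℝ => ((t - ⌊t⌋₊ : ℝ):ℂ) * (t:ℂ)^(-(s+1)))
          (fun t : ℝ => (t:ℂ)^(-s) - (∑ k ∈ Finset.Icc 1 ⌊t⌋₊, (1:ℂ)) * (t:ℂ)^(-(s+1))) (Set.Ioi 1) := by
        intro t ht
        have ht : 1 < t := ht
        have ht0 : (t:ℂ) ≠ 0 := by exact_mod_cast (by linarith : t ≠ 0)
        simp only [ofReal_sub, sub_mul]
        congr 1
        · rw [show -s = -(s+1)+1 by ring, cpow_add _ _ ht0, cpow_one]; ring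
        · simp
      have i2 : IntegrableOn (fun t : ℝ => (∑ k ∈ Finset.Icc 1 ⌊t⌋₊, (1:ℂ)) * (t:ℂ)^(-(s+1))) (Set.Ioi 1) := by
        refine Integrable.mono' i1.norm ?_ ?_
        · refine Measurable.aestronglyMeasurable ?_
          refine Measurable.mul ?_ (by fun_prop)
          exact Measurable.comp (g := fun n : ℕ => ∑ k ∈ Finset.Icc 1 n, (1:ℂ)) (Measurable.of_discrete) Nat.measurable_floor
        · rw [ae_restrict_iff' measurableSet_Ioi]
          refine Filter.Eventually.of_forall fun t ht => ?_
          have ht : 1 < t := ht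
          have ht0 : (t:ℂ) ≠ 0 := by exact_mod_cast (by linarith : t ≠ 0)
          rw [show -s = -(s+1)+1 by ring, cpow_add _ _ ht0, cpow_one, norm_mul, norm_mul, mul_comm]
          gcongr
          simp
          rw [abs_of_pos (by linarith)]
          exact Nat.floor_le (by linarith)
      rw [setIntegral_congr_fun measurableSet_Ioi e2, integral_sub i1 i2, i1v, zt_eq h1, hz]
      field_simp
      ring) s hs

lemma zeta_up (s : ℂ) (hs : 1/4 ≤ s.re) : ‖zt s‖ ≤ 5 * (1+‖s‖)^2 := by
  refine (zeta_up' s hs).trans ?_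
  rw [norm_mul, norm_neg]
  have := norm_sub_le s 1
  rw [norm_one] at this
  nlinarith [norm_nonneg s, norm_nonneg (s-1)]

end P8

section P9
open Complex MeasureTheory

lemma ls_near_one (f : ℕ → ℂ) (h1 : f 1 = 1) (hf : ∀ n, ‖f n‖ ≤ 1) (s : ℂ) (hs : 2 ≤ s.re) :
    ‖LSeries f s - 1‖ ≤ 2/3 := by
  have hsum : LSeriesSummable f s :=
    LSeriesSummable_of_bounded_of_one_lt_re (m := 1) (fun n _ => hf n) (by linarith)
  have hs1 : HasSum (fun n => LSeries.term f s n - if n = 1 then (1:ℂ) else 0) (LSeries f s - 1) :=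
    hsum.hasSum.sub (hasSum_ite_eq 1 (1:ℂ))
  have hs2 : HasSum (fun n : ℕ => 1/(n:ℝ)^2 - if n = 1 then (1:ℝ) else 0) (Real.pi^2/6 - 1) :=
    hasSum_zeta_two.sub (hasSum_ite_eq 1 (1:ℝ))
  rw [← hs1.tsum_eq]
  refine (tsum_of_norm_bounded hs2 fun n => ?_).trans ?_
  · rcases eq_or_ne n 1 with rfl | hn1
    · simp [LSeries.term, h1]
    · rcases eq_or_ne n 0 with rfl | hn0
      · simp
      · simp only [hn1, if_false, sub_zero]
        rw [LSeries.norm_term_eq, if_neg hn0]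
        have : (1:ℝ) ≤ n := by exact_mod_cast Nat.one_le_iff_ne_zero.2 hn0
        have h2 : (n:ℝ)^2 ≤ (n:ℝ)^s.re := by
          rw [← Real.rpow_natCast]; exact Real.rpow_le_rpow_of_exponent_le this (by simpa using hs)
        have := hf n
        gcongr
  · have := Real.pi_lt_d2
    have := Real.pi_pos
    nlinarith

lemma zeta54 : ‖riemannZeta (5/4:ℝ)‖ ≤ 10 := by
  have h := zeta_up' (5/4:ℝ) (by simp; norm_num)
  have hne : ((5/4:ℝ):ℂ) ≠ 1 := by
    intro h; have := congrArg re h; norm_num at this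
  rw [zt_eq hne, norm_mul, norm_mul, norm_neg] at h
  have e1 : ‖((5/4:ℝ):ℂ)‖ = 5/4 := by rw [norm_real]; norm_num
  have e2 : ‖((5/4:ℝ):ℂ) - 1‖ = 1/4 := by
    rw [show ((5/4:ℝ):ℂ) - 1 = ((1/4:ℝ):ℂ) by push_cast; norm_num, norm_real]; norm_num
  rw [e1, e2] at h
  linarith

lemma zeta54_sum : ∑' n : ℕ, 1/(n:ℝ)^(5/4:ℝ) ≤ 10 := by
  refine le_trans ?_ zeta54
  rw [zeta_eq_tsum_one_div_nat_cpow (by simp; norm_num)]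
  have : ∀ n : ℕ, 1 / (n:ℂ)^((5/4:ℝ):ℂ) = ((1/(n:ℝ)^(5/4:ℝ) : ℝ):ℂ) := fun n => by
    have := ofReal_cpow (n.cast_nonneg (α := ℝ)) (5/4)
    rw [ofReal_div 1, this]; simp
  simp_rw [this]
  rw [← ofReal_tsum, norm_real]
  exact Real.le_norm_self _

lemma lsL_bound (f : ℕ → ℂ) (hf : ∀ n, ‖f n‖ ≤ ArithmeticFunction.vonMangoldt n) (s : ℂ) (hs : 3/2 ≤ s.re) :
    ‖LSeries f s‖ ≤ 40 := by
  have hsum : Summable fun n : ℕ => 4*(1/(n:ℝ)^(5/4:ℝ)) :=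
    (Real.summable_one_div_nat_rpow.2 (by norm_num)).mul_left 4
  refine (tsum_of_norm_bounded hsum.hasSum fun n => ?_).trans ?_
  · rw [LSeries.norm_term_eq]
    split_ifs with h
    · positivity
    · have h1 : (1:ℝ) ≤ n := by exact_mod_cast Nat.one_le_iff_ne_zero.2 h
      have h0 : (0:ℝ) < n := by linarith
      have h2 : ‖f n‖ ≤ (n:ℝ)^(1/4:ℝ)/(1/4) :=
        (hf n).trans (ArithmeticFunction.vonMangoldt_le_log.trans (Real.log_le_rpow_div h0.le (by norm_num)))
      have h3 : (n:ℝ)^(3/2:ℝ) ≤ (n:ℝ)^s.re := Real.rpow_le_rpow_of_exponent_le h1 hs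
      have h4 : (n:ℝ)^(3/2:ℝ) = (n:ℝ)^(1/4:ℝ) * (n:ℝ)^(5/4:ℝ) := by
        rw [← Real.rpow_add h0]; norm_num
      calc _ ≤ ((n:ℝ)^(1/4:ℝ)/(1/4)) / (n:ℝ)^(3/2:ℝ) := by gcongr
        _ = _ := by rw [h4]; field_simp
  · rw [tsum_mul_left]; linarith [zeta54_sum]

lemma log_tail (n : ℕ) (hn : 4 ≤ n) :
    Real.log n / (n:ℝ)^2 ≤ (Real.log (n-1)+1)/(n-1) - (Real.log n+1)/n := by
  have hn' : (4:ℝ) ≤ n := by exact_mod_cast hn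
  have hl4 : (4/3:ℝ) ≤ Real.log n := by
    have h := Real.log_two_gt_d9
    have e : Real.log 4 = 2*Real.log 2 := by
      rw [show (4:ℝ) = 2^2 by norm_num, Real.log_pow]; norm_num
    have := Real.log_le_log (by norm_num) hn'
    linarith
  have hd : Real.log n - Real.log (n-1) ≤ 1/(n-1) := by
    rw [← Real.log_div (by linarith) (by linarith)]
    refine (Real.log_le_sub_one_of_pos (div_pos (by linarith) (by linarith))).trans (le_of_eq ?_)
    have : (n:ℝ) - 1 ≠ 0 := by linarith
    field_simp; ring
  set l := Real.log n
  set m := Real.log ((n:ℝ)-1)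
  have hn1 : (0:ℝ) < n - 1 := by linarith
  rw [le_div_iff₀ hn1] at hd
  rw [div_sub_div _ _ hn1.ne' (by linarith), div_le_div_iff₀ (by positivity) (by nlinarith)]
  have key : l * (n-1) ≤ ((m+1)*n - (n-1)*(l+1)) * n := by
    -- (m+1) n - (n-1)(l+1) = (m - l) n + l + 1
    have : (m+1)*n - (n-1)*(l+1) = l + 1 - n*(l-m) := by ring
    rw [this]
    have h5 : n*(l-m) * (n-1) ≤ n := by nlinarith
    have h6 : (4/3)*(n-1) ≤ l*(n-1) := by nlinarith
    have h7 : n ≤ l*(n-1) := by linarith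
    have h8 : n*(l-m)*(n-1) ≤ (n-1) + 1 := by linarith
    have h9 : n * (n*(l-m)*(n-1)) ≤ n*n := by nlinarith
    have h10 : 0 ≤ (n-1) * ((l+1-n*(l-m))*n - l*(n-1)) := by nlinarith
    have := nonneg_of_mul_nonneg_right h10 hn1
    linarith
  nlinarith

lemma log_partial (N : ℕ) : ∑ n ∈ Finset.range (N+4), Real.log n / (n:ℝ)^2 ≤
    Real.log 2/4 + Real.log 3/9 + (Real.log 3+1)/3 - (Real.log ((N:ℝ)+3)+1)/((N:ℝ)+3) := by
  induction N with
  | zero =>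
    simp [Finset.sum_range_succ]; norm_num
  | succ N ih =>
    rw [show N+1+4 = (N+4)+1 by ring, Finset.sum_range_succ]
    have := log_tail (N+4) (by omega)
    push_cast at this ⊢
    rw [show (N:ℝ)+4-1 = N+3 by ring] at this
    rw [show (N:ℝ)+1+3 = N+4 by ring]
    linarith

lemma log3_bounds : Real.log 3 < 1.1 ∧ 1.09 < Real.log 3 := by
  constructor
  · have h := Real.log_two_lt_d9
    have : Real.log (3^12) ≤ Real.log (2^(19)*(1+0.0137)) := Real.log_le_log (by norm_num) (by norm_num)
    rw [Real.log_pow, Real.log_mul (by norm_num) (by norm_num), Real.log_pow] at this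
    have h2 := Real.log_le_sub_one_of_pos (show (0:ℝ) < 1+0.0137 by norm_num)
    norm_num at this h2 ⊢
    linarith
  · have h := Real.log_two_gt_d9
    have : Real.log (2^(19)) ≤ Real.log (3^12) := Real.log_le_log (by norm_num) (by norm_num)
    rw [Real.log_pow, Real.log_pow] at this
    norm_num at this ⊢
    linarith

lemma log_sum : Summable (fun n : ℕ => Real.log n / (n:ℝ)^2) ∧ ∑' n : ℕ, Real.log n / (n:ℝ)^2 ≤ 1 := by
  have h0 : ∀ n : ℕ, 0 ≤ Real.log n / (n:ℝ)^2 := fun n => by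
    have := Real.log_natCast_nonneg n; positivity
  have hp : ∀ n : ℕ, ∑ i ∈ Finset.range n, Real.log i / (i:ℝ)^2 ≤ 1 := by
    intro n
    have h1 : ∑ i ∈ Finset.range n, Real.log i / (i:ℝ)^2 ≤ ∑ i ∈ Finset.range (n+4), Real.log i / (i:ℝ)^2 :=
      Finset.sum_le_sum_of_subset_of_nonneg (Finset.range_mono (by omega)) (fun i _ _ => h0 i)
    have h2 := log_partial n
    have h3 : 0 ≤ (Real.log ((n:ℝ)+3)+1)/((n:ℝ)+3) := by
      have : 0 ≤ Real.log ((n:ℝ)+3) := Real.log_nonneg (by have := n.cast_nonneg (α := ℝ); linarith)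
      positivity
    linarith [log3_bounds.1, Real.log_two_lt_d9]
  exact ⟨summable_of_sum_range_le h0 hp, Real.tsum_le_of_sum_range_le h0 hp⟩

lemma vM_sum : Summable (fun n : ℕ => ArithmeticFunction.vonMangoldt n / (n:ℝ)^2) ∧
   ∑' n : ℕ, ArithmeticFunction.vonMangoldt n / (n:ℝ)^2 ≤ 2/3 ∧
   1/3 ≤ ∑' n : ℕ, ArithmeticFunction.vonMangoldt n / (n:ℝ)^2 := by
  have hle : ∀ n : ℕ, ArithmeticFunction.vonMangoldt n / (n:ℝ)^2 ≤ Real.log n / (n:ℝ)^2 := fun n => by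
    have := @ArithmeticFunction.vonMangoldt_le_log n
    gcongr
  have h0 : ∀ n : ℕ, 0 ≤ ArithmeticFunction.vonMangoldt n / (n:ℝ)^2 := fun n => by
    have := @ArithmeticFunction.vonMangoldt_nonneg n; positivity
  have hS := Summable.of_nonneg_of_le h0 hle log_sum.1
  refine ⟨hS, ?_, ?_⟩
  · have hconv := LSeries_convolution' (s := 2) (ArithmeticFunction.LSeriesSummable_vonMangoldt (s := 2) (by simp))
      (LSeriesSummable_one_iff.2 (by simp : 1 < (2:ℂ).re))
    rw [ArithmeticFunction.convolution_vonMangoldt_const_one, LSeries_one_eq_riemannZeta (by simp), riemannZeta_two] at hconv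
    have e1 : LSeries (fun n : ℕ => (ArithmeticFunction.vonMangoldt n : ℂ)) 2 = ((∑' n : ℕ, ArithmeticFunction.vonMangoldt n / (n:ℝ)^2 : ℝ):ℂ) := by
      rw [ofReal_tsum, LSeries]
      congr 1; ext n
      rcases eq_or_ne n 0 with rfl | hn
      · simp
      · rw [LSeries.term_of_ne_zero hn]; push_cast; norm_cast
    have e2 : LSeries (fun n : ℕ => Complex.log n) 2 = ((∑' n : ℕ, Real.log n / (n:ℝ)^2 : ℝ):ℂ) := by
      rw [ofReal_tsum, LSeries]
      congr 1; ext n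
      rcases eq_or_ne n 0 with rfl | hn
      · simp
      · rw [LSeries.term_of_ne_zero hn, ← natCast_log]; push_cast; norm_cast
    rw [e1, e2] at hconv
    have h3 : ∑' n : ℕ, Real.log n / (n:ℝ)^2 = (∑' n : ℕ, ArithmeticFunction.vonMangoldt n / (n:ℝ)^2) * (Real.pi^2/6) := by
      exact_mod_cast hconv
    have h4 := log_sum.2
    have := Real.pi_gt_d2
    have h5 : 1.6 ≤ Real.pi^2/6 := by nlinarith
    have h6 : 0 ≤ ∑' n : ℕ, ArithmeticFunction.vonMangoldt n / (n:ℝ)^2 := tsum_nonneg h0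
    nlinarith
  · refine le_trans ?_ (hS.sum_le_tsum (Finset.range 5) (fun i _ => h0 i))
    have v2 := ArithmeticFunction.vonMangoldt_apply_prime Nat.prime_two
    have v3 := ArithmeticFunction.vonMangoldt_apply_prime Nat.prime_three
    have v4 : ArithmeticFunction.vonMangoldt 4 = Real.log 2 := by
      have := @ArithmeticFunction.vonMangoldt_apply_pow 2 2 (by norm_num)
      rw [show 2^2 = 4 by norm_num, v2] at this
      simpa using this
    simp only [Finset.sum_range_succ, Finset.sum_range_zero, v2, v3, v4, ArithmeticFunction.vonMangoldt_apply_one]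
    have h := Real.log_two_gt_d9
    have h3 := log3_bounds.2
    norm_num
    linarith

lemma lsL_two (f : ℕ → ℂ) (hf : ∀ n, ‖f n‖ ≤ ArithmeticFunction.vonMangoldt n) : ‖LSeries f 2‖ ≤ 2/3 := by
  refine (tsum_of_norm_bounded vM_sum.1.hasSum fun n => ?_).trans vM_sum.2.1
  rw [LSeries.norm_term_eq]
  split_ifs with h
  · have := @ArithmeticFunction.vonMangoldt_nonneg n; positivity
  · simp; exact div_le_div_of_nonneg_right (hf n) (by positivity)

lemma lsL_two_ge : 1/3 ≤ (LSeries (fun n : ℕ => (ArithmeticFunction.vonMangoldt n : ℂ)) 2).re := by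
  have e1 : LSeries (fun n : ℕ => (ArithmeticFunction.vonMangoldt n : ℂ)) 2 = ((∑' n : ℕ, ArithmeticFunction.vonMangoldt n / (n:ℝ)^2 : ℝ):ℂ) := by
    rw [ofReal_tsum, LSeries]
    congr 1; ext n
    rcases eq_or_ne n 0 with rfl | hn
    · simp
    · rw [LSeries.term_of_ne_zero hn]; push_cast; norm_cast
  rw [e1, ofReal_re]; exact vM_sum.2.2

end P9

section P10
open Complex MeasureTheory

lemma lseries_conj (f g : ℕ → ℂ) (hfg : ∀ n, g n = (starRingEnd ℂ) (f n)) (s : ℂ) :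
    LSeries g s = (starRingEnd ℂ) (LSeries f ((starRingEnd ℂ) s)) := by
  rw [LSeries, LSeries, Complex.conj_tsum]
  congr 1; ext n
  rcases eq_or_ne n 0 with rfl | hn
  · simp
  · rw [LSeries.term_of_ne_zero hn, LSeries.term_of_ne_zero hn, map_div₀, hfg]
    congr 1
    rw [Complex.cpow_conj _ _ (by rw [natCast_arg]; exact Real.pi_pos.ne)]
    simp

lemma conj_ident (M M' : ℂ → ℂ) (hM : Differentiable ℂ M) (hM' : Differentiable ℂ M')
    (h : ∀ s : ℂ, 1 < s.re → M' s = (starRingEnd ℂ) (M ((starRingEnd ℂ) s))) (s : ℂ) :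
    M' s = (starRingEnd ℂ) (M ((starRingEnd ℂ) s)) := by
  have hd : Differentiable ℂ (fun s => (starRingEnd ℂ) (M ((starRingEnd ℂ) s))) := by
    intro s
    have := (hM ((starRingEnd ℂ) s)).conj_conj
    rw [Complex.conj_conj] at this
    exact this
  have hEq : Set.EqOn M' (fun s => (starRingEnd ℂ) (M ((starRingEnd ℂ) s))) Set.univ := by
    refine AnalyticOnNhd.eqOn_of_preconnected_of_eventuallyEq (𝕜 := ℂ) (z₀ := 2) ?_ ?_ isPreconnected_univ (by simp) ?_
    · exact hM'.differentiableOn.analyticOnNhd isOpen_univ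
    · exact hd.differentiableOn.analyticOnNhd isOpen_univ
    · have hU1 : IsOpen {z : ℂ | 1 < z.re} := isOpen_lt continuous_const continuous_re
      filter_upwards [hU1.mem_nhds (show (2:ℂ) ∈ {z : ℂ | 1 < z.re} by simp)] with z hz
      exact h z hz
  exact hEq (Set.mem_univ s)

lemma norm_GammaR (s : ℂ) (a : ℝ) : ‖Gammaℝ (s+a)‖ = Real.pi^(-(s.re+a)/2) * ‖Gamma ((s+a)/2)‖ := by
  rw [Gammaℝ_def, norm_mul, Complex.norm_cpow_eq_rpow_re_of_pos Real.pi_pos]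
  congr 2
  simp

lemma L_conj (p : ℕ) [NeZero p] (χ : DirichletCharacter ℂ p) (hχ : χ ≠ 1) (s : ℂ) :
    DirichletCharacter.LFunction χ⁻¹ s = (starRingEnd ℂ) (DirichletCharacter.LFunction χ ((starRingEnd ℂ) s)) := by
  have hχ' : χ⁻¹ ≠ 1 := by simpa using hχ
  refine conj_ident _ _ (DirichletCharacter.differentiable_LFunction hχ) (DirichletCharacter.differentiable_LFunction hχ') (fun s hs => ?_) s
  rw [DirichletCharacter.LFunction_eq_LSeries _ hs, DirichletCharacter.LFunction_eq_LSeries _ (by simpa using hs)]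
  refine lseries_conj _ _ (fun n => ?_) s
  rw [← MulChar.star_eq_inv]; rfl

open Classical in
/-- parity parameter -/
noncomputable def par {p : ℕ} (χ : DirichletCharacter ℂ p) : ℝ := if χ.Even then 0 else 1

lemma par_cases {p : ℕ} (χ : DirichletCharacter ℂ p) : par χ = 0 ∨ par χ = 1 := by
  unfold par; split_ifs <;> simp

lemma par_inv {p : ℕ} (χ : DirichletCharacter ℂ p) : par χ⁻¹ = par χ := by
  have : χ⁻¹.Even ↔ χ.Even := by
    unfold DirichletCharacter.Even
    rw [MulChar.inv_apply_eq_inv']; exact inv_eq_one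
  unfold par
  by_cases h : χ.Even
  · rw [if_pos h, if_pos (this.2 h)]
  · rw [if_neg h, if_neg (fun h2 => h (this.1 h2))]

lemma gf_par {p : ℕ} (χ : DirichletCharacter ℂ p) (s : ℂ) : χ.gammaFactor s = Gammaℝ (s + par χ) := by
  classical
  unfold par DirichletCharacter.gammaFactor
  split_ifs <;> simp

lemma char_fe (p : ℕ) [NeZero p] (hp1 : p ≠ 1) (χ : DirichletCharacter ℂ p) (hχ : χ ≠ 1) (hprim : χ.IsPrimitive)
    (hne : ∀ s : ℂ, 1/2 < s.re → DirichletCharacter.LFunction χ s ≠ 0) (s : ℂ) (h0 : 0 < s.re) (h1 : s.re < 1) :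
    ((p:ℝ)/Real.pi)^(s.re/2) * ‖Gamma ((s+par χ)/2)‖ * ‖DirichletCharacter.LFunction χ s‖
    = ((p:ℝ)/Real.pi)^((1-s.re)/2) * ‖Gamma ((1-(starRingEnd ℂ) s+par χ)/2)‖ * ‖DirichletCharacter.LFunction χ (1-(starRingEnd ℂ) s)‖ := by
  have hpp : (0:ℝ) < p := by exact_mod_cast Nat.pos_of_ne_zero (NeZero.ne p)
  have hpi := Real.pi_pos
  set a := par χ with ha
  have ha0 : 0 ≤ a := by rcases par_cases χ with h | h <;> rw [ha, h]; norm_num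
  set W : ℂ → ℝ := fun s => ((p:ℝ)/Real.pi)^(s.re/2) * ‖Gamma ((s+a)/2)‖ * ‖DirichletCharacter.LFunction χ s‖ with hW
  have hcomp : ∀ (ψ : DirichletCharacter ℂ p) (s : ℂ), par ψ = a → 0 < s.re →
      ‖ψ.completedLFunction s‖ = ‖DirichletCharacter.LFunction ψ s‖ * (Real.pi^(-(s.re+a)/2) * ‖Gamma ((s+a)/2)‖) := by
    intro ψ s hψ hs
    have := DirichletCharacter.LFunction_eq_completed_div_gammaFactor ψ s (Or.inr hp1)
    rw [gf_par, hψ] at this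
    have hn : Gammaℝ (s+a) ≠ 0 := Gammaℝ_ne_zero_of_re_pos (by simp; linarith)
    rw [this, norm_div, ← norm_GammaR]
    have := norm_ne_zero_iff.2 hn
    field_simp
  have E : ∀ s : ℂ, 0 < s.re → s.re < 1 → W (1-s) = ‖χ.rootNumber‖ * W ((starRingEnd ℂ) s) := by
    intro s h0 h1
    have h := congrArg norm (DirichletCharacter.IsPrimitive.completedLFunction_one_sub hprim s)
    rw [norm_mul, norm_mul, hcomp χ (1-s) rfl (by simpa using h1), hcomp χ⁻¹ s (par_inv χ) h0, L_conj p χ hχ s, RCLike.norm_conj,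
      show ((p:ℕ):ℂ) = ((p:ℝ):ℂ) by simp, Complex.norm_cpow_eq_rpow_re_of_pos hpp] at h
    have hg : ‖Gamma (((starRingEnd ℂ) s + a)/2)‖ = ‖Gamma ((s+a)/2)‖ := by
      rw [← RCLike.norm_conj (Gamma ((s+a)/2)), ← Complex.Gamma_conj]
      congr 2; rw [map_div₀, map_add, conj_ofReal, Complex.conj_ofNat]
    simp only [hW]
    rw [hg]
    simp only [sub_re, one_re, conj_re] at h ⊢
    have e1 : ((p:ℝ)/Real.pi)^((1-s.re)/2) = (p:ℝ)^((1-s.re)/2) * Real.pi^(a/2) * Real.pi^(-(1-s.re+a)/2) := by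
      rw [Real.div_rpow hpp.le hpi.le, mul_assoc, ← Real.rpow_add hpi, div_eq_mul_inv, ← Real.rpow_neg hpi.le]
      congr 2; ring
    have e2 : ((p:ℝ)/Real.pi)^(s.re/2) = (p:ℝ)^((1-s.re)/2) * (p:ℝ)^(s.re-(1/2:ℂ).re) * Real.pi^(a/2) * Real.pi^(-(s.re+a)/2) := by
      rw [Real.div_rpow hpp.le hpi.le, mul_assoc, ← Real.rpow_add hpi, ← Real.rpow_add hpp, div_eq_mul_inv, ← Real.rpow_neg hpi.le]
      congr 2
      · norm_num; ring
      · ring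
    rw [e1, e2]
    linear_combination ((p:ℝ)^((1-s.re)/2) * Real.pi^(a/2)) * h
  have hε : ‖χ.rootNumber‖ = 1 := by
    have hE1 := E ((3/4:ℝ):ℂ) (by norm_num) (by norm_num)
    have hE2 := E ((1/4:ℝ):ℂ) (by norm_num) (by norm_num)
    rw [conj_ofReal] at hE1 hE2
    rw [show (1:ℂ) - ((3/4:ℝ):ℂ) = ((1/4:ℝ):ℂ) by push_cast; norm_num] at hE1
    rw [show (1:ℂ) - ((1/4:ℝ):ℂ) = ((3/4:ℝ):ℂ) by push_cast; norm_num, hE1] at hE2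
    have hpos : 0 < W ((3/4:ℝ):ℂ) := by
      simp only [hW]
      have := norm_pos_iff.2 (hne ((3/4:ℝ):ℂ) (by norm_num))
      have := norm_pos_iff.2 (Gamma_ne_zero_of_re_pos (s := (((3/4:ℝ):ℂ)+a)/2) (by simp; positivity))
      positivity
    have hn := norm_nonneg χ.rootNumber
    have : (‖χ.rootNumber‖^2 - 1) * W ((3/4:ℝ):ℂ) = 0 := by linarith
    have := (mul_eq_zero.1 this).resolve_right hpos.ne'
    nlinarith
  have := E ((starRingEnd ℂ) s) (by simpa using h0) (by simpa using h1)
  rw [hε, one_mul, conj_conj] at this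
  simp only [hW] at this
  rw [← this]; simp

lemma char_good (hG : GRH) (p : ℕ) (hp : p.Prime) [NeZero p] (χ : DirichletCharacter ℂ p) (hχ : χ ≠ 1) :
    GoodData (DirichletCharacter.LFunction χ) (par χ) p := by
  have hp1 : p ≠ 1 := hp.one_lt.ne'
  have hprim : χ.IsPrimitive := by
    have h := χ.conductor_dvd_level
    rcases (Nat.dvd_prime hp).1 h with h | h
    · exact absurd ((χ.eq_one_iff_conductor_eq_one).2 h) hχ
    · exact h
  have hne : ∀ s : ℂ, 1/2 < s.re → DirichletCharacter.LFunction χ s ≠ 0 := by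
    intro s hs h
    rcases lt_or_ge s.re 1 with h1 | h1
    · have := hG p inferInstance χ s h (by linarith) h1
      linarith
    · exact DirichletCharacter.LFunction_ne_zero_of_one_le_re χ (Or.inl hχ) h1 h
  have near : ∀ s : ℂ, 2 ≤ s.re → 1/3 ≤ ‖DirichletCharacter.LFunction χ s‖ ∧ ‖DirichletCharacter.LFunction χ s‖ ≤ 5/3 := by
    intro s hs
    have := ls_near_one (fun n => χ n) (by simp) (fun n => χ.norm_le_one _) s hs
    rw [DirichletCharacter.LFunction_eq_LSeries χ (by linarith)]
    set z := LSeries (fun n => χ n) s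
    have h1 := norm_sub_norm_le (1:ℂ) z
    have h2 := norm_sub_norm_le z (1:ℂ)
    rw [norm_sub_rev] at h1
    rw [norm_one] at h1 h2
    constructor <;> linarith
  refine ⟨DirichletCharacter.differentiable_LFunction hχ, hne, ⟨4*p, ?_, fun s hs => ?_⟩, ⟨1/3, by norm_num, fun s hs => (near s hs).1⟩,
    ⟨5, fun x h hx h0 h1 => ?_⟩, char_fe p hp1 χ hχ hprim hne, ?_, ?_⟩
  · have := hp.pos; positivity
  · refine (char_up p hp1 χ hχ s hs).trans ?_
    have : (0:ℝ) ≤ 4 * p := by positivity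
    rw [mul_comm]
    refine mul_le_mul_of_nonneg_left ?_ this
    nlinarith [norm_nonneg s]
  · have a1 := (near (x-h) (by simp; linarith)).2
    have a2 := (near (x+h) (by simp; linarith)).1
    linarith
  · rcases par_cases χ with h | h <;> rw [h]; norm_num
  · exact_mod_cast hp.one_lt.le

lemma zeta_conj {s : ℂ} : zt s = (starRingEnd ℂ) (zt ((starRingEnd ℂ) s)) := by
  refine conj_ident zt zt zt_diff zt_diff (fun s hs => ?_) s
  have h1 : s ≠ 1 := fun h => by simp [h] at hs
  have h2 : (starRingEnd ℂ) s ≠ 1 := fun h => by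
    have := congrArg re h
    simp at this; linarith
  rw [zt_eq h1, zt_eq h2, map_mul, ← LSeries_one_eq_riemannZeta hs, ← LSeries_one_eq_riemannZeta (by simpa using hs),
    ← lseries_conj 1 1 (by simp)]
  simp

lemma zeta_fe (s : ℂ) (h0 : 0 < s.re) (h1 : s.re < 1) :
    ((1:ℝ)/Real.pi)^(s.re/2) * ‖Gamma ((s+(2:ℝ))/2)‖ * ‖zt s‖
    = ((1:ℝ)/Real.pi)^((1-s.re)/2) * ‖Gamma ((1-(starRingEnd ℂ) s+(2:ℝ))/2)‖ * ‖zt (1-(starRingEnd ℂ) s)‖ := by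
  have hpi := Real.pi_pos
  have key : ∀ s : ℂ, 0 < s.re → s.re < 1 → ((1:ℝ)/Real.pi)^(s.re/2) * ‖Gamma ((s+(2:ℝ))/2)‖ * ‖zt s‖
     = ‖s*(s-1)/2‖ * ‖completedRiemannZeta s‖ := by
    intro s h0 h1
    have hs0 : s ≠ 0 := fun h => by simp [h] at h0
    have hs1 : s ≠ 1 := fun h => by simp [h] at h1
    have hg : Gammaℝ s ≠ 0 := Gammaℝ_ne_zero_of_re_pos h0
    have e1 : completedRiemannZeta s = riemannZeta s * Gammaℝ s := by
      rw [riemannZeta_def_of_ne_zero hs0]; field_simp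
    have e2 := norm_GammaR s 0
    rw [ofReal_zero, add_zero, add_zero] at e2
    have e3 : Gamma ((s+(2:ℝ))/2) = (s/2) * Gamma (s/2) := by
      rw [show (s+(2:ℝ))/2 = s/2+1 by push_cast; ring, Gamma_add_one _ (by simpa using hs0)]
    rw [e1, zt_eq hs1, e3, norm_mul, norm_mul, norm_mul, e2, one_div, Real.inv_rpow hpi.le, ← Real.rpow_neg hpi.le,
      show s*(s-1)/2 = (s/2)*(s-1) by ring, norm_mul, neg_div]
    ring
  have hc : ‖zt (1-(starRingEnd ℂ) s)‖ = ‖zt (1-s)‖ := by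
    rw [zeta_conj, RCLike.norm_conj]; simp
  have hg : ‖Gamma ((1-(starRingEnd ℂ) s+(2:ℝ))/2)‖ = ‖Gamma ((1-s+(2:ℝ))/2)‖ := by
    rw [← RCLike.norm_conj (Gamma ((1-s+(2:ℝ))/2)), ← Complex.Gamma_conj]
    congr 2; rw [map_div₀, map_add, conj_ofReal, Complex.conj_ofNat, map_sub, map_one]
  have k2 := key (1-s) (by simpa using h1) (by simpa using h0)
  rw [hc, hg, key s h0 h1]
  rw [completedRiemannZeta_one_sub, sub_re, one_re] at k2
  rw [k2]
  congr 2; ring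

lemma zeta_good (hG : GRH) : GoodData zt 2 1 := by
  have hz1 : ∀ s : ℂ, 1 < s.re → s ≠ 1 := fun s hs h => by simp [h] at hs
  have near : ∀ s : ℂ, 2 ≤ s.re → 1/3 ≤ ‖riemannZeta s‖ ∧ ‖riemannZeta s‖ ≤ 5/3 := by
    intro s hs
    have := ls_near_one 1 (by simp) (fun n => by simp) s hs
    rw [← LSeries_one_eq_riemannZeta (by linarith)]
    set z := LSeries 1 s
    have h1 := norm_sub_norm_le (1:ℂ) z
    have h2 := norm_sub_norm_le z (1:ℂ)
    rw [norm_sub_rev] at h1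
    rw [norm_one] at h1 h2
    constructor <;> linarith
  refine ⟨zt_diff, fun s hs => ?_, ⟨5, by norm_num, zeta_up⟩, ⟨1/3, by norm_num, fun s hs => ?_⟩,
    ⟨5, fun x h hx h0 h1 => ?_⟩, zeta_fe, by norm_num, le_rfl⟩
  · by_cases h1 : s = 1
    · rw [h1, zt, Function.update_self]; exact one_ne_zero
    · rw [zt_eq h1]
      refine mul_ne_zero (sub_ne_zero.2 h1) ?_
      rcases lt_or_ge s.re 1 with h | h
      · intro h0
        have := hG 1 inferInstance 1 s (by rw [DirichletCharacter.LFunction_modOne_eq]; exact h0) (by linarith) h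
        linarith
      · exact riemannZeta_ne_zero_of_one_le_re h
  · rw [zt_eq (hz1 s (by linarith)), norm_mul]
    have a1 := (near s hs).1
    have a2 : 1 ≤ ‖s - 1‖ := by
      refine le_trans ?_ (Complex.re_le_norm _)
      simp; linarith
    nlinarith
  · have r1 : (2:ℝ) ≤ ((x:ℂ)-h).re := by simp; linarith
    have r2 : (2:ℝ) ≤ ((x:ℂ)+h).re := by simp; linarith
    have a1 := (near (x-h) r1).2
    have a2 := (near (x+h) r2).1
    rw [zt_eq (hz1 _ (by linarith)), zt_eq (hz1 _ (by linarith)), norm_mul, norm_mul]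
    have b1 : ‖(x:ℂ)-h-1‖ = x-h-1 := by
      rw [show (x:ℂ)-h-1 = ((x-h-1:ℝ):ℂ) by push_cast; ring, norm_real, Real.norm_of_nonneg (by linarith)]
    have b2 : ‖(x:ℂ)+h-1‖ = x+h-1 := by
      rw [show (x:ℂ)+h-1 = ((x+h-1:ℝ):ℂ) by push_cast; ring, norm_real, Real.norm_of_nonneg (by linarith)]
    rw [b1, b2]
    calc (x-h-1) * ‖riemannZeta (x-h)‖ ≤ (x+h-1) * (5 * ‖riemannZeta (x+h)‖) :=
          mul_le_mul (by linarith) (by linarith) (norm_nonneg _) (by linarith)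
      _ = _ := by ring

end P10

section P11
open Complex MeasureTheory

lemma log_pi_gt : 1.134 < Real.log Real.pi := by
  have h3 := log3_bounds.2
  have hpi := Real.pi_gt_d4
  have h : Real.log 3 + Real.log (Real.pi/3) = Real.log Real.pi := by
    rw [← Real.log_mul (by norm_num) (by positivity)]; congr 1; ring
  have h2 := Real.one_sub_inv_le_log_of_pos (show 0 < Real.pi/3 by positivity)
  have h4 : (Real.pi/3)⁻¹ ≤ 0.955 := by
    rw [inv_div, div_le_iff₀ (by positivity)]; linarith
  norm_num at *
  linarith

lemma eF_two (a : ℝ) (c : ℝ) (hc : Real.log ((a+4)/2) + 1/(a+3/2) ≤ c) (ha : 0 ≤ a) : (eF a 2).re ≤ c - 1.134 := by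
  have h : (eF a 2).re = Real.log ((a+4)/2) + (1/(a+3/2) - Real.log Real.pi) := by
    rw [eF, add_re, ofReal_re, show ((2:ℂ)+a+2)/2 = (((a+4)/2:ℝ):ℂ) by push_cast; ring, log_ofReal_re]
  rw [h]; linarith [log_pi_gt]

lemma eF_zero : (eF 0 2).re ≤ 0.26 := by
  have := eF_two 0 1.394 (by
    rw [show ((0:ℝ)+4)/2 = 2 by norm_num]
    have := Real.log_two_lt_d9
    norm_num at *; linarith) le_rfl
  linarith

lemma eF_one : (eF 1 2).re ≤ 0.26 := by
  have := eF_two 1 1.394 (by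
    have h := Real.log_two_lt_d9
    have h2 : Real.log (((1:ℝ)+4)/2) = Real.log 2 + Real.log 1.25 := by
      rw [← Real.log_mul (by norm_num) (by norm_num)]; norm_num
    have h3 := Real.log_le_sub_one_of_pos (show (0:ℝ) < 1.25 by norm_num)
    rw [h2]
    norm_num at *; linarith) zero_le_one
  linarith

lemma eF_2 : (eF 2 2).re ≤ 0.26 := by
  have := eF_two 2 1.394 (by
    rw [show ((2:ℝ)+4)/2 = 3 by norm_num]
    have := log3_bounds.1
    norm_num at *; linarith) zero_le_two
  linarith

lemma char_D (p : ℕ) [NeZero p] (χ : DirichletCharacter ℂ p) (s : ℂ) (hs : 1 < s.re) :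
    deriv (DirichletCharacter.LFunction χ) s / DirichletCharacter.LFunction χ s =
      - LSeries (fun n : ℕ => χ n * ArithmeticFunction.vonMangoldt n) s := by
  have := DirichletCharacter.LSeries_twist_vonMangoldt_eq χ hs
  rw [DirichletCharacter.deriv_LFunction_eq_deriv_LSeries χ hs, DirichletCharacter.LFunction_eq_LSeries χ hs]
  have e : LSeries (fun n : ℕ => χ n * ArithmeticFunction.vonMangoldt n) s = _ := this
  rw [e]; ring

lemma char_S (hG : GRH) (p : ℕ) (hp : p.Prime) [NeZero p] (χ : DirichletCharacter ℂ p) (hχ : χ ≠ 1) (x : ℝ) (hx : 1 ≤ x) :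
    ‖∑ n ∈ Finset.range ⌈x⌉₊, χ n * ArithmeticFunction.vonMangoldt n * (kf (n/x) : ℂ)‖ ≤
      √x/3*(Real.log p + 1.6) + (√x)⁻¹*(Real.log p + 60) := by
  have hf : ∀ n : ℕ, ‖χ n * (ArithmeticFunction.vonMangoldt n : ℂ)‖ ≤ ArithmeticFunction.vonMangoldt n := fun n => by
    rw [norm_mul, norm_real, Real.norm_of_nonneg ArithmeticFunction.vonMangoldt_nonneg]
    exact mul_le_of_le_one_left ArithmeticFunction.vonMangoldt_nonneg (χ.norm_le_one _)
  have ha2 : par χ ≤ 2 := by rcases par_cases χ with h | h <;> rw [h] <;> norm_num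
  have hb := (char_good hG p hp χ hχ).bound ha2 40 (fun s hs => by
    rw [char_D p χ s (by linarith), norm_neg]; exact lsL_bound _ hf s hs) x hx
  have hi := lseries_interchange (fun n : ℕ => χ n * (ArithmeticFunction.vonMangoldt n : ℂ)) (by simp)
    (DirichletCharacter.LSeriesSummable_twist_vonMangoldt χ (by simp; norm_num)) x hx
  have e : ∀ t : ℝ, deriv (DirichletCharacter.LFunction χ) ((3/2:ℝ)+t*I)/DirichletCharacter.LFunction χ ((3/2:ℝ)+t*I) * GF x ((3/2:ℝ)+t*I)
     = -(LSeries (fun n : ℕ => χ n * ArithmeticFunction.vonMangoldt n) ((3/2:ℝ)+t*I) * GF x ((3/2:ℝ)+t*I)) := fun t => by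
    rw [char_D p χ _ (by norm_num)]; ring
  simp_rw [e] at hb
  rw [integral_neg, norm_neg, hi, norm_mul] at hb
  have h2pi : ‖(2*Real.pi : ℂ)‖ = 2*Real.pi := by
    rw [show (2*Real.pi : ℂ) = ((2*Real.pi:ℝ):ℂ) by push_cast; ring, norm_real, Real.norm_of_nonneg (by positivity)]
  rw [h2pi] at hb
  have hb := le_of_mul_le_mul_left hb (by positivity)
  refine hb.trans ?_
  have hV : (VF (DirichletCharacter.LFunction χ) (par χ) p 2).re ≤ Real.log p + 1.6 := by
    rw [VF, char_D p χ 2 (by simp), add_re, add_re, ofReal_re]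
    have h1 : (2 * -LSeries (fun n : ℕ => χ n * (ArithmeticFunction.vonMangoldt n:ℂ)) 2).re ≤ 4/3 := by
      refine (Complex.re_le_norm _).trans ?_
      rw [norm_mul, norm_neg]
      have := lsL_two _ hf
      norm_num; linarith
    have h2 : (eF (par χ) 2).re ≤ 0.26 := by
      rcases par_cases χ with h | h <;> rw [h]
      · exact eF_zero
      · exact eF_one
    norm_num at *
    linarith
  have h0 : (0:ℝ) ≤ √x / 3 := by positivity
  have h3 : (√x)⁻¹ * (Real.log p + 37/2 + 40) ≤ (√x)⁻¹*(Real.log p + 60) :=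
    mul_le_mul_of_nonneg_left (by linarith) (by positivity)
  have := mul_le_mul_of_nonneg_left hV h0
  linarith

lemma zeta_D (s : ℂ) (hs : 1 < s.re) :
    deriv zt s / zt s = (s-1)⁻¹ - LSeries (fun n : ℕ => (ArithmeticFunction.vonMangoldt n : ℂ)) s := by
  have h1 : s ≠ 1 := fun h => by simp [h] at hs
  have h := ArithmeticFunction.LSeries_vonMangoldt_eq_deriv_riemannZeta_div hs
  have hz : riemannZeta s ≠ 0 := riemannZeta_ne_zero_of_one_le_re hs.le
  have hd : deriv zt s = riemannZeta s + (s-1) * deriv riemannZeta s := by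
    have e : zt =ᶠ[nhds s] fun s => (s-1)*riemannZeta s := by
      filter_upwards [isOpen_ne.mem_nhds h1] with z hz
      exact zt_eq hz
    rw [e.deriv_eq]
    have := (((hasDerivAt_id s).sub_const 1).mul (differentiableAt_riemannZeta h1).hasDerivAt).deriv
    simpa using! this
  rw [hd, zt_eq h1, h]
  have := sub_ne_zero.2 h1
  field_simp
  ring

lemma zeta_S (hG : GRH) (x : ℝ) (hx : 1 < x) :
    x/4 - (Real.log x/2+1/4)/x - (√x/3*1.6 + (√x)⁻¹*62) ≤
    ∑ n ∈ Finset.range ⌈x⌉₊, ArithmeticFunction.vonMangoldt n * kf (n/x) := by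
  have hx0 : 0 < x := by linarith
  set f : ℕ → ℂ := fun n : ℕ => (ArithmeticFunction.vonMangoldt n : ℂ) with hff
  have hf : ∀ n : ℕ, ‖f n‖ ≤ ArithmeticFunction.vonMangoldt n := fun n => by
    rw [hff, norm_real, Real.norm_of_nonneg ArithmeticFunction.vonMangoldt_nonneg]
  have hs1 : ∀ s : ℂ, 3/2 ≤ s.re → ‖(s-1)⁻¹‖ ≤ 2 := fun s hs => by
    have : 1/2 ≤ ‖s-1‖ := by
      refine le_trans ?_ (Complex.re_le_norm _)
      simp; linarith
    rw [norm_inv, inv_le_comm₀ (by linarith) (by norm_num)]; linarith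
  have hB : ∀ s : ℂ, 3/2 ≤ s.re → ‖deriv zt s / zt s‖ ≤ 42 := fun s hs => by
    rw [zeta_D s (by linarith)]
    refine (norm_sub_le _ _).trans ?_
    linarith [lsL_bound f hf s hs, hs1 s hs]
  have hgood := zeta_good hG
  have hb := hgood.bound le_rfl 42 hB x hx.le
  have hi := lseries_interchange f (by simp [hff]) (ArithmeticFunction.LSeriesSummable_vonMangoldt (by simp; norm_num)) x hx.le
  have hGc : Continuous fun t : ℝ => GF x ((3/2:ℝ)+t*I) := by
    unfold GF
    refine Continuous.mul ?_ (Continuous.inv₀ (by fun_prop) (fun t => pow_ne_zero _ (ln_ne t)))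
    exact Continuous.const_cpow (by fun_prop) (Or.inl (by exact_mod_cast hx0.ne'))
  have hGn : ∀ t : ℝ, ‖GF x ((3/2:ℝ)+t*I)‖ ≤ x^(3/2:ℝ) * (1/(1/4+t^2)) := fun t => by
    rw [GF, norm_mul, Complex.norm_cpow_eq_rpow_re_of_pos hx0]
    have : (((3/2:ℝ):ℂ)+t*I).re = 3/2 := by simp
    rw [this]
    gcongr; exact ln_norm t
  have hGi : Integrable fun t : ℝ => GF x ((3/2:ℝ)+t*I) :=
    Integrable.mono' (integral_quarter.2.const_mul _) hGc.aestronglyMeasurable (Filter.Eventually.of_forall hGn)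
  have i1 : Integrable fun t : ℝ => (((3/2:ℝ):ℂ)+t*I-1)⁻¹ * GF x ((3/2:ℝ)+t*I) := by
    refine hGi.bdd_mul (c := 2) (Continuous.inv₀ (by fun_prop) (fun t => ln_ne' t)).aestronglyMeasurable (Filter.Eventually.of_forall fun t => ?_)
    exact hs1 _ (by simp)
  have i2 : Integrable fun t : ℝ => deriv zt ((3/2:ℝ)+t*I) / zt ((3/2:ℝ)+t*I) * GF x ((3/2:ℝ)+t*I) := by
    have hc : Continuous fun t : ℝ => deriv zt ((3/2:ℝ)+t*I) / zt ((3/2:ℝ)+t*I) := by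
      refine Continuous.div ?_ ?_ (fun t => hgood.ne _ (by norm_num))
      · have : Continuous (deriv zt) := (zt_diff.contDiff (n := 1)).continuous_deriv le_rfl
        exact this.comp (by fun_prop)
      · exact zt_diff.continuous.comp (by fun_prop)
    refine hGi.bdd_mul (c := 42) hc.aestronglyMeasurable (Filter.Eventually.of_forall fun t => ?_)
    exact hB _ (by simp)
  have e : ∀ t : ℝ, LSeries f ((3/2:ℝ)+t*I) * GF x ((3/2:ℝ)+t*I) =
     (((3/2:ℝ):ℂ)+t*I-1)⁻¹ * GF x ((3/2:ℝ)+t*I) - deriv zt ((3/2:ℝ)+t*I) / zt ((3/2:ℝ)+t*I) * GF x ((3/2:ℝ)+t*I) := fun t => by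
    rw [zeta_D _ (by norm_num)]; ring
  simp_rw [e] at hi
  rw [integral_sub i1 i2, kernel_eval' x hx] at hi
  have hV : (VF zt 2 1 2).re ≤ 1.6 := by
    rw [VF, zeta_D 2 (by simp), add_re, add_re, ofReal_re, Real.log_one]
    have h1 : (2 * (((2:ℂ)-1)⁻¹ - LSeries f 2)).re ≤ 4/3 := by
      have := lsL_two_ge
      rw [show ((2:ℂ)-1)⁻¹ = 1 by norm_num]
      simp only [mul_re, sub_re, one_re, re_ofNat, im_ofNat]
      have h2 : 1/3 ≤ (LSeries f 2).re := this
      linarith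
    have h2 := eF_2
    norm_num at *
    linarith
  set T : ℝ := ∑ n ∈ Finset.range ⌈x⌉₊, ArithmeticFunction.vonMangoldt n * kf (n/x) with hT
  have hTc : ∑ n ∈ Finset.range ⌈x⌉₊, f n * (kf (n/x) : ℂ) = (T:ℂ) := by
    rw [hT]; push_cast; rfl
  rw [hTc] at hi
  set J := ∫ t : ℝ, deriv zt ((3/2:ℝ)+t*I) / zt ((3/2:ℝ)+t*I) * GF x ((3/2:ℝ)+t*I) with hJ
  set U : ℝ := x/4 - (Real.log x/2+1/4)/x with hU
  have hJ2 : J = ((2*Real.pi * (U - T) : ℝ):ℂ) := by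
    push_cast; linear_combination -hi
  rw [hJ2, norm_real] at hb
  have h5 := (Real.le_norm_self _).trans hb
  have h6 := le_of_mul_le_mul_left h5 (by positivity)
  have h0 : (0:ℝ) ≤ √x / 3 := by positivity
  have h3 : (√x)⁻¹ * (Real.log 1 + 37/2 + 42) ≤ (√x)⁻¹*62 := by
    rw [Real.log_one]; exact mul_le_mul_of_nonneg_left (by norm_num) (by positivity)
  have := mul_le_mul_of_nonneg_left hV h0
  linarith

end P11

section P12
open Complex

lemma J_ne {ι : Type} [Fintype ι] [DecidableEq ι] {G : Type*} [CommGroup G] (q : ι → ℕ)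
    (hq : ∀ i, (q i).Prime) (hinj : Function.Injective q) (ψ : ι → G)
    (hψ : ∀ i, orderOf (ψ i) = q i) (J : ι → ℕ) (hJ : ∀ i, J i < q i) (hJ0 : J ≠ 0) :
    ∏ i, ψ i ^ J i ≠ 1 := by
  intro h
  apply hJ0
  funext i
  have h1 : (∏ i, ψ i ^ J i) ^ (∏ k ∈ Finset.univ.erase i, q k) = 1 := by rw [h, one_pow]
  rw [← Finset.mul_prod_erase _ _ (Finset.mem_univ i), mul_pow, ← Finset.prod_pow (Finset.univ.erase i) (∏ k ∈ Finset.univ.erase i, q k)] at h1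
  rw [Finset.prod_eq_one (s := Finset.univ.erase i) (f := fun k => (ψ k ^ J k) ^ (∏ k ∈ Finset.univ.erase i, q k)), mul_one, ← pow_mul] at h1
  · have h2 := orderOf_dvd_of_pow_eq_one h1
    rw [hψ] at h2
    rcases (hq i).dvd_mul.1 h2 with h3 | h3
    · exact Nat.eq_zero_of_dvd_of_lt h3 (hJ i)
    · exfalso
      obtain ⟨k, hk, hk2⟩ := ((hq i).prime.dvd_finsetProd_iff _).1 h3
      have := (Nat.prime_dvd_prime_iff_eq (hq i) (hq k)).1 hk2
      exact (Finset.mem_erase.1 hk).1 (hinj this).symm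
  · intro k hk
    rw [← pow_mul]
    obtain ⟨m, hm⟩ := Finset.dvd_prod_of_mem q hk
    rw [hm, mul_left_comm, pow_mul, ← hψ k, pow_orderOf_eq_one, one_pow]

lemma a_sum (q : ℕ) (hq : q ≠ 0) : ∑ j ∈ Finset.range q, ((if j = 0 then 1 else 0) - 1/(q:ℝ)) = 0 := by
  have : (q:ℝ) ≠ 0 := by exact_mod_cast hq
  rw [Finset.sum_sub_distrib, Finset.sum_ite_eq']
  simp [Nat.pos_of_ne_zero hq, this]

lemma a_abs (q : ℕ) (hq : 2 ≤ q) :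
    ∑ j ∈ Finset.range q, |((if j = 0 then 1 else 0) - 1/(q:ℝ))| = 2 * (1 - 1/(q:ℝ)) := by
  obtain ⟨m, rfl⟩ : ∃ m, q = m+1 := ⟨q-1, by omega⟩
  have hm : (0:ℝ) ≤ m := by positivity
  rw [Finset.sum_range_succ']
  simp only [Nat.add_eq_zero_iff, one_ne_zero, and_false, if_false, if_true, zero_sub, abs_neg]
  rw [Finset.sum_const, Finset.card_range, abs_of_nonneg (by positivity), abs_of_nonneg]
  · push_cast; simp; field_simp; ring
  · push_cast
    rw [sub_nonneg, div_le_one (by positivity)]; linarith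

/-- the sieve inequality -/
lemma sieve_ineq {ι : Type} [Fintype ι] [DecidableEq ι] (p : ℕ) (q : ι → ℕ)
    (hq : ∀ i, (q i).Prime) (hinj : Function.Injective q) (ψ : ι → DirichletCharacter ℂ p)
    (hψ : ∀ i, orderOf (ψ i) = q i) (N : ℕ) (w : ℕ → ℝ) (B : ℝ)
    (hw : ∀ n ∈ Finset.range N, w n ≠ 0 → IsUnit (n : ZMod p) → ∃ i, ψ i n = 1)
    (hB : ∀ χ : DirichletCharacter ℂ p, χ ≠ 1 → ‖∑ n ∈ Finset.range N, χ n * (w n : ℂ)‖ ≤ B) :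
    ‖∑ n ∈ Finset.range N, (1 : DirichletCharacter ℂ p) n * (w n : ℂ)‖ ≤ (2^(Fintype.card ι) - 1) * B := by
  classical
  set a : ι → ℕ → ℝ := fun i j => (if j = 0 then 1 else 0) - 1/(q i:ℝ) with ha
  set P := Fintype.piFinset (fun i => Finset.range (q i)) with hP
  set A : (ι → ℕ) → ℝ := fun J => ∏ i, a i (J i) with hA
  set X : (ι → ℕ) → DirichletCharacter ℂ p := fun J => ∏ i, ψ i ^ J i with hX
  have hq2 : ∀ i, 2 ≤ q i := fun i => (hq i).two_le
  have h0P : (0 : ι → ℕ) ∈ P := by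
    rw [hP, Fintype.mem_piFinset]; intro i; simp [(hq i).pos]
  have hX0 : X 0 = 1 := by simp [hX]
  have hai : ∀ i, a i 0 = 1 - 1/(q i:ℝ) := fun i => by simp [ha]
  have hA0 : 0 < A 0 := by
    refine Finset.prod_pos fun i _ => ?_
    rw [Pi.zero_apply, hai, sub_pos, div_lt_one (by exact_mod_cast (hq i).pos)]
    exact_mod_cast (hq i).one_lt
  have hAs : ∑ J ∈ P, |A J| = 2^(Fintype.card ι) * A 0 := by
    simp only [hA, Finset.abs_prod]
    rw [hP, ← Finset.prod_univ_sum (fun i => Finset.range (q i)) (fun i j => |a i j|)]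
    have : ∀ i, ∑ j ∈ Finset.range (q i), |a i j| = 2 * a i 0 := fun i => by
      rw [hai]; exact a_abs _ (hq2 i)
    rw [Finset.prod_congr rfl fun i _ => this i, Finset.prod_mul_distrib]
    simp
  have hpt : ∀ n ∈ Finset.range N, ∑ J ∈ P, (A J : ℂ) * (X J n * (w n : ℂ)) = 0 := by
    intro n hn
    by_cases hwn : w n = 0
    · simp [hwn]
    by_cases hu : IsUnit (n : ZMod p)
    · obtain ⟨i, hi⟩ := hw n hn hwn hu
      have h1 : ∀ J, X J n = ∏ i, (ψ i n) ^ J i := by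
        intro J
        have : ∀ (s : Finset ι), (∏ i ∈ s, ψ i ^ J i) (n : ZMod p) = ∏ i ∈ s, (ψ i n) ^ J i := by
          intro s
          induction s using Finset.induction_on with
          | empty => simp [MulChar.one_apply hu]
          | insert k s hk ih =>
            rw [Finset.prod_insert hk, Finset.prod_insert hk, MulChar.mul_apply, ih]
            congr 1
            obtain ⟨u, hu⟩ := hu
            rw [← hu, MulChar.pow_apply_coe]
        exact this _
      have h2 : ∀ J, (A J : ℂ) * (X J n * (w n : ℂ)) = (∏ i, ((a i (J i) : ℂ) * (ψ i n)^(J i))) * w n := by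
        intro J
        rw [h1, Finset.prod_mul_distrib, hA]; push_cast; ring
      rw [Finset.sum_congr rfl fun J _ => h2 J, ← Finset.sum_mul, hP,
        ← Finset.prod_univ_sum (fun i => Finset.range (q i)) (fun i j => (a i j : ℂ) * (ψ i n)^j)]
      rw [Finset.prod_eq_zero (Finset.mem_univ i), zero_mul]
      simp only [hi, one_pow, mul_one]
      rw [← ofReal_sum, ha]
      exact_mod_cast a_sum (q i) (hq i).ne_zero
    · refine Finset.sum_eq_zero fun J _ => ?_
      rw [MulChar.map_nonunit _ hu]; ring
  set S : DirichletCharacter ℂ p → ℂ := fun χ => ∑ n ∈ Finset.range N, χ n * (w n : ℂ) with hS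
  have htot : ∑ J ∈ P, (A J : ℂ) * S (X J) = 0 := by
    simp only [hS, Finset.mul_sum]
    rw [Finset.sum_comm]
    exact Finset.sum_eq_zero hpt
  rw [← Finset.add_sum_erase _ _ h0P, hX0] at htot
  have h3 : ‖(A 0 : ℂ) * S 1‖ ≤ ∑ J ∈ P.erase 0, |A J| * B := by
    rw [eq_neg_of_add_eq_zero_left htot, norm_neg]
    refine (norm_sum_le _ _).trans (Finset.sum_le_sum fun J hJ => ?_)
    obtain ⟨hJ0, hJP⟩ := Finset.mem_erase.1 hJ
    rw [norm_mul, norm_real, Real.norm_eq_abs]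
    refine mul_le_mul_of_nonneg_left (hB _ ?_) (abs_nonneg _)
    refine J_ne q hq hinj ψ hψ J (fun i => ?_) hJ0
    exact Finset.mem_range.1 (Fintype.mem_piFinset.1 hJP i)
  rw [← Finset.add_sum_erase _ _ h0P, abs_of_pos hA0] at hAs
  rw [← Finset.sum_mul, norm_mul, norm_real, Real.norm_of_nonneg hA0.le,
    show ∑ J ∈ P.erase 0, |A J| = A 0 * (2^(Fintype.card ι) - 1) by linarith, mul_assoc] at h3
  exact le_of_mul_le_mul_left h3 hA0

lemma exists_psi (p : ℕ) (hp : p.Prime) : ∃ ψ : (p-1).primeFactors → DirichletCharacter ℂ p,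
    (∀ i, orderOf (ψ i) = i) ∧
    ∀ n : ℕ, IsUnit (n : ZMod p) → orderOf (n : ZMod p) ≠ p - 1 → ∃ i, ψ i n = 1 := by
  have : Fact p.Prime := ⟨hp⟩
  have hp1 : 0 < p - 1 := by have := hp.two_le; omega
  obtain ⟨χ, hχ⟩ := MulChar.exists_mulChar_orderOf_eq_card_units (F := ZMod p) (R := ℂ)
    (ζ := Complex.exp (2*Real.pi*I/((p-1 : ℕ):ℂ)))
    (by rw [ZMod.card_units]; exact Complex.isPrimitiveRoot_exp _ hp1.ne')
  rw [ZMod.card_units] at hχ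
  refine ⟨fun i => χ ^ ((p-1)/(i:ℕ)), fun i => ?_, fun n hn ho => ?_⟩
  · have hd : (i:ℕ) ∣ p-1 := Nat.dvd_of_mem_primeFactors i.2
    rw [orderOf_pow_of_dvd (Nat.div_pos (Nat.le_of_dvd hp1 hd) (Nat.pos_of_mem_primeFactors i.2)).ne'
      (by rw [hχ]; exact Nat.div_dvd_of_dvd hd), hχ, Nat.div_div_self hd hp1.ne']
  · by_contra! hcon
    apply ho
    refine orderOf_eq_of_pow_and_pow_div_prime hp1 (ZMod.pow_card_sub_one_eq_one hn.ne_zero) ?_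
    intro q hq hqd h1
    refine hcon ⟨q, Nat.mem_primeFactors.2 ⟨hq, hqd, hp1.ne'⟩⟩ ?_
    obtain ⟨u, hu⟩ := hn
    rw [← hu] at h1 ⊢
    rw [MulChar.pow_apply_coe, ← map_pow, h1, map_one]

end P12

section P13
open Complex

lemma kf_le (u : ℝ) (hu : 0 ≤ u) : kf u ≤ 0.37 := by
  rw [kf]
  rcases hu.eq_or_lt with rfl | hu
  · norm_num
  rw [mul_max_of_nonneg _ _ hu.le]
  refine max_le ?_ (by norm_num)
  have he := Real.exp_pos 1
  have h1 := Real.log_le_sub_one_of_pos (x := (u * Real.exp 1)⁻¹) (by positivity)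
  rw [Real.log_inv, Real.log_mul hu.ne' he.ne', Real.log_exp] at h1
  have h2 : -Real.log u ≤ (u * Real.exp 1)⁻¹ := by linarith
  have h3 := mul_le_mul_of_nonneg_left h2 hu.le
  have h4 : u * (u * Real.exp 1)⁻¹ = (Real.exp 1)⁻¹ := by field_simp
  have h5 : (Real.exp 1)⁻¹ ≤ 0.37 := by
    rw [inv_le_comm₀ he (by norm_num)]
    have := Real.exp_one_gt_d9
    norm_num; linarith
  linarith

lemma vM_mult (p : ℕ) (hp : p.Prime) (x : ℝ) (hx : 1 ≤ x) :
    ∑ n ∈ (Finset.range ⌈x⌉₊).filter (p ∣ ·), ArithmeticFunction.vonMangoldt n ≤ Real.log x := by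
  have hlp : 0 < Real.log p := Real.log_pos (by exact_mod_cast hp.one_lt)
  have hlx : 0 ≤ Real.log x := Real.log_nonneg hx
  set m := ⌊Real.log x / Real.log p⌋₊ with hm
  have h1 : ∑ n ∈ (Finset.range ⌈x⌉₊).filter (p ∣ ·), ArithmeticFunction.vonMangoldt n
      ≤ ∑ n ∈ (Finset.Icc 1 m).image (p ^ ·), ArithmeticFunction.vonMangoldt n := by
    rw [← Finset.sum_filter_ne_zero]
    refine Finset.sum_le_sum_of_subset_of_nonneg (fun n hn => ?_)
      fun _ _ _ => ArithmeticFunction.vonMangoldt_nonneg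
    obtain ⟨hn, hne⟩ := Finset.mem_filter.1 hn
    rw [Finset.mem_filter, Finset.mem_range, Nat.lt_ceil] at hn
    obtain ⟨hnx, hpn⟩ := hn
    obtain ⟨r, k, hr, hk, rfl⟩ := ArithmeticFunction.vonMangoldt_ne_zero_iff.1 hne
    have hr := hr.nat_prime
    have : p = r := (Nat.prime_dvd_prime_iff_eq hp hr).1 (hp.dvd_of_dvd_pow hpn)
    subst this
    refine Finset.mem_image.2 ⟨k, Finset.mem_Icc.2 ⟨hk, ?_⟩, rfl⟩
    apply Nat.le_floor
    rw [le_div_iff₀ hlp, ← Real.log_pow]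
    refine Real.log_le_log (by have := hp.pos; positivity) ?_
    push_cast at hnx
    exact hnx.le
  refine h1.trans ?_
  rw [Finset.sum_image (fun a _ b _ h => Nat.pow_right_injective hp.two_le h)]
  have h2 : ∀ k ∈ Finset.Icc 1 m, ArithmeticFunction.vonMangoldt (p^k) = Real.log p := fun k hk => by
    rw [ArithmeticFunction.vonMangoldt_apply_pow (by have := (Finset.mem_Icc.1 hk).1; omega),
      ArithmeticFunction.vonMangoldt_apply_prime hp]
  rw [Finset.sum_congr rfl h2, Finset.sum_const, Nat.card_Icc, nsmul_eq_mul, Nat.add_sub_cancel,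
    ← le_div_iff₀ hlp]
  exact Nat.floor_le (by positivity)

/-- combination: the analytic contradiction inequality -/
lemma main_ineq (hG : GRH) (p : ℕ) (hp : p.Prime) (x : ℝ) (hx : 1 < x)
    (hnone : ∀ n : ℕ, IsPrimePow n → (n : ℝ) < x → orderOf (n : ZMod p) ≠ p - 1) :
    x/4 - (Real.log x/2+1/4)/x - (√x/3*1.6 + (√x)⁻¹*62) ≤
    (2^(p-1).primeFactors.card - 1) * (√x/3*(Real.log p + 1.6) + (√x)⁻¹*(Real.log p + 60))
      + 0.37 * Real.log x := by
  have : NeZero p := ⟨hp.ne_zero⟩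
  have : Fact p.Prime := ⟨hp⟩
  refine (zeta_S hG x hx).trans ?_
  obtain ⟨ψ, hψ1, hψ2⟩ := exists_psi p hp
  set w : ℕ → ℝ := fun n => ArithmeticFunction.vonMangoldt n * kf (n/x) with hw
  have hx0 : 0 < x := by linarith
  have hs := sieve_ineq p (fun i : (p-1).primeFactors => (i:ℕ))
    (fun i => Nat.prime_of_mem_primeFactors i.2) Subtype.val_injective ψ hψ1 ⌈x⌉₊ w
    (√x/3*(Real.log p + 1.6) + (√x)⁻¹*(Real.log p + 60)) ?_ ?_
  · rw [Fintype.card_coe] at hs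
    have e : ∀ n : ℕ, w n = (if p ∣ n then 0 else w n) + (if p ∣ n then w n else 0) := fun n => by
      split_ifs <;> simp
    rw [Finset.sum_congr rfl fun n _ => e n, Finset.sum_add_distrib]
    refine add_le_add ?_ ?_
    · have e2 : ∑ n ∈ Finset.range ⌈x⌉₊, (1 : DirichletCharacter ℂ p) n * (w n : ℂ)
         = ((∑ n ∈ Finset.range ⌈x⌉₊, (if p ∣ n then 0 else w n) : ℝ) : ℂ) := by
        push_cast
        refine Finset.sum_congr rfl fun n _ => ?_
        split_ifs with h
        · rw [MulChar.map_nonunit, zero_mul]; · simp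
          rw [(ZMod.natCast_eq_zero_iff n p).2 h]; simp
        · rw [MulChar.one_apply, one_mul]
          rw [isUnit_iff_ne_zero, Ne, ZMod.natCast_eq_zero_iff]; exact h
      rw [e2, norm_real] at hs
      exact (Real.le_norm_self _).trans hs
    · rw [← Finset.sum_filter]
      refine le_trans ?_ (mul_le_mul_of_nonneg_left (vM_mult p hp x hx.le) (by norm_num))
      rw [Finset.mul_sum]
      refine Finset.sum_le_sum fun n _ => ?_
      change ArithmeticFunction.vonMangoldt n * kf (n/x) ≤ _
      rw [mul_comm]
      exact mul_le_mul_of_nonneg_right (kf_le _ (by positivity)) ArithmeticFunction.vonMangoldt_nonneg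
  · intro n hn hwn hu
    refine hψ2 n hu (hnone n ?_ ?_)
    · exact ArithmeticFunction.vonMangoldt_ne_zero_iff.1 (left_ne_zero_of_mul hwn)
    · exact Nat.lt_ceil.1 (Finset.mem_range.1 hn)
  · intro χ hχ
    have := char_S hG p hp χ hχ x hx.le
    refine le_trans (le_of_eq ?_) this
    congr 1
    refine Finset.sum_congr rfl fun n _ => ?_
    rw [hw]; push_cast; ring

lemma numerics (K L x : ℝ) (hK : 1 ≤ K) (hL : 20.72 ≤ L) (hx : x = (8/5*K*L)^2)
    (h : x/4 - (Real.log x/2+1/4)/x - (√x/3*1.6 + (√x)⁻¹*62) ≤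
      K * (√x/3*(L + 1.6) + (√x)⁻¹*(L + 60)) + 0.37 * Real.log x) : False := by
  have hKL : 20.72 ≤ K*L := by nlinarith
  have hs : √x = 8/5*K*L := by rw [hx, Real.sqrt_sq (by nlinarith)]
  set s := √x with hsd
  have hs1 : (4144/125) ≤ s := by rw [hs]; linarith
  have hxs : x = s^2 := by rw [hs, hx]
  have hlog : Real.log x ≤ 2 * (19/625*s + 251/100) := by
    rw [hxs, Real.log_pow]
    push_cast
    have h1 := Real.log_le_sub_one_of_pos (x := s/(4144/125)) (by positivity)
    rw [Real.log_div (by linarith) (by norm_num)] at h1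
    have h2 : Real.log (4144/125) ≤ 3.51 := by
      rw [show ((4144/125):ℝ) = 2^5*1.036 by norm_num, Real.log_mul (by norm_num) (by norm_num), Real.log_pow]
      have := Real.log_two_lt_d9
      have := Real.log_le_sub_one_of_pos (x := (1.036:ℝ)) (by norm_num)
      push_cast; linarith
    have h3 : s/(4144/125) ≤ 19/625*s := by rw [div_le_iff₀ (by norm_num)]; linarith
    linarith
  have hss : (4144/125) * s ≤ s^2 := by nlinarith
  have hi : s⁻¹ ≤ (151/5000) := by
    rw [inv_le_comm₀ (by linarith) (by norm_num)]; norm_num; linarith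
  have hipos : 0 < s⁻¹ := by positivity
  have hlx : (Real.log x/2+1/4)/x ≤ 1 := by
    rw [div_le_one (by rw [hxs]; positivity), hxs]
    rw [hxs] at hlog
    linarith
  have hKs : K * L * s⁻¹ = 5/8 := by
    have : s ≠ 0 := by linarith
    have : K*L = 5/8*s := by rw [hs]; ring
    rw [this]; field_simp
  have hK1 : K * s⁻¹ ≤ K * (151/5000) := by gcongr
  -- multiply out
  have hKs2 : K*L*s = 5/8*s^2 := by nlinarith
  have hKle : K ≤ 19/625*s := by rw [hs]; nlinarith
  have hKs3 : K * s ≤ 19/625*s^2 := by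
    have := mul_le_mul_of_nonneg_right hKle (by linarith : (0:ℝ) ≤ s)
    calc K * s ≤ 19/625*s * s := this
      _ = _ := by ring
  have h' : s^2/4 - 1 - (8/15*s + (151/5000)*62) ≤ 5/24*s^2 + 8/15*(K*s) + 5/8 + 60*((151/5000)*K) + 37/100*(2 * (19/625*s + 251/100)) := by
    rw [hxs] at h hlx hlog
    nlinarith
  linarith

lemma final (hGRH : GRH) (p : ℕ) (hp : p.Prime) (hp' : 10 ^ 9 ≤ p)
    (x : ℝ) (hx : x = (8 / 5 * (2 ^ (p - 1).primeFactors.card - 1) * Real.log p) ^ 2)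
    (hnone : ∀ n : ℕ, IsPrimePow n → (n : ℝ) < x → orderOf (n : ZMod p) ≠ p - 1) : False := by
  have hL : 20.72 ≤ Real.log p := by
    have h1 : Real.log ((10:ℝ)^9) ≤ Real.log p := Real.log_le_log (by norm_num) (by exact_mod_cast hp')
    refine le_trans ?_ h1
    rw [Real.le_log_iff_exp_le (by norm_num)]
    have h2 := Real.exp_one_lt_d9
    have h3 : Real.exp 20.72 = (Real.exp 1)^20 * Real.exp 0.72 := by
      rw [← Real.exp_nat_mul, ← Real.exp_add]; norm_num
    have h4 : Real.exp 0.72 ^ 25 = Real.exp 1 ^ 18 := by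
      rw [← Real.exp_nat_mul, ← Real.exp_nat_mul]; norm_num
    have h5 : Real.exp 0.72 ≤ 2.0545 := by
      refine le_of_pow_le_pow_left₀ (n := 25) (by norm_num) (by norm_num) ?_
      rw [h4]
      calc Real.exp 1 ^ 18 ≤ 2.7182818286 ^ 18 := by gcongr
        _ ≤ _ := by norm_num
    rw [h3]
    calc Real.exp 1 ^ 20 * Real.exp 0.72 ≤ 2.7182818286 ^ 20 * 2.0545 := by gcongr
      _ ≤ _ := by norm_num
  have hK : (1:ℝ) ≤ 2 ^ (p - 1).primeFactors.card - 1 := by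
    have hc : 1 ≤ (p-1).primeFactors.card := by
      rw [Nat.succ_le_iff, Finset.card_pos, Nat.nonempty_primeFactors]
      omega
    have : (2:ℝ)^1 ≤ 2 ^ (p - 1).primeFactors.card := pow_le_pow_right₀ (by norm_num) hc
    linarith
  have hx1 : 1 < x := by
    rw [hx]
    have : 20.72 ≤ (2 ^ (p - 1).primeFactors.card - 1) * Real.log p := by nlinarith
    nlinarith
  exact numerics _ _ x hK hL hx (main_ineq hGRH p hp x hx1 hnone)

end P13

/-- Assume GRH. Let `p ≥ 10^9` be prime and `x = ((8/5)(2^{ω(p-1)} - 1) log p)²`. If no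
prime power `n < x` is a primitive root modulo `p`, then
`√x ≤ 1/10 + 6/√x + (14/9)(2^{ω(p-1)} - 1) log p`. -/
theorem key_inequality (hGRH : GRH) (p : ℕ) (hp : p.Prime) (hp' : 10 ^ 9 ≤ p)
    (x : ℝ) (hx : x = (8 / 5 * (2 ^ (p - 1).primeFactors.card - 1) * Real.log p) ^ 2)
    (hnone : ∀ n : ℕ, IsPrimePow n → (n : ℝ) < x → orderOf (n : ZMod p) ≠ p - 1) :
    Real.sqrt x ≤ 1 / 10 + 6 / Real.sqrt x +
      14 / 9 * (2 ^ (p - 1).primeFactors.card - 1) * Real.log p := by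
  exact (final hGRH p hp hp' x hx hnone).elim
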